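/- Fix a small ε > 0. Assume the complex scalar field φ vanishes at null infinity and at spatial infinity initially, and write D̄φ = (Dφ, r₊^{−1}φ), J^μ[φ] = Im(φ·conj(D^μφ)), F = dA. Then there is a constant C depending only on R, γ₀, ε such that: (interior) for all 0 ≤ τ₁ < τ₂ and all v ≥ (τ₂+R)/2, I^{−1−ε}_0[D̄φ](𝒟_{τ₁}^{τ₂}) + E[φ](Σ_{τ₂}) + E[φ](H̲_v^{τ₁,τ₂}) + ∬_{𝒟_{τ₁}^{τ₂}} |D̸φ|²/(1+r) dx dt ≤ C( E[φ](Σ_{τ₁}) + I^{1+ε}_0[□_Aφ](𝒟_{τ₁}^{τ₂}) + ∬_{𝒟_{τ₁}^{τ₂}} (|F_{Lν}J^ν[φ]| + |F_{L̲ν}J^ν[φ]|) dx dt ); and (exterior) for all τ₂ ≤ τ₁ ≤ 0, I^{−1−ε}_0[D̄φ](𝒟_{τ₁}^{τ₂}) + E[φ](H_{τ₁*}^{−τ₂*}) + E[φ](H̲_{−τ₂*}^{τ₁*}) ≤ C( E[φ](B_{R−τ₁}) + I^{1+ε}_0[□_Aφ](𝒟_{τ₁}^{τ₂}) + ∬_{𝒟_{τ₁}^{τ₂}}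 (|F_{Lν}J^ν[φ]| + |F_{L̲ν}J^ν[φ]|) dx dt ). -/

import Mathlib

/-!  Common setup: Minkowski space ℝ^{3+1}, null frame, Maxwell–Klein–Gordon objects. -/

noncomputable section

open MeasureTheory ENNReal Set Metric

/-- spacetime points of ℝ^{3+1} -/
abbrev V : Type := Fin 4 → ℝ
/-- spatial points -/
abbrev E3 : Type := EuclideanSpace ℝ (Fin 3)

namespace MKG

def oR (x : ℝ) : ℝ≥0∞ := ENNReal.ofReal x

/-! ## Coordinates -/
def tC (p : V) : ℝ := p 0
def rad (p : V) : ℝ := Real.sqrt (∑ i : Fin 3, (p i.succ) ^ 2)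
def uC (p : V) : ℝ := (tC p - rad p) / 2
def vC (p : V) : ℝ := (tC p + rad p) / 2
def rplus (p : V) : ℝ := 1 + rad p
def uplus (p : V) : ℝ := 1 + |uC p|
def taupl (τ : ℝ) : ℝ := 1 + |τ|
/-- Minkowski metric diag(-1,1,1,1) (diagonal entries). -/
def eta : Fin 4 → ℝ := fun μ => if μ = 0 then -1 else 1

/-- spacetime point from time and space -/
def stp (t : ℝ) (x : E3) : V := ![t, x 0, x 1, x 2]
/-- spacetime point from time, radius and angle -/
def pt (t r : ℝ) (ω : E3) : V := ![t, r * ω 0, r * ω 1, r * ω 2]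

/-! ## Derivatives, connection, curvature -/
def pd (μ : Fin 4) (f : V → ℝ) (p : V) : ℝ := fderiv ℝ f p (Pi.single μ 1)
def pdC (μ : Fin 4) (f : V → ℂ) (p : V) : ℂ := fderiv ℝ f p (Pi.single μ 1)

/-- covariant derivative D_μ = ∂_μ + i A_μ -/
def covD (A : V → Fin 4 → ℝ) (μ : Fin 4) (φ : V → ℂ) (p : V) : ℂ :=
  pdC μ φ p + Complex.I * (A p μ) * φ p
/-- second covariant derivative D_μ D_ν φ -/
def covD2 (A : V → Fin 4 → ℝ) (μ ν : Fin 4) (φ : V → ℂ) (p : V) : ℂ :=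
  pdC μ (covD A ν φ) p + Complex.I * (A p μ) * covD A ν φ p
/-- covariant wave operator □_A = D^μ D_μ -/
def boxA (A : V → Fin 4 → ℝ) (φ : V → ℂ) (p : V) : ℂ :=
  ∑ μ, (eta μ : ℂ) * covD2 A μ μ φ p
/-- curvature 2-form F = dA -/
def curv (A : V → Fin 4 → ℝ) (p : V) (μ ν : Fin 4) : ℝ :=
  pd μ (fun q => A q ν) p - pd ν (fun q => A q μ) p

/-- (δG)_ν = ∂^μ G_{μν} (divergence over the first index) -/
def divFst (G : V → Fin 4 → Fin 4 → ℝ) (p : V) (ν : Fin 4) : ℝ :=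
  ∑ μ, eta μ * pd μ (fun q => G q μ ν) p
/-- J_μ = ∂^ν G_{μν} (divergence over the second index) -/
def divSnd (G : V → Fin 4 → Fin 4 → ℝ) (p : V) (μ : Fin 4) : ℝ :=
  ∑ ν, eta ν * pd ν (fun q => G q μ ν) p

/-! ## Null frame and null decompositions -/
/-- outgoing null vector L = ∂_t + ∂_r -/
def Lv (p : V) : V := ![1, p 1 / rad p, p 2 / rad p, p 3 / rad p]
/-- incoming null vector L̲ = ∂_t − ∂_r -/
def Lbv (p : V) : V := ![1, -(p 1 / rad p), -(p 2 / rad p), -(p 3 / rad p)]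
/-- radial vector ∂_r -/
def rv (p : V) : V := ![0, p 1 / rad p, p 2 / rad p, p 3 / rad p]
/-- tangential projection frame P_j = ∂_j − ω_j ∂_r (spanning the spheres'
tangent space; for any covector ξ one has Σ_j ξ(P_j)² = |ξ restricted to the sphere|²). -/
def Pv (p : V) (j : Fin 3) : V :=
  fun μ => if μ = 0 then 0 else
    (if μ = j.succ then 1 else 0) - p j.succ * p μ / rad p ^ 2

/-- evaluation of a 2-form on two vectors -/
def ap2 (G : V → Fin 4 → Fin 4 → ℝ) (X Y : V) (p : V) : ℝ := ∑ μ, ∑ ν, X μ * Y ν * G p μ ν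
/-- evaluation of a 1-form on a vector -/
def ap1 (J : V → Fin 4 → ℝ) (X : V) (p : V) : ℝ := ∑ μ, X μ * J p μ

/-- |α|² = Σ_i F(L,e_i)² -/
def alphaSq (G : V → Fin 4 → Fin 4 → ℝ) (p : V) : ℝ := ∑ j : Fin 3, (ap2 G (Lv p) (Pv p j) p) ^ 2
/-- |α̲|² = Σ_i F(L̲,e_i)² -/
def abarSq (G : V → Fin 4 → Fin 4 → ℝ) (p : V) : ℝ := ∑ j : Fin 3, (ap2 G (Lbv p) (Pv p j) p) ^ 2
/-- ρ = ½ F(L̲,L) -/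
def rhoC (G : V → Fin 4 → Fin 4 → ℝ) (p : V) : ℝ := (1 / 2) * ap2 G (Lbv p) (Lv p) p
/-- σ² = F(e₁,e₂)² -/
def sigmaSq (G : V → Fin 4 → Fin 4 → ℝ) (p : V) : ℝ :=
  (1 / 2) * ∑ j : Fin 3, ∑ k : Fin 3, (ap2 G (Pv p j) (Pv p k) p) ^ 2
/-- |F|², the sum of the squares of all (independent) components -/
def fSq (G : V → Fin 4 → Fin 4 → ℝ) (p : V) : ℝ := (1 / 2) * ∑ μ, ∑ ν, (G p μ ν) ^ 2
/-- squared angular part |J̸|² of a 1-form -/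
def JslashSq (J : V → Fin 4 → ℝ) (p : V) : ℝ := ∑ j : Fin 3, (ap1 J (Pv p j) p) ^ 2

/-! ## Scalar field: null derivatives and energy densities -/
/-- directional covariant derivative -/
def dirD (A : V → Fin 4 → ℝ) (X : V) (φ : V → ℂ) (p : V) : ℂ :=
  ∑ μ, (X μ : ℂ) * covD A μ φ p
/-- the weighted field ψ = rφ -/
def psi (φ : V → ℂ) (p : V) : ℂ := (rad p : ℂ) * φ p
def eDL (A : V → Fin 4 → ℝ) (φ : V → ℂ) (p : V) : ℝ := ‖dirD A (Lv p) φ p‖ ^ 2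
def eDLb (A : V → Fin 4 → ℝ) (φ : V → ℂ) (p : V) : ℝ := ‖dirD A (Lbv p) φ p‖ ^ 2
/-- |D̸φ|² -/
def eDslash (A : V → Fin 4 → ℝ) (φ : V → ℂ) (p : V) : ℝ :=
  ∑ j : Fin 3, ‖dirD A (Pv p j) φ p‖ ^ 2
/-- |Dφ|² -/
def eD (A : V → Fin 4 → ℝ) (φ : V → ℂ) (p : V) : ℝ := ∑ μ, ‖covD A μ φ p‖ ^ 2
/-- |D̄φ|² = |Dφ|² + r₊^{-2}|φ|² -/
def eDbar (A : V → Fin 4 → ℝ) (φ : V → ℂ) (p : V) : ℝ := eD A φ p + ‖φ p‖ ^ 2 / rplus p ^ 2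
/-- the covariant angular Laplacian D̸² -/
def covLapSph (A : V → Fin 4 → ℝ) (φ : V → ℂ) (p : V) : ℂ :=
  ∑ j : Fin 3, dirD A (Pv p j) (fun q => dirD A (Pv q j) φ q) p

/-- the current J_μ[φ] = Im(φ · conj(D_μ φ)) -/
def Jsf (A : V → Fin 4 → ℝ) (φ : V → ℂ) (p : V) (μ : Fin 4) : ℝ :=
  (φ p * (starRingEnd ℂ) (covD A μ φ p)).im
/-- X^μ F_{μν} J^ν[φ] -/
def FJcontr (G : V → Fin 4 → Fin 4 → ℝ) (A : V → Fin 4 → ℝ) (φ : V → ℂ)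
    (X : V → V) (p : V) : ℝ :=
  ∑ ν, (∑ μ, X p μ * G p μ ν) * (eta ν * Jsf A φ p ν)

/-! ## Integrals over spheres, null hypersurfaces and regions -/
/-- integral over the unit sphere (2-dimensional Hausdorff measure) -/
def sphLInt (f : E3 → ℝ≥0∞) : ℝ≥0∞ := ∫⁻ ω in sphere (0 : E3) 1, f ω ∂ μH[2]
/-- sphere integral of a density on the sphere of radius r at time t -/
def sphI (f : V → ℝ) (t r : ℝ) : ℝ≥0∞ := sphLInt (fun ω => oR (f (pt t r ω)))
/-- ∫_{H_u ∩ {v ≥ v₀}} f dv dω -/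
def lIntH (u v0 : ℝ) (f : V → ℝ) : ℝ≥0∞ := ∫⁻ v in Ici v0, sphI f (u + v) (v - u)
/-- ∫_{H_u ∩ {v₀ ≤ v ≤ v₁}} f dv dω -/
def lIntHseg (u v0 v1 : ℝ) (f : V → ℝ) : ℝ≥0∞ := ∫⁻ v in Icc v0 v1, sphI f (u + v) (v - u)
/-- ∫_{H̲_v ∩ {u₀ ≤ u ≤ u₁}} f du dω -/
def lIntHb (v u0 u1 : ℝ) (f : V → ℝ) : ℝ≥0∞ := ∫⁻ u in Icc u0 u1, sphI f (u + v) (v - u)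
/-- integral over the ball {|x| ≤ R'} at time t -/
def lIntBall (t R' : ℝ) (f : V → ℝ) : ℝ≥0∞ := ∫⁻ x in closedBall (0 : E3) R', oR (f (stp t x))
/-- integral over the annulus {r₀ ≤ |x| ≤ r₁} at time t -/
def lIntAnn (t r0 r1 : ℝ) (f : V → ℝ) : ℝ≥0∞ :=
  ∫⁻ x in {x : E3 | r0 ≤ ‖x‖ ∧ ‖x‖ ≤ r1}, oR (f (stp t x))
/-- integral over {|x| ≥ r₀} at time t -/
def lIntExt (t r0 : ℝ) (f : V → ℝ) : ℝ≥0∞ := ∫⁻ x in {x : E3 | r0 ≤ ‖x‖}, oR (f (stp t x))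
/-- integral over all of ℝ³ -/
def lIntE3 (f : E3 → ℝ) : ℝ≥0∞ := ∫⁻ x, oR (f x)

/-! ## The foliation Σ_τ and the regions -/
/-- the foliation parameter through a point: t in the cylinder {r ≤ R}, 2u+R outside -/
def sigP (R : ℝ) (p : V) : ℝ := if rad p ≤ R then tC p else 2 * uC p + R
def SigmaSet (R τ : ℝ) : Set V := {p | 0 ≤ tC p ∧ sigP R p = τ}
/-- interior region 𝒟_{τ₁}^{τ₂} between Σ_{τ₁} and Σ_{τ₂} -/
def Dint (R τ₁ τ₂ : ℝ) : Set V := {p | 0 ≤ tC p ∧ τ₁ ≤ sigP R p ∧ sigP R p ≤ τ₂}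
/-- 𝒟̄_{τ₁}^{τ₂} = 𝒟_{τ₁}^{τ₂} ∩ {r ≥ R} -/
def DbarInt (R τ₁ τ₂ : ℝ) : Set V := Dint R τ₁ τ₂ ∩ {p | R ≤ rad p}
/-- exterior region 𝒟_{τ₁}^{τ₂} (τ₂ ≤ τ₁ ≤ 0), the Cauchy development of
the annulus {R−τ₁ ≤ |x| ≤ R−τ₂} -/
def Dext (R τ₁ τ₂ : ℝ) : Set V :=
  {p | 0 ≤ tC p ∧ uC p ≤ (τ₁ - R) / 2 ∧ vC p ≤ -((τ₂ - R) / 2)}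
/-- 𝒟_τ : future of Σ_τ (τ ≥ 0), resp. 𝒟_τ^{-∞} (τ < 0) -/
def Dfrom (R τ : ℝ) : Set V :=
  if 0 ≤ τ then {p | 0 ≤ tC p ∧ τ ≤ sigP R p} else {p | 0 ≤ tC p ∧ uC p ≤ (τ - R) / 2}
def DbarFrom (R τ : ℝ) : Set V := Dfrom R τ ∩ {p | R ≤ rad p}
def halfSpace : Set V := {p | 0 ≤ tC p}
def regGe (R : ℝ) : Set V := {p | 0 ≤ tC p ∧ R ≤ rad p}
def regLe (R' : ℝ) : Set V := {p | 0 ≤ tC p ∧ rad p ≤ R'}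

/-- weighted spacetime norm  I^{pw}_{qw}[·](D) = ∫_D u₊^{qw} r₊^{pw} g  (g = squared magnitude) -/
def wI (pw qw : ℝ) (g : V → ℝ) (D : Set V) : ℝ≥0∞ :=
  ∫⁻ x in D, oR (uplus x ^ qw * rplus x ^ pw * g x)

/-- surface integral over Σ_τ with the measures dx (ball part) and r²dv dω (null part) -/
def lIntSigE (R τ : ℝ) (f : V → ℝ) : ℝ≥0∞ :=
  if 0 ≤ τ then lIntBall τ R f + lIntH ((τ - R) / 2) ((τ + R) / 2) (fun p => f p * rad p ^ 2)
  else lIntH ((τ - R) / 2) (-((τ - R) / 2)) (fun p => f p * rad p ^ 2)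
/-- integral over Σ_τ with the measure dv′dω (v′ = v on the null part, r in the cylinder) -/
def lIntSig (R τ : ℝ) (f : V → ℝ) : ℝ≥0∞ :=
  if 0 ≤ τ then (∫⁻ r' in Icc (0 : ℝ) R, sphI f τ r') + lIntH ((τ - R) / 2) ((τ + R) / 2) f
  else lIntH ((τ - R) / 2) (-((τ - R) / 2)) f

/-- the starting value v(u) of H_u (t = 0 in the exterior, r = R in the interior) -/
def vStart (R u : ℝ) : ℝ := if u ≤ -R / 2 then -u else 2 * R + u

/-- exterior region in (u,v,ω) coordinates: double null integral ∬_{𝒟_{τ₁}^{τ₂}} f dv dω du -/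
def lIntExtUV (R τ₁ τ₂ : ℝ) (f : V → ℝ) : ℝ≥0∞ :=
  ∫⁻ u in Icc ((τ₂ - R) / 2) ((τ₁ - R) / 2),
    ∫⁻ v in Icc (-u) (-((τ₂ - R) / 2)), sphI f (u + v) (v - u)

/-! ## Energy fluxes -/
def EphiH (A : V → Fin 4 → ℝ) (φ : V → ℂ) (u v0 : ℝ) : ℝ≥0∞ :=
  lIntH u v0 (fun p => (eDL A φ p + eDslash A φ p) * rad p ^ 2)
def EphiHseg (A : V → Fin 4 → ℝ) (φ : V → ℂ) (u v0 v1 : ℝ) : ℝ≥0∞ :=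
  lIntHseg u v0 v1 (fun p => (eDL A φ p + eDslash A φ p) * rad p ^ 2)
def EphiHb (A : V → Fin 4 → ℝ) (φ : V → ℂ) (v u0 u1 : ℝ) : ℝ≥0∞ :=
  lIntHb v u0 u1 (fun p => (eDLb A φ p + eDslash A φ p) * rad p ^ 2)
/-- energy flux E[φ](Σ_τ) -/
def EphiSig (R : ℝ) (A : V → Fin 4 → ℝ) (φ : V → ℂ) (τ : ℝ) : ℝ≥0∞ :=
  if 0 ≤ τ then lIntBall τ R (eD A φ) + EphiH A φ ((τ - R) / 2) ((τ + R) / 2)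
  else EphiH A φ ((τ - R) / 2) (-((τ - R) / 2))

def EfH (G : V → Fin 4 → Fin 4 → ℝ) (u v0 : ℝ) : ℝ≥0∞ :=
  lIntH u v0 (fun p => (rhoC G p ^ 2 + sigmaSq G p + alphaSq G p) * rad p ^ 2)
def EfHseg (G : V → Fin 4 → Fin 4 → ℝ) (u v0 v1 : ℝ) : ℝ≥0∞ :=
  lIntHseg u v0 v1 (fun p => (rhoC G p ^ 2 + sigmaSq G p + alphaSq G p) * rad p ^ 2)
def EfHb (G : V → Fin 4 → Fin 4 → ℝ) (v u0 u1 : ℝ) : ℝ≥0∞ :=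
  lIntHb v u0 u1 (fun p => (rhoC G p ^ 2 + sigmaSq G p + abarSq G p) * rad p ^ 2)
/-- energy flux E[G](Σ_τ) of a 2-form -/
def EfSig (R : ℝ) (G : V → Fin 4 → Fin 4 → ℝ) (τ : ℝ) : ℝ≥0∞ :=
  if 0 ≤ τ then
    lIntBall τ R (fun p => rhoC G p ^ 2 + sigmaSq G p + (1 / 2) * (alphaSq G p + abarSq G p))
      + EfH G ((τ - R) / 2) ((τ + R) / 2)
  else EfH G ((τ - R) / 2) (-((τ - R) / 2))

/-! ## The commutation vector fields Z = {∂_t, Ω_ij} and Lie derivatives -/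
inductive Gen : Type
  | time : Gen
  | rot : Fin 3 → Fin 3 → Gen
  deriving DecidableEq

instance : Fintype Gen := by
  classical
  exact Fintype.ofSurjective
    (fun x : Option (Fin 3 × Fin 3) => (x.casesOn Gen.time (fun ij => Gen.rot ij.1 ij.2) : Gen))
    (by rintro (_ | ⟨i, j⟩); exacts [⟨none, rfl⟩, ⟨some (i, j), rfl⟩])

/-- the vector field of a generator: ∂_t, resp. Ω_ij = x_i ∂_j − x_j ∂_i -/
def genV : Gen → V → V
  | Gen.time, _ => Pi.single 0 1
  | Gen.rot i j, p => fun μ => (if μ = j.succ then p i.succ else 0) - (if μ = i.succ then p j.succ else 0)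

/-- Lie derivative of a 2-form along X -/
def lie2 (X : V → V) (G : V → Fin 4 → Fin 4 → ℝ) (p : V) (μ ν : Fin 4) : ℝ :=
  fderiv ℝ (fun q => G q μ ν) p (X p)
    + ∑ lam, pd μ (fun q => X q lam) p * G p lam ν
    + ∑ lam, pd ν (fun q => X q lam) p * G p μ lam
/-- Lie derivative of a 1-form along X -/
def lie1 (X : V → V) (J : V → Fin 4 → ℝ) (p : V) (μ : Fin 4) : ℝ :=
  fderiv ℝ (fun q => J q μ) p (X p) + ∑ lam, pd μ (fun q => X q lam) p * J p lam

def lie2Iter : List Gen → (V → Fin 4 → Fin 4 → ℝ) → V → Fin 4 → Fin 4 → ℝ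
  | [], G => G
  | g :: w, G => lie2 (genV g) (lie2Iter w G)
def lie1Iter : List Gen → (V → Fin 4 → ℝ) → V → Fin 4 → ℝ
  | [], J => J
  | g :: w, J => lie1 (genV g) (lie1Iter w J)

/-- covariant derivative D_Z along a generator -/
def covDZ (A : V → Fin 4 → ℝ) (g : Gen) (φ : V → ℂ) (p : V) : ℂ := dirD A (genV g p) φ p
def covDZIter (A : V → Fin 4 → ℝ) : List Gen → (V → ℂ) → V → ℂ
  | [], φ => φ
  | g :: w, φ => covDZ A g (covDZIter A w φ)

/-! ## Charge and the chargeless part -/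
def esingle (j : Fin 3) : E3 := EuclideanSpace.single j 1
/-- total charge q₀ = (1/4π) ∫ div E dx computed at t = 0 -/
def charge (G : V → Fin 4 → Fin 4 → ℝ) : ℝ :=
  (1 / (4 * Real.pi)) *
    ∫ x : E3, ∑ i : Fin 3, fderiv ℝ (fun y => G (stp 0 y) 0 i.succ) x (esingle i)
/-- the 2-form dt ∧ dr -/
def dtdr (p : V) (μ ν : Fin 4) : ℝ :=
  (if μ = 0 then 1 else 0) * (if ν = 0 then 0 else p ν / rad p)
    - (if ν = 0 then 1 else 0) * (if μ = 0 then 0 else p μ / rad p)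
/-- the chargeless part F̄ = F − χ_{{r ≥ t+R}} q₀ r^{-2} dt∧dr -/
def Fbar (R q0 : ℝ) (G : V → Fin 4 → Fin 4 → ℝ) (p : V) (μ ν : Fin 4) : ℝ :=
  G p μ ν - (if tC p + R ≤ rad p then q0 / rad p ^ 2 else 0) * dtdr p μ ν

/-! ## The norms m_k, E₀^k, M_k of the Maxwell data and current -/
def twoSqAll (G : V → Fin 4 → Fin 4 → ℝ) (p : V) : ℝ := ∑ μ, ∑ ν, (G p μ ν) ^ 2
/-- |∇J|² (spatial gradient of a 1-form) -/
def grad3Sq1 (J : V → Fin 4 → ℝ) (p : V) : ℝ :=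
  ∑ i : Fin 3, ∑ μ, (pd i.succ (fun q => J q μ) p) ^ 2
def JdensL (J : V → Fin 4 → ℝ) (p : V) : ℝ := (ap1 J (Lv p) p) ^ 2
def JdensLb (J : V → Fin 4 → ℝ) (p : V) : ℝ := (ap1 J (Lbv p) p) ^ 2
def JdensMix (J : V → Fin 4 → ℝ) (p : V) : ℝ :=
  (Real.sqrt (JslashSq J p) + |ap1 J (Lv p) p|) ^ 2

/-- the quantity m_k measuring the current J -/
def mFn (R γ₀ ε : ℝ) (J : V → Fin 4 → ℝ) (q0 : ℝ) (k : ℕ) : ℝ≥0∞ :=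
  (∑ l ∈ Finset.range (k + 1), ∑ w : Fin l → Gen,
      (wI (1 + γ₀) (1 + ε) (JslashSq (lie1Iter (List.ofFn w) J)) (regGe R)
        + wI (2 + γ₀) 0 (JdensL (lie1Iter (List.ofFn w) J)) (regGe R)
        + wI (1 + ε) (1 + γ₀) (JdensMix (lie1Iter (List.ofFn w) J)) halfSpace
        + wI (1 - ε) (1 + γ₀ + 2 * ε) (JdensLb (lie1Iter (List.ofFn w) J)) halfSpace))
  + (∑ l ∈ Finset.range k, ∑ w : Fin l → Gen,
      wI 0 (1 + γ₀) (grad3Sq1 (lie1Iter (List.ofFn w) J)) (regLe (2 * R)))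
  + oR |q0| * ⨆ (τ : ℝ) (_ : τ ≤ 0), oR (taupl τ ^ (1 + γ₀)) *
      ∫⁻ p in Dfrom R τ, oR (|ap1 J (Lbv p) p| / rad p ^ 2)

/-- weighted initial energy E₀^k[G] of a 2-form -/
def E0F (γ₀ : ℝ) (G : V → Fin 4 → Fin 4 → ℝ) (k : ℕ) : ℝ≥0∞ :=
  ∑ l ∈ Finset.range (k + 1), ∑ w : Fin l → Gen,
    lIntE3 (fun x => (1 + ‖x‖) ^ (1 + γ₀) * twoSqAll (lie2Iter (List.ofFn w) G) (stp 0 x))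

/-- M_k = m_k + E₀^k[F̄] + 1 + |q₀| for the Maxwell field G with current δG -/
def MFn (R γ₀ ε : ℝ) (G : V → Fin 4 → Fin 4 → ℝ) (k : ℕ) : ℝ≥0∞ :=
  mFn R γ₀ ε (fun p μ => divSnd G p μ) (charge G) k
    + E0F γ₀ (Fbar R (charge G) G) k + 1 + oR |charge G|

/-! ## The norms E₀^k[φ], 𝓔_k[φ] of the scalar field -/
def E0phi (γ₀ : ℝ) (A : V → Fin 4 → ℝ) (φ : V → ℂ) (k : ℕ) : ℝ≥0∞ :=
  ∑ l ∈ Finset.range (k + 1), ∑ w : Fin l → Gen, ∑ j : Fin 3,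
    lIntE3 (fun x =>
      (1 + ‖x‖) ^ (1 + γ₀) * ‖covDZIter A (List.ofFn w) (covD A j.succ φ) (stp 0 x)‖ ^ 2)

def calE (γ₀ ε : ℝ) (A : V → Fin 4 → ℝ) (φ : V → ℂ) (k : ℕ) : ℝ≥0∞ :=
  E0phi γ₀ A φ k
    + ∑ l ∈ Finset.range (k + 1), ∑ w : Fin l → Gen,
        (wI (1 + γ₀) (1 + ε) (fun p => ‖covDZIter A (List.ofFn w) (boxA A φ) p‖ ^ 2) halfSpace
          + wI (1 + ε) (1 + γ₀) (fun p => ‖covDZIter A (List.ofFn w) (boxA A φ) p‖ ^ 2) halfSpace)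

/-! ## Mixed L_u²L_v^∞L_ω² and L_v²L_u^∞L_ω² norms on 𝒟̄_τ -/
def mixULV (R τ : ℝ) (f : V → ℝ) : ℝ≥0∞ :=
  if 0 ≤ τ then
    ∫⁻ u in Ici ((τ - R) / 2), ⨆ v ∈ Ici (u + R), sphI (fun p => f p ^ 2) (u + v) (v - u)
  else
    ∫⁻ u in Iic ((τ - R) / 2), ⨆ v ∈ Ici (-u), sphI (fun p => f p ^ 2) (u + v) (v - u)
def mixVLU (R τ : ℝ) (f : V → ℝ) : ℝ≥0∞ :=
  if 0 ≤ τ then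
    ∫⁻ v in Ici ((τ + R) / 2),
      ⨆ u ∈ Icc ((τ - R) / 2) (v - R), sphI (fun p => f p ^ 2) (u + v) (v - u)
  else
    ∫⁻ v in Ici (-((τ - R) / 2)),
      ⨆ u ∈ Icc (-v) ((τ - R) / 2), sphI (fun p => f p ^ 2) (u + v) (v - u)

/-! ## Asymptotic vanishing conditions -/
def vanishNullInf (φ : V → ℂ) : Prop :=
  ∀ u : ℝ, ∀ ω : E3, ‖ω‖ = 1 →
    Filter.Tendsto (fun v => φ (pt (u + v) (v - u) ω)) Filter.atTop (nhds 0)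
def vanishSpatialInf (φ : V → ℂ) : Prop :=
  ∀ ω : E3, ‖ω‖ = 1 → Filter.Tendsto (fun r => φ (pt 0 r ω)) Filter.atTop (nhds 0)

/-! ## Structural properties -/
def AntiSym (G : V → Fin 4 → Fin 4 → ℝ) : Prop := ∀ p μ ν, G p μ ν = -G p ν μ
def Bianchi (G : V → Fin 4 → Fin 4 → ℝ) : Prop :=
  ∀ (p : V) (γ' μ ν : Fin 4),
    pd γ' (fun q => G q μ ν) p + pd μ (fun q => G q ν γ') p + pd ν (fun q => G q γ' μ) p = 0
def Smooth2Form (G : V → Fin 4 → Fin 4 → ℝ) : Prop := ∀ μ ν, ContDiff ℝ (⊤ : ℕ∞) (fun p => G p μ ν)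

/-! ## Initial data (for the Cauchy problem) -/
def pd3 (j : Fin 3) (f : E3 → ℝ) (x : E3) : ℝ := fderiv ℝ f x (esingle j)
def pd3C (j : Fin 3) (f : E3 → ℂ) (x : E3) : ℂ := fderiv ℝ f x (esingle j)
/-- rotation Ω_ij acting on a scalar -/
def rotSc (i j : Fin 3) (f : E3 → ℝ) (x : E3) : ℝ := x i * pd3 j f x - x j * pd3 i f x
def rotScC (i j : Fin 3) (f : E3 → ℂ) (x : E3) : ℂ :=
  (x i : ℂ) * pd3C j f x - (x j : ℂ) * pd3C i f x
/-- rotation Ω_ij acting on a vector field (Lie derivative) -/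
def rotVF (i j : Fin 3) (W : E3 → Fin 3 → ℝ) (x : E3) (k : Fin 3) : ℝ :=
  rotSc i j (fun y => W y k) x - ((if k = j then W x i else 0) - (if k = i then W x j else 0))

abbrev Gen3 : Type := Fin 3 × Fin 3

def rotScIter : List Gen3 → (E3 → ℝ) → E3 → ℝ
  | [], f => f
  | g :: w, f => rotSc g.1 g.2 (rotScIter w f)
def rotScCIter : List Gen3 → (E3 → ℂ) → E3 → ℂ
  | [], f => f
  | g :: w, f => rotScC g.1 g.2 (rotScCIter w f)
def rotVFIter : List Gen3 → (E3 → Fin 3 → ℝ) → E3 → Fin 3 → ℝ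
  | [], W => W
  | g :: w, W => rotVF g.1 g.2 (rotVFIter w W)
def pd3Iter : List (Fin 3) → (E3 → ℝ) → E3 → ℝ
  | [], f => f
  | j :: w, f => pd3 j (pd3Iter w f)
def pd3CIter : List (Fin 3) → (E3 → ℂ) → E3 → ℂ
  | [], f => f
  | j :: w, f => pd3C j (pd3CIter w f)
def pd3VFIter (w : List (Fin 3)) (W : E3 → Fin 3 → ℝ) (x : E3) (k : Fin 3) : ℝ :=
  pd3Iter w (fun y => W y k) x

/-- the weighted Sobolev norm 𝓜 of the Maxwell initial data (E^{df}, H) -/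
def calM (γ₀ : ℝ) (Edf Hd : E3 → Fin 3 → ℝ) : ℝ≥0∞ :=
  ∑ l ∈ Finset.range 3,
    ((∑ w : Fin l → Gen3, lIntE3 (fun x => (1 + ‖x‖) ^ (1 + γ₀) *
        ((∑ k : Fin 3, (rotVFIter (List.ofFn w) Edf x k) ^ 2)
          + ∑ k : Fin 3, (rotVFIter (List.ofFn w) Hd x k) ^ 2)))
      + ∑ w : Fin l → Fin 3, lIntE3 (fun x => (1 + ‖x‖) ^ (1 + γ₀) *
        ((∑ k : Fin 3, (pd3VFIter (List.ofFn w) Edf x k) ^ 2)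
          + ∑ k : Fin 3, (pd3VFIter (List.ofFn w) Hd x k) ^ 2)))

/-- the weighted Sobolev norm 𝓔 of the scalar initial data (φ₀, φ₁) -/
def calEdata (γ₀ : ℝ) (φ₀ φ₁ : E3 → ℂ) : ℝ≥0∞ :=
  ∑ l ∈ Finset.range 3,
    ((∑ w : Fin l → Gen3, lIntE3 (fun x => (1 + ‖x‖) ^ (1 + γ₀) *
        ((∑ j : Fin 3, ‖pd3C j (rotScCIter (List.ofFn w) φ₀) x‖ ^ 2)
          + ‖rotScCIter (List.ofFn w) φ₁ x‖ ^ 2)))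
      + (∑ w : Fin (l + 1) → Fin 3,
          lIntE3 (fun x => (1 + ‖x‖) ^ (1 + γ₀) * ‖pd3CIter (List.ofFn w) φ₀ x‖ ^ 2))
      + (∑ w : Fin l → Fin 3,
          lIntE3 (fun x => (1 + ‖x‖) ^ (1 + γ₀) * ‖pd3CIter (List.ofFn w) φ₁ x‖ ^ 2))
      + lIntE3 (fun x => (1 + ‖x‖) ^ (1 + γ₀) * ‖φ₀ x‖ ^ 2))

/-- the Maxwell–Klein–Gordon equations (for t ≥ 0) -/
def IsMKG (A : V → Fin 4 → ℝ) (φ : V → ℂ) : Prop :=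
  ∀ p : V, 0 ≤ tC p →
    (∀ μ, divSnd (curv A) p μ = Jsf A φ p μ) ∧ boxA A φ p = 0

/-- the solution attains the initial data (E, H, φ₀, φ₁) -/
def InitData (A : V → Fin 4 → ℝ) (φ : V → ℂ) (Ed Hd : E3 → Fin 3 → ℝ)
    (φ₀ φ₁ : E3 → ℂ) : Prop :=
  (∀ (x : E3) (i : Fin 3), curv A (stp 0 x) 0 i.succ = Ed x i)
    ∧ (∀ x : E3, curv A (stp 0 x) 2 3 = Hd x 0 ∧ curv A (stp 0 x) 3 1 = Hd x 1
        ∧ curv A (stp 0 x) 1 2 = Hd x 2)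
    ∧ (∀ x : E3, φ (stp 0 x) = φ₀ x) ∧ (∀ x : E3, covD A 0 φ (stp 0 x) = φ₁ x)

/-- the compatibility (constraint) conditions -/
def Admissible (Ed Hd : E3 → Fin 3 → ℝ) (φ₀ φ₁ : E3 → ℂ) : Prop :=
  (∀ x : E3, (∑ i : Fin 3, pd3 i (fun y => Ed y i) x) = (φ₀ x * (starRingEnd ℂ) (φ₁ x)).im)
    ∧ (∀ x : E3, (∑ i : Fin 3, pd3 i (fun y => Hd y i) x) = 0)

end MKG

namespace MKG

section

/-- Surface measure of the unit sphere, viewed as a measure on space. -/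
def sphMeas : Measure E3 := (μH[2] : Measure E3).restrict (sphere (0 : E3) 1)

/-- Spherical coordinates on the unit sphere. -/
def sphCoord (y : Fin 2 → ℝ) : E3 :=
  !₂[Real.sin (y 0) * Real.cos (y 1), Real.sin (y 0) * Real.sin (y 1), Real.cos (y 0)]

lemma contDiff_sphCoord : ContDiff ℝ 1 sphCoord := by
  rw [contDiff_euclidean]
  intro i
  fin_cases i <;> simp [sphCoord] <;> fun_prop

lemma norm_sq_e3 (x : E3) : ‖x‖ ^ 2 = x 0 ^ 2 + x 1 ^ 2 + x 2 ^ 2 := by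
  rw [EuclideanSpace.norm_sq_eq, Fin.sum_univ_three]
  simp

lemma sphere_subset_image_sphCoord :
    sphere (0 : E3) 1 ⊆ sphCoord '' closedBall (0 : Fin 2 → ℝ) 4 := by
  intro ω hω
  have h1 : ω 0 ^ 2 + ω 1 ^ 2 + ω 2 ^ 2 = 1 := by
    rw [← norm_sq_e3, mem_sphere_zero_iff_norm.1 hω]; norm_num
  set z : ℂ := ⟨ω 0, ω 1⟩ with hz
  have hzn : ‖z‖ = Real.sqrt (1 - ω 2 ^ 2) := by
    rw [Complex.norm_def, Complex.normSq_mk]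
    congr 1; linarith
  refine ⟨![Real.arccos (ω 2), Complex.arg z], ?_, ?_⟩
  · rw [mem_closedBall_zero_iff, pi_norm_le_iff_of_nonneg (by norm_num)]
    intro i
    have hpi := Real.pi_lt_four
    fin_cases i
    · simp only [Fin.zero_eta, Matrix.cons_val_zero, Real.norm_eq_abs]
      rw [abs_of_nonneg (Real.arccos_nonneg _)]
      exact (Real.arccos_le_pi _).trans hpi.le
    · simp only [Fin.mk_one, Matrix.cons_val_one, Real.norm_eq_abs]
      exact (Complex.abs_arg_le_pi _).trans hpi.le
  · have ha : -1 ≤ ω 2 := by nlinarith [sq_nonneg (ω 0), sq_nonneg (ω 1)]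
    have hb : ω 2 ≤ 1 := by nlinarith [sq_nonneg (ω 0), sq_nonneg (ω 1)]
    ext i
    fin_cases i
    · simp [sphCoord, Real.sin_arccos, ← hzn, Complex.norm_mul_cos_arg, hz]
    · simp [sphCoord, Real.sin_arccos, ← hzn, Complex.norm_mul_sin_arg, hz]
    · simp [sphCoord, Real.cos_arccos ha hb]

lemma hausdorff_sphere_lt_top : (μH[2] : Measure E3) (sphere (0 : E3) 1) < ∞ := by
  obtain ⟨K, hK⟩ := (contDiff_sphCoord.locallyLipschitz.locallyLipschitzOn
    (s := closedBall 0 4)).exists_lipschitzOnWith_of_compact (isCompact_closedBall _ _)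
  refine (measure_mono sphere_subset_image_sphCoord).trans_lt ?_
  refine (hK.hausdorffMeasure_image_le (by norm_num)).trans_lt ?_
  have : (μH[2] : Measure (Fin 2 → ℝ)) = volume := by
    simpa using hausdorffMeasure_pi_real (ι := Fin 2)
  rw [this]
  exact ENNReal.mul_lt_top (by simp) (isCompact_closedBall _ _).measure_lt_top

lemma hausdorff_sphere_pos : 0 < (μH[2] : Measure E3) (sphere (0 : E3) 1) := by
  have hl : LipschitzWith 1 (fun x : E3 => (![x 0, x 1] : Fin 2 → ℝ)) := by
    refine LipschitzWith.of_dist_le_mul fun x y => ?_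
    rw [NNReal.coe_one, one_mul, dist_pi_le_iff dist_nonneg]
    intro i
    fin_cases i
    · simpa [dist_eq_norm] using PiLp.norm_apply_le (x - y) 0
    · simpa [dist_eq_norm] using PiLp.norm_apply_le (x - y) 1
  have h := hl.hausdorffMeasure_image_le (d := 2) (by norm_num) (sphere (0 : E3) 1)
  have hv : (μH[2] : Measure (Fin 2 → ℝ)) = volume := by
    simpa using hausdorffMeasure_pi_real (ι := Fin 2)
  rw [hv] at h
  have hs : ball (0 : Fin 2 → ℝ) (1 / 2) ⊆
      (fun x : E3 => (![x 0, x 1] : Fin 2 → ℝ)) '' sphere (0 : E3) 1 := by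
    intro y hy
    rw [mem_ball_zero_iff, pi_norm_lt_iff (by norm_num)] at hy
    have h0 := hy 0
    have h1 := hy 1
    rw [Real.norm_eq_abs, abs_lt] at h0 h1
    have hnn : 0 ≤ 1 - y 0 ^ 2 - y 1 ^ 2 := by nlinarith
    refine ⟨!₂[y 0, y 1, Real.sqrt (1 - y 0 ^ 2 - y 1 ^ 2)], ?_, ?_⟩
    · rw [mem_sphere_zero_iff_norm, ← sq_eq_sq₀ (norm_nonneg _) (by norm_num), norm_sq_e3]
      simp [Real.sq_sqrt hnn]
    · ext i; fin_cases i <;> simp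
  have hb : 0 < (volume : Measure (Fin 2 → ℝ)) (ball 0 (1 / 2)) :=
    measure_ball_pos _ _ (by norm_num)
  have := (hb.trans_le (measure_mono hs)).trans_le h
  simpa using this

instance : IsFiniteMeasure sphMeas :=
  ⟨by rw [sphMeas, Measure.restrict_apply_univ]; exact hausdorff_sphere_lt_top⟩

lemma sphMeas_univ_pos : 0 < sphMeas univ := by
  rw [sphMeas, Measure.restrict_apply_univ]; exact hausdorff_sphere_pos

lemma sphMeas_restrict : sphMeas.restrict (sphere (0 : E3) 1) = sphMeas := by
  rw [sphMeas, Measure.restrict_restrict isClosed_sphere.measurableSet, inter_self]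

lemma ae_sphMeas : ∀ᵐ ω ∂sphMeas, ‖ω‖ = 1 := by
  filter_upwards [ae_restrict_mem isClosed_sphere.measurableSet] with ω hω
  simpa using hω

lemma sphMeas_map (e : E3 ≃ₗᵢ[ℝ] E3) : sphMeas.map e = sphMeas := by
  have h := e.toIsometryEquiv.measurePreserving_hausdorffMeasure 2
  have h2 := h.restrict_preimage (s := sphere (0 : E3) 1) isClosed_sphere.measurableSet
  have h3 : (e.toIsometryEquiv : E3 → E3) ⁻¹' sphere (0 : E3) 1 = sphere 0 1 := by
    ext x; simp
  rw [h3] at h2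
  exact h2.map_eq

section Pointwise

open scoped Pointwise

/-- The cone surface measure of the unit sphere, viewed as a measure on space. -/
def coneMeas : Measure E3 := (volume : Measure E3).toSphere.map Subtype.val

instance : IsFiniteMeasure coneMeas := by unfold coneMeas; infer_instance

lemma coneMeas_apply {s : Set E3} (hs : MeasurableSet s) :
    coneMeas s = 3 * volume (Ioo (0 : ℝ) 1 • (s ∩ sphere (0 : E3) 1)) := by
  rw [coneMeas, Measure.map_apply measurable_subtype_coe hs,
    Measure.toSphere_apply' _ (measurable_subtype_coe hs), Subtype.image_preimage_coe,
    inter_comm]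
  simp

lemma coneMeas_univ_pos : 0 < coneMeas univ := by
  rw [coneMeas, Measure.map_apply measurable_subtype_coe MeasurableSet.univ, preimage_univ,
    pos_iff_ne_zero, Ne, Measure.measure_univ_eq_zero]
  exact Measure.toSphere_ne_zero _

lemma ae_coneMeas : ∀ᵐ ω ∂coneMeas, ‖ω‖ = 1 := by
  have : MeasurableSet {ω : E3 | ‖ω‖ = 1} := measurableSet_eq_fun (by fun_prop) (by fun_prop)
  rw [coneMeas, ae_map_iff measurable_subtype_coe.aemeasurable this]
  exact Filter.Eventually.of_forall fun ω => by simp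

lemma coneMeas_map (e : E3 ≃ₗᵢ[ℝ] E3) : coneMeas.map e = coneMeas := by
  ext s hs
  have hm : Measurable e := e.continuous.measurable
  rw [Measure.map_apply hm hs, coneMeas_apply (hm hs), coneMeas_apply hs]
  congr 1
  have : Ioo (0 : ℝ) 1 • (e ⁻¹' s ∩ sphere (0 : E3) 1) =
      e ⁻¹' (Ioo (0 : ℝ) 1 • (s ∩ sphere (0 : E3) 1)) := by
    ext x
    simp only [mem_smul, mem_inter_iff, mem_preimage, mem_sphere_iff_norm, sub_zero]
    constructor
    · rintro ⟨a, ha, y, ⟨hy, hy1⟩, rfl⟩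
      exact ⟨a, ha, e y, ⟨hy, by simpa using hy1⟩, by simp⟩
    · rintro ⟨a, ha, y, ⟨hy, hy1⟩, h⟩
      exact ⟨a, ha, e.symm y, ⟨by simpa using hy, by simpa using hy1⟩, by
        rw [← map_smul, h]; simp⟩
  rw [this]
  have hp := e.measurePreserving
  have := hp.measure_preimage_equiv (f := e.toHomeomorph.toMeasurableEquiv)
    (Ioo (0 : ℝ) 1 • (s ∩ sphere (0 : E3) 1))
  exact this

end Pointwise

lemma exists_isometry_of_norm_eq {x y : E3} (h : ‖x‖ = ‖y‖) :
    ∃ e : E3 ≃ₗᵢ[ℝ] E3, e x = y :=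
  ⟨_, Submodule.reflection_sub h⟩

lemma measure_closedBall_eq {μ : Measure E3} (hμ : ∀ e : E3 ≃ₗᵢ[ℝ] E3, μ.map e = μ)
    {x y : E3} (h : ‖x‖ = ‖y‖) (r : ℝ) : μ (closedBall x r) = μ (closedBall y r) := by
  obtain ⟨e, rfl⟩ := exists_isometry_of_norm_eq h
  conv_rhs => rw [← hμ e]
  rw [Measure.map_apply e.continuous.measurable isClosed_closedBall.measurableSet]
  congr 1
  ext z
  simp [dist_eq_norm]

end

section

open scoped NNReal

section Uniqueness

lemma measure_closedBall_pos_of_invariant {μ : Measure E3} (hμ : ∀ e : E3 ≃ₗᵢ[ℝ] E3, μ.map e = μ)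
    (hμs : ∀ᵐ ω ∂μ, ‖ω‖ = 1) (hμ0 : 0 < μ univ) {x : E3} (hx : ‖x‖ = 1) {r : ℝ} (hr : 0 < r) :
    0 < μ (closedBall x r) := by
  rw [pos_iff_ne_zero]
  intro h0
  have h1 : μ (sphere (0 : E3) 1) = 0 := by
    refine (isCompact_sphere (0 : E3) 1).measure_zero_of_nhdsWithin fun y hy => ?_
    refine ⟨closedBall y r, mem_nhdsWithin_of_mem_nhds (closedBall_mem_nhds y hr), ?_⟩
    rw [← h0]
    exact measure_closedBall_eq hμ (by rw [hx]; simpa using hy) r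
  have h2 : μ (sphere (0 : E3) 1)ᶜ = 0 := by
    have : (sphere (0 : E3) 1)ᶜ = {ω | ¬ ‖ω‖ = 1} := by ext; simp
    rw [this]; exact hμs
  have h3 := measure_union_null h1 h2
  rw [union_compl_self] at h3
  exact hμ0.ne' h3

variable {μ ν : Measure E3} [IsFiniteMeasure μ] [IsFiniteMeasure ν]

lemma lintegral_ball_swap (f : E3 → ℝ≥0∞) (hf : Measurable f) (r : ℝ) :
    ∫⁻ x, ν (closedBall x r) * f x ∂μ = ∫⁻ y, ∫⁻ x in closedBall y r, f x ∂μ ∂ν := by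
  have hm : Measurable (fun p : E3 × E3 => ({p : E3 × E3 | dist p.1 p.2 ≤ r}).indicator
      (fun p => f p.1) p) :=
    (hf.comp measurable_fst).indicator (measurableSet_le (by fun_prop) (by fun_prop))
  have h1 : ∀ x, ν (closedBall x r) * f x = ∫⁻ y, ({p : E3 × E3 | dist p.1 p.2 ≤ r}).indicator
      (fun p => f p.1) (x, y) ∂ν := by
    intro x
    have : (fun y => ({p : E3 × E3 | dist p.1 p.2 ≤ r}).indicator (fun p => f p.1) (x, y))
        = (closedBall x r).indicator (fun _ => f x) := by
      ext y; simp [indicator, dist_comm]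
    rw [this, lintegral_indicator_const isClosed_closedBall.measurableSet, mul_comm]
  have h2 : ∀ y, ∫⁻ x in closedBall y r, f x ∂μ =
      ∫⁻ x, ({p : E3 × E3 | dist p.1 p.2 ≤ r}).indicator (fun p => f p.1) (x, y) ∂μ := by
    intro y
    rw [← lintegral_indicator isClosed_closedBall.measurableSet]
    congr 1
  simp_rw [h1, h2]
  exact lintegral_lintegral_swap hm.aemeasurable

lemma lintegral_le_of_invariant (hμ : ∀ e : E3 ≃ₗᵢ[ℝ] E3, μ.map e = μ)
    (hν : ∀ e : E3 ≃ₗᵢ[ℝ] E3, ν.map e = ν) (hμs : ∀ᵐ ω ∂μ, ‖ω‖ = 1)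
    (hνs : ∀ᵐ ω ∂ν, ‖ω‖ = 1) (hμ0 : 0 < μ univ)
    (f : E3 → ℝ≥0) (hf : Continuous f) :
    ν univ * ∫⁻ x, f x ∂μ ≤ μ univ * ∫⁻ x, f x ∂ν := by
  have key : ∀ δ : ℝ≥0, 0 < δ →
      ν univ * ∫⁻ x, f x ∂μ ≤ μ univ * (∫⁻ x, f x ∂ν + δ * ν univ) := by
    intro δ hδ
    have huc := (isCompact_sphere (0 : E3) 1).uniformContinuousOn_of_continuous hf.continuousOn
    rw [Metric.uniformContinuousOn_iff_le] at huc
    obtain ⟨r, hr, hfr⟩ := huc δ hδ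
    set e : E3 := EuclideanSpace.single 0 1 with he
    have hen : ‖e‖ = 1 := by simp [he]
    set g := μ (closedBall e r) with hg
    set h := ν (closedBall e r) with hh
    have hgx : ∀ᵐ x ∂ν, μ (closedBall x r) = g := by
      filter_upwards [hνs] with x hx using measure_closedBall_eq hμ (by rw [hx, hen]) r
    have hhx : ∀ᵐ x ∂μ, ν (closedBall x r) = h := by
      filter_upwards [hμs] with x hx using measure_closedBall_eq hν (by rw [hx, hen]) r
    have hgpos : 0 < g := measure_closedBall_pos_of_invariant hμ hμs hμ0 hen hr
    have hgtop : g ≠ ∞ := measure_ne_top _ _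
    have h1 : h * μ univ = g * ν univ := by
      have := lintegral_ball_swap (μ := μ) (ν := ν) (fun _ => 1) measurable_const r
      simp only [mul_one, lintegral_const, Measure.restrict_apply_univ, one_mul] at this
      rw [lintegral_congr_ae hhx, lintegral_congr_ae hgx, lintegral_const, lintegral_const] at this
      exact this
    have h2 : h * ∫⁻ x, f x ∂μ ≤ g * (∫⁻ x, f x ∂ν + δ * ν univ) := by
      have hsw := lintegral_ball_swap (μ := μ) (ν := ν) (fun x => (f x : ℝ≥0∞))
        (by fun_prop) r
      have e1 : ∫⁻ x, ν (closedBall x r) * f x ∂μ = h * ∫⁻ x, f x ∂μ := by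
        rw [← lintegral_const_mul _ (by fun_prop)]
        refine lintegral_congr_ae ?_
        filter_upwards [hhx] with x hx
        rw [hx]
      rw [← e1, hsw]
      have e2 : ∫⁻ x, (f x : ℝ≥0∞) ∂ν + δ * ν univ = ∫⁻ x, ((f x : ℝ≥0∞) + δ) ∂ν := by
        rw [lintegral_add_right _ measurable_const, lintegral_const]
      rw [e2, ← lintegral_const_mul _ (by fun_prop)]
      refine lintegral_mono_ae ?_
      filter_upwards [hνs, hgx] with y hy hgy
      calc ∫⁻ x in closedBall y r, (f x : ℝ≥0∞) ∂μ
          ≤ ∫⁻ x in closedBall y r, ((f y : ℝ≥0∞) + δ) ∂μ := by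
            refine lintegral_mono_ae ?_
            filter_upwards [ae_restrict_mem isClosed_closedBall.measurableSet,
              ae_restrict_of_ae hμs] with x hx hx1
            have := hfr x (by simpa using hx1) y (by simpa using hy) hx
            rw [NNReal.dist_eq] at this
            have h3 := (abs_le.1 this).2
            have h4 : f x ≤ f y + δ := by
              rw [← NNReal.coe_le_coe]; push_cast; linarith
            exact_mod_cast h4
        _ = g * ((f y : ℝ≥0∞) + δ) := by
            rw [lintegral_const, Measure.restrict_apply_univ, hgy, mul_comm]
    have h3 : g * (ν univ * ∫⁻ x, f x ∂μ) ≤ g * (μ univ * (∫⁻ x, f x ∂ν + δ * ν univ)) := by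
      calc g * (ν univ * ∫⁻ x, f x ∂μ) = μ univ * (h * ∫⁻ x, f x ∂μ) := by
            rw [← mul_assoc, ← h1]; ring
        _ ≤ μ univ * (g * (∫⁻ x, f x ∂ν + δ * ν univ)) := by gcongr
        _ = _ := by ring
    exact (ENNReal.mul_le_mul_iff_right hgpos.ne' hgtop).1 h3
  refine ENNReal.le_of_forall_pos_le_add fun η hη _ => ?_
  have hM : μ univ * ν univ ≠ ∞ := ENNReal.mul_ne_top (measure_ne_top _ _) (measure_ne_top _ _)
  set M := (μ univ * ν univ).toNNReal with hMdef
  have hMc : (M : ℝ≥0∞) = μ univ * ν univ := ENNReal.coe_toNNReal hM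
  refine (key (η / (M + 1)) (by positivity)).trans ?_
  rw [mul_add]
  gcongr
  calc μ univ * (((η / (M + 1) : ℝ≥0) : ℝ≥0∞) * ν univ)
      = ((η / (M + 1) * M : ℝ≥0) : ℝ≥0∞) := by push_cast [hMc]; ring
    _ ≤ η := by
        have : η / (M + 1) * M ≤ η := by
          rw [div_mul_eq_mul_div, div_le_iff₀ (by positivity)]
          gcongr; exact le_self_add
        exact_mod_cast this

lemma eq_smul_of_invariant (hμ : ∀ e : E3 ≃ₗᵢ[ℝ] E3, μ.map e = μ)
    (hν : ∀ e : E3 ≃ₗᵢ[ℝ] E3, ν.map e = ν) (hμs : ∀ᵐ ω ∂μ, ‖ω‖ = 1)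
    (hνs : ∀ᵐ ω ∂ν, ‖ω‖ = 1) (hμ0 : 0 < μ univ) (hν0 : 0 < ν univ) :
    ∃ κ : ℝ≥0, 0 < κ ∧ ν = κ • μ := by
  have hμt := measure_ne_top μ univ
  have hνt := measure_ne_top ν univ
  have hκt : ν univ / μ univ ≠ ∞ := (ENNReal.div_lt_top hνt hμ0.ne').ne
  refine ⟨(ν univ / μ univ).toNNReal,
    ENNReal.toNNReal_pos (ENNReal.div_pos hν0.ne' hμt).ne' hκt, ?_⟩
  refine ext_of_forall_lintegral_eq_of_IsFiniteMeasure fun f => ?_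
  have h := le_antisymm (lintegral_le_of_invariant hμ hν hμs hνs hμ0 f f.continuous)
    (lintegral_le_of_invariant hν hμ hνs hμs hν0 f f.continuous)
  rw [lintegral_smul_measure, ENNReal.smul_def, ENNReal.coe_toNNReal hκt, smul_eq_mul,
    ENNReal.div_eq_inv_mul, mul_assoc, h, ← mul_assoc, ENNReal.inv_mul_cancel hμ0.ne' hμt, one_mul]

end Uniqueness

lemma exists_coneMeas_eq : ∃ κ : ℝ≥0, 0 < κ ∧ coneMeas = κ • sphMeas :=
  eq_smul_of_invariant sphMeas_map coneMeas_map ae_sphMeas ae_coneMeas sphMeas_univ_pos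
    coneMeas_univ_pos

/-- Polar coordinates in space with respect to the Hausdorff measure on the sphere. -/
lemma exists_polar : ∃ κ : ℝ≥0, 0 < κ ∧ ∀ f : E3 → ℝ≥0∞, Measurable f →
    ∫⁻ x, f x = κ * ∫⁻ r in Ioi (0 : ℝ), ENNReal.ofReal (r ^ 2) * ∫⁻ ω, f (r • ω) ∂sphMeas := by
  obtain ⟨κ, hκ, hc⟩ := exists_coneMeas_eq
  refine ⟨κ, hκ, fun f hf => ?_⟩
  have hfin : Module.finrank ℝ E3 - 1 = 2 := by simp
  have h1 : ∫⁻ x, f x = ∫⁻ x : ({(0 : E3)}ᶜ : Set E3), f x ∂((volume : Measure E3).comap (↑)) := by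
    rw [lintegral_subtype_comap (measurableSet_singleton _).compl, restrict_compl_singleton]
  have h2 := ((volume : Measure E3).measurePreserving_homeomorphUnitSphereProd).lintegral_comp_emb
    (Homeomorph.measurableEmbedding _)
    (fun p : sphere (0 : E3) 1 × Ioi (0 : ℝ) => f ((p.2 : ℝ) • (p.1 : E3)))
  have h3 : ∀ x : ({(0 : E3)}ᶜ : Set E3),
      ((homeomorphUnitSphereProd E3 x).2 : ℝ) • ((homeomorphUnitSphereProd E3 x).1 : E3) = x := by
    intro x
    have hx : ‖(x : E3)‖ ≠ 0 := norm_ne_zero_iff.2 x.2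
    simp [smul_smul, mul_inv_cancel₀ hx]
  simp only [h3] at h2
  rw [h1, h2, hfin, lintegral_prod_symm _ (by fun_prop), Measure.volumeIoiPow,
    lintegral_withDensity_eq_lintegral_mul _ (by fun_prop)
      (Measurable.lintegral_prod_left' (f := fun p : sphere (0 : E3) 1 × Ioi (0 : ℝ) =>
        f ((p.2 : ℝ) • (p.1 : E3))) (by fun_prop))]
  have h4 : ∀ r : ℝ, ∫⁻ ω : sphere (0 : E3) 1, f (r • (ω : E3)) ∂(volume : Measure E3).toSphere
      = κ * ∫⁻ ω, f (r • ω) ∂sphMeas := by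
    intro r
    have : ∫⁻ ω, f (r • ω) ∂coneMeas = _ := lintegral_map (by fun_prop) measurable_subtype_coe
    rw [← this, hc, lintegral_smul_measure]; rfl
  simp only [Pi.mul_apply, h4]
  rw [lintegral_subtype_comap measurableSet_Ioi
    (fun r : ℝ => ENNReal.ofReal (r ^ 2) * (κ * ∫⁻ ω, f (r • ω) ∂sphMeas)),
    ← lintegral_const_mul']
  · congr 1; ext r; ring
  · simp

end

section

section SphereIntegral

lemma integrable_sphMeas {E : Type*} [NormedAddCommGroup E] {g : E3 → E} (hg : Continuous g) : Integrable g sphMeas := by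
  have h := hg.continuousOn.integrableOn_compact (μ := sphMeas) (isCompact_sphere (0 : E3) 1)
  rwa [IntegrableOn, sphMeas_restrict] at h

lemma continuous_sphMeas_integral {H E : Type*} [TopologicalSpace H] [FirstCountableTopology H]
    [LocallyCompactSpace H] [NormedAddCommGroup E] [NormedSpace ℝ E] {F : H × E3 → E} (hF : Continuous F) :
    Continuous fun x => ∫ ω, F (x, ω) ∂sphMeas := by
  have h := continuous_parametric_integral_of_continuous (μ := sphMeas)
    (f := fun x ω => F (x, ω)) (by exact hF) (isCompact_sphere (0 : E3) 1)
  simpa only [sphMeas_restrict] using h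

variable {H : Type*} [NormedAddCommGroup H] [NormedSpace ℝ H]

lemma hasFDerivAt_sphMeas_integral [ProperSpace H] {F : H × E3 → ℝ} (hF : ContDiff ℝ 1 F) (x : H) :
    HasFDerivAt (fun x => ∫ ω, F (x, ω) ∂sphMeas)
      (∫ ω, (fderiv ℝ F (x, ω)).comp (ContinuousLinearMap.inl ℝ H E3) ∂sphMeas) x := by
  have hc : Continuous fun p : H × E3 => (fderiv ℝ F p).comp (ContinuousLinearMap.inl ℝ H E3) :=
    (hF.continuous_fderiv one_ne_zero).clm_comp continuous_const
  obtain ⟨C, hC⟩ := ((isCompact_closedBall x 1).prod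
    (isCompact_sphere (0 : E3) 1)).exists_bound_of_continuousOn hc.continuousOn
  refine hasFDerivAt_integral_of_dominated_of_fderiv_le (bound := fun _ => C)
    (closedBall_mem_nhds x one_pos) ?_ ?_ ?_ ?_ (integrable_const _) ?_
    (F' := fun x ω => (fderiv ℝ F (x, ω)).comp (ContinuousLinearMap.inl ℝ H E3))
  · exact .of_forall fun y => (integrable_sphMeas (hF.continuous.comp (by fun_prop))).1
  · exact integrable_sphMeas (hF.continuous.comp (by fun_prop))
  · exact (integrable_sphMeas (hc.comp (by fun_prop : Continuous fun ω : E3 => (x, ω)))).1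
  · filter_upwards [ae_sphMeas] with ω hω y hy
    exact hC (y, ω) ⟨hy, by simpa using hω⟩
  · refine .of_forall fun ω y _ => ?_
    have h1 := (hF.differentiable one_ne_zero (y, ω)).hasFDerivAt
    have h2 : HasFDerivAt (fun y : H => (y, ω)) (ContinuousLinearMap.inl ℝ H E3) y :=
      hasFDerivAt_prodMk_left y ω
    exact h1.comp y h2

lemma sphMeas_integral_fderiv_apply {F : H × E3 → ℝ} (hF : ContDiff ℝ 1 F) (x e : H) :
    (∫ ω, (fderiv ℝ F (x, ω)).comp (ContinuousLinearMap.inl ℝ H E3) ∂sphMeas) e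
      = ∫ ω, fderiv ℝ F (x, ω) (e, 0) ∂sphMeas := by
  have hc : Continuous fun p : H × E3 => (fderiv ℝ F p).comp (ContinuousLinearMap.inl ℝ H E3) :=
    (hF.continuous_fderiv one_ne_zero).clm_comp continuous_const
  exact ContinuousLinearMap.integral_apply
    (integrable_sphMeas (hc.comp (by fun_prop : Continuous fun ω : E3 => (x, ω)))) e

end SphereIntegral

/-- Rotation by the angle `θ` in the `(i, j)` coordinate plane. -/
def planeRot (i j : Fin 3) (θ : ℝ) (x : E3) : E3 :=
  x + ((Real.cos θ - 1) * x i - Real.sin θ * x j) • esingle i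
    + (Real.sin θ * x i + (Real.cos θ - 1) * x j) • esingle j

lemma norm_planeRot {i j : Fin 3} (hij : i ≠ j) (θ : ℝ) (x : E3) :
    ‖planeRot i j θ x‖ = ‖x‖ := by
  rw [← sq_eq_sq₀ (norm_nonneg _) (norm_nonneg _), norm_sq_e3, norm_sq_e3]
  have h := Real.sin_sq_add_cos_sq θ
  fin_cases i <;> fin_cases j <;> first | exact absurd rfl hij | skip
  all_goals
    simp [planeRot, esingle]
    first
    | linear_combination (x 0 ^ 2 + x 1 ^ 2) * h
    | linear_combination (x 0 ^ 2 + x 2 ^ 2) * h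
    | linear_combination (x 1 ^ 2 + x 2 ^ 2) * h

/-- The rotation in a coordinate plane as a linear isometry. -/
def planeRotEquiv {i j : Fin 3} (hij : i ≠ j) (θ : ℝ) : E3 ≃ₗᵢ[ℝ] E3 :=
  LinearIsometry.toLinearIsometryEquiv
    { toFun := planeRot i j θ
      map_add' := fun x y => by
        ext k; simp [planeRot]; ring
      map_smul' := fun c x => by
        ext k; simp [planeRot]; ring
      norm_map' := norm_planeRot hij θ } rfl

lemma contDiff_planeRot (i j : Fin 3) :
    ContDiff ℝ 1 fun p : ℝ × E3 => planeRot i j p.1 p.2 := by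
  unfold planeRot
  fun_prop

lemma hasDerivAt_planeRot (i j : Fin 3) (x : E3) :
    HasDerivAt (fun θ => planeRot i j θ x) (x i • esingle j - x j • esingle i) 0 := by
  unfold planeRot
  have hc := Real.hasDerivAt_cos 0
  have hs := Real.hasDerivAt_sin 0
  have h := (((((hc.sub_const 1).mul_const (x i)).sub (hs.mul_const (x j))).smul_const
    (esingle i)).const_add x).add
    (((hs.mul_const (x i)).add ((hc.sub_const 1).mul_const (x j))).smul_const (esingle j))
  refine h.congr_deriv ?_
  simp only [Real.sin_zero, Real.cos_zero]
  module

/-- The integral over the sphere of an angular derivative vanishes. -/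
lemma sphMeas_integral_rotation {i j : Fin 3} (hij : i ≠ j) {g : E3 → ℝ} (hg : ContDiff ℝ 1 g) :
    ∫ ω, fderiv ℝ g ω (ω i • esingle j - ω j • esingle i) ∂sphMeas = 0 := by
  have hF : ContDiff ℝ 1 fun p : ℝ × E3 => g (planeRot i j p.1 p.2) :=
    hg.comp (contDiff_planeRot i j)
  have h1 := (hasFDerivAt_sphMeas_integral hF (0 : ℝ)).hasDerivAt
  rw [sphMeas_integral_fderiv_apply hF] at h1
  have h2 : (fun θ : ℝ => ∫ ω, g (planeRot i j θ ω) ∂sphMeas)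
      = fun _ => ∫ ω, g ω ∂sphMeas := by
    funext θ
    conv_rhs => rw [← sphMeas_map (planeRotEquiv hij θ)]
    rw [integral_map (planeRotEquiv hij θ).continuous.aemeasurable
      hg.continuous.aestronglyMeasurable]
    rfl
  simp only [h2] at h1
  rw [← h1.unique (hasDerivAt_const _ _)]
  refine integral_congr_ae (.of_forall fun ω => ?_)
  have h0 : planeRot i j 0 ω = ω := by simp [planeRot]
  have hd : HasFDerivAt (fun p : ℝ × E3 => g (planeRot i j p.1 p.2)) _ (0, ω) :=
    (hF.differentiable one_ne_zero _).hasFDerivAt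
  have hp : HasDerivAt (fun θ : ℝ => (θ, ω)) ((1 : ℝ), (0 : E3)) 0 :=
    (hasDerivAt_id _).prodMk (hasDerivAt_const _ _)
  have h3 : HasDerivAt (fun θ => g (planeRot i j θ ω)) _ 0 := 
    HasFDerivAt.comp_hasDerivAt (f := fun θ : ℝ => (θ, ω)) (0 : ℝ) hd hp
  have hgd : HasFDerivAt g (fderiv ℝ g ω) (planeRot i j 0 ω) := by
    rw [h0]; exact (hg.differentiable one_ne_zero _).hasFDerivAt
  have h4 : HasDerivAt (fun θ => g (planeRot i j θ ω)) _ 0 :=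
    hgd.comp_hasDerivAt (0 : ℝ) (hasDerivAt_planeRot i j ω)
  exact h4.unique h3

end

section

lemma contDiff_sphMeas_integral {H : Type*} [NormedAddCommGroup H] [NormedSpace ℝ H]
    [ProperSpace H] {F : H × E3 → ℝ} (hF : ContDiff ℝ 1 F) :
    ContDiff ℝ 1 fun x => ∫ ω, F (x, ω) ∂sphMeas := by
  refine contDiff_one_iff_hasFDerivAt.2
    ⟨_, continuous_sphMeas_integral (F := fun p : H × E3 =>
      (fderiv ℝ F p).comp (ContinuousLinearMap.inl ℝ H E3)) ?_, hasFDerivAt_sphMeas_integral hF⟩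
  exact (hF.continuous_fderiv one_ne_zero).clm_comp continuous_const

/-- The embedding of space into the time slice `t = 0`. -/
def spaceEmb : E3 →L[ℝ] V :=
  LinearMap.toContinuousLinearMap
    { toFun := fun x => stp 0 x
      map_add' := fun x y => by ext k; fin_cases k <;> simp [stp]
      map_smul' := fun c x => by ext k; fin_cases k <;> simp [stp] }

lemma spaceEmb_apply (x : E3) : spaceEmb x = stp 0 x := rfl

lemma pt_eq (t r : ℝ) (ω : E3) : pt t r ω = t • (Pi.single 0 1 : V) + r • spaceEmb ω := by
  ext k; fin_cases k <;> simp [pt, spaceEmb_apply, stp]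

lemma spaceEmb_eq_sum (x : E3) : spaceEmb x = ∑ i : Fin 3, x i • (Pi.single i.succ 1 : V) := by
  ext k; fin_cases k <;> simp [spaceEmb_apply, stp, Fin.sum_univ_three, Pi.single_apply]

lemma contDiff_pt {n : WithTop ℕ∞} : ContDiff ℝ n fun p : (ℝ × ℝ) × E3 => pt p.1.1 p.1.2 p.2 := by
  simp only [pt_eq]
  fun_prop

lemma continuous_pt : Continuous fun p : (ℝ × ℝ) × E3 => pt p.1.1 p.1.2 p.2 :=
  contDiff_pt (n := 0).continuous

lemma hasFDerivAt_pt (z : ℝ × ℝ) (ω : E3) :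
    ∃ T : (ℝ × ℝ) × E3 →L[ℝ] V, HasFDerivAt (fun p : (ℝ × ℝ) × E3 => pt p.1.1 p.1.2 p.2) T (z, ω) ∧
      ∀ a b x, T ((a, b), x) = a • (Pi.single 0 1 : V) + b • spaceEmb ω + z.2 • spaceEmb x := by
  let p0 : (ℝ × ℝ) × E3 := (z, ω)
  have h1 : HasFDerivAt (fun p : (ℝ × ℝ) × E3 => p.1.1) _ p0 :=
    ((ContinuousLinearMap.fst ℝ ℝ ℝ).comp (ContinuousLinearMap.fst ℝ (ℝ × ℝ) E3)).hasFDerivAt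
  have h2 : HasFDerivAt (fun p : (ℝ × ℝ) × E3 => p.1.2) _ p0 :=
    ((ContinuousLinearMap.snd ℝ ℝ ℝ).comp (ContinuousLinearMap.fst ℝ (ℝ × ℝ) E3)).hasFDerivAt
  have h3 : HasFDerivAt (fun p : (ℝ × ℝ) × E3 => spaceEmb p.2) _ p0 :=
    spaceEmb.hasFDerivAt.comp p0 hasFDerivAt_snd
  have h := (h1.smul_const (Pi.single 0 1 : V)).add (h2.smul h3)
  have he : (fun p : (ℝ × ℝ) × E3 => pt p.1.1 p.1.2 p.2)
      = fun p => p.1.1 • (Pi.single 0 1 : V) + p.1.2 • spaceEmb p.2 := funext fun p => pt_eq _ _ _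
  refine ⟨_, by rw [he]; exact h, fun a b x => ?_⟩
  simp [p0]
  module

section RadialFlux

variable {g : V → ℝ} (hg : ContDiff ℝ 1 g)

include hg in
lemma fderiv_comp_pt (z : ℝ × ℝ) (ω : E3) (a b : ℝ) (x : E3) :
    fderiv ℝ (fun p : (ℝ × ℝ) × E3 => g (pt p.1.1 p.1.2 p.2)) (z, ω) ((a, b), x)
      = a * pd 0 g (pt z.1 z.2 ω) + ∑ i : Fin 3, (b * ω i + z.2 * x i) * pd i.succ g (pt z.1 z.2 ω) := by
  obtain ⟨T, hT, hTe⟩ := hasFDerivAt_pt z ω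
  have h : HasFDerivAt (fun p : (ℝ × ℝ) × E3 => g (pt p.1.1 p.1.2 p.2)) _ (z, ω) :=
    ((hg.differentiable one_ne_zero (pt z.1 z.2 ω)).hasFDerivAt).comp (z, ω) hT
  rw [h.fderiv]
  simp only [ContinuousLinearMap.comp_apply, hTe, spaceEmb_eq_sum, map_add, map_smul, map_sum,
    smul_eq_mul, pd, Finset.mul_sum, ← Finset.sum_add_distrib, add_assoc]
  congr 1
  exact Finset.sum_congr rfl fun i _ => by ring

end RadialFlux

/-- The radial component of the spatial part of a vector field. -/
def radialPart (Y : Fin 4 → V → ℝ) (z : ℝ × ℝ) (ω : E3) : ℝ :=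
  ∑ i : Fin 3, ω i * Y i.succ (pt z.1 z.2 ω)

/-- The divergence theorem on spheres, in the coordinates of the ambient space. -/
lemma sphMeas_integral_div {Y : Fin 4 → V → ℝ} (hY : ∀ μ, ContDiff ℝ 1 (Y μ)) (z : ℝ × ℝ) :
    ∫ ω, (z.2 * ∑ i : Fin 3, pd i.succ (Y i.succ) (pt z.1 z.2 ω)
      - 2 * ∑ i : Fin 3, ω i * Y i.succ (pt z.1 z.2 ω)
      - z.2 * ∑ i : Fin 3, ω i * ∑ j : Fin 3, ω j * pd j.succ (Y i.succ) (pt z.1 z.2 ω)) ∂sphMeas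
      = 0 := by
  have hh : ∀ i : Fin 3, ContDiff ℝ 1 fun ω : E3 => Y i.succ (pt z.1 z.2 ω) := fun i =>
    ((hY i.succ).comp contDiff_pt).comp (contDiff_prodMk_right z)
  have hd : ∀ (i : Fin 3) (ω x : E3), fderiv ℝ (fun ω : E3 => Y i.succ (pt z.1 z.2 ω)) ω x
      = z.2 * ∑ j : Fin 3, x j * pd j.succ (Y i.succ) (pt z.1 z.2 ω) := by
    intro i ω x
    have h1 : HasFDerivAt (fun p : (ℝ × ℝ) × E3 => Y i.succ (pt p.1.1 p.1.2 p.2)) _ (z, ω) :=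
      (((hY i.succ).comp contDiff_pt).differentiable one_ne_zero _).hasFDerivAt
    have h2 : HasFDerivAt (fun ω : E3 => Y i.succ (pt z.1 z.2 ω)) _ ω :=
      HasFDerivAt.comp (g := fun p : (ℝ × ℝ) × E3 => Y i.succ (pt p.1.1 p.1.2 p.2)) ω h1
        (hasFDerivAt_prodMk_right z ω)
    rw [h2.fderiv]
    have := fderiv_comp_pt (hY i.succ) z ω 0 0 x
    simp only [zero_mul, zero_add, mul_assoc] at this
    rw [Finset.mul_sum, ← this]
    rfl
  let G : Fin 3 → Fin 3 → E3 → ℝ := fun i j ω =>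
    ω i * Y j.succ (pt z.1 z.2 ω) - ω j * Y i.succ (pt z.1 z.2 ω)
  have hG : ∀ i j, ContDiff ℝ 1 (G i j) := fun i j =>
    ((by fun_prop : ContDiff ℝ 1 fun ω : E3 => ω i).mul (hh j)).sub
      ((by fun_prop : ContDiff ℝ 1 fun ω : E3 => ω j).mul (hh i))
  have hGd : ∀ i j (ω x : E3), fderiv ℝ (G i j) ω x
      = x i * Y j.succ (pt z.1 z.2 ω) + ω i * (z.2 * ∑ k : Fin 3, x k * pd k.succ (Y j.succ) (pt z.1 z.2 ω))
        - (x j * Y i.succ (pt z.1 z.2 ω) + ω j * (z.2 * ∑ k : Fin 3, x k * pd k.succ (Y i.succ) (pt z.1 z.2 ω))) := by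
    intro i j ω x
    have hp : ∀ i : Fin 3, HasFDerivAt (fun ω : E3 => ω i) (EuclideanSpace.proj i : E3 →L[ℝ] ℝ) ω :=
      fun i => (EuclideanSpace.proj i : E3 →L[ℝ] ℝ).hasFDerivAt
    have hf : ∀ i : Fin 3, HasFDerivAt (fun ω : E3 => Y i.succ (pt z.1 z.2 ω)) _ ω := fun i =>
      ((hh i).differentiable one_ne_zero ω).hasFDerivAt
    have h : HasFDerivAt (G i j) _ ω := ((hp i).mul (hf j)).sub ((hp j).mul (hf i))
    rw [h.fderiv, ← hd, ← hd]
    simp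
    ring
  have hint : ∀ i j, Integrable
      (fun ω : E3 => fderiv ℝ (G i j) ω (ω i • esingle j - ω j • esingle i)) sphMeas := fun i j => by
    refine integrable_sphMeas (((hG i j).continuous_fderiv one_ne_zero).clm_apply ?_)
    fun_prop
  have h01 := sphMeas_integral_rotation (by decide : (0 : Fin 3) ≠ 1) (hG 0 1)
  have h02 := sphMeas_integral_rotation (by decide : (0 : Fin 3) ≠ 2) (hG 0 2)
  have h12 := sphMeas_integral_rotation (by decide : (1 : Fin 3) ≠ 2) (hG 1 2)
  calc _ = ∫ ω, (fderiv ℝ (G 0 1) ω (ω 0 • esingle 1 - ω 1 • esingle 0)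
        + fderiv ℝ (G 0 2) ω (ω 0 • esingle 2 - ω 2 • esingle 0)
        + fderiv ℝ (G 1 2) ω (ω 1 • esingle 2 - ω 2 • esingle 1)) ∂sphMeas := by
        refine integral_congr_ae ?_
        filter_upwards [ae_sphMeas] with ω hω
        have hω2 : ω 0 ^ 2 + ω 1 ^ 2 + ω 2 ^ 2 = 1 := by rw [← norm_sq_e3, hω, one_pow]
        simp only [hGd, Fin.sum_univ_three]
        simp [esingle]
        linear_combination (-(z.2 * pd 1 (Y 1) (pt z.1 z.2 ω)) - z.2 * pd 2 (Y 2) (pt z.1 z.2 ω)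
          - z.2 * pd 3 (Y 3) (pt z.1 z.2 ω)) * hω2
    _ = 0 := by
        have h := (hint 0 1).add (hint 0 2)
        simp only [Pi.add_def] at h
        rw [integral_add h (hint 1 2), integral_add (hint 0 1) (hint 0 2), h01, h02, h12]
        simp

/-- The density of the flux through the time slices, weighted by the area of the spheres. -/
def fluxT (Y : Fin 4 → V → ℝ) (z : ℝ × ℝ) : ℝ := z.2 ^ 2 * ∫ ω, Y 0 (pt z.1 z.2 ω) ∂sphMeas
/-- The density of the radial flux, weighted by the area of the spheres. -/
def fluxR (Y : Fin 4 → V → ℝ) (z : ℝ × ℝ) : ℝ := z.2 ^ 2 * ∫ ω, radialPart Y z ω ∂sphMeas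
/-- The divergence of a vector field on spacetime. -/
def divV (Y : Fin 4 → V → ℝ) (p : V) : ℝ := ∑ μ, pd μ (Y μ) p

lemma contDiff_fluxT {Y : Fin 4 → V → ℝ} (hY : ∀ μ, ContDiff ℝ 1 (Y μ)) :
    ContDiff ℝ 1 (fluxT Y) :=
  (contDiff_snd.pow 2).mul (contDiff_sphMeas_integral ((hY 0).comp contDiff_pt))

lemma contDiff_radialPart {Y : Fin 4 → V → ℝ} (hY : ∀ μ, ContDiff ℝ 1 (Y μ)) :
    ContDiff ℝ 1 fun p : (ℝ × ℝ) × E3 => radialPart Y p.1 p.2 :=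
  ContDiff.sum fun i _ => (by fun_prop : ContDiff ℝ 1 fun p : (ℝ × ℝ) × E3 => p.2 i).mul
    ((hY i.succ).comp contDiff_pt)

lemma contDiff_fluxR {Y : Fin 4 → V → ℝ} (hY : ∀ μ, ContDiff ℝ 1 (Y μ)) :
    ContDiff ℝ 1 (fluxR Y) :=
  (contDiff_snd.pow 2).mul (contDiff_sphMeas_integral (contDiff_radialPart hY))

lemma continuous_pd {g : V → ℝ} (hg : ContDiff ℝ 1 g) (μ : Fin 4) : Continuous (pd μ g) :=
  (hg.continuous_fderiv one_ne_zero).clm_apply continuous_const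

lemma fluxT_fluxR_div {Y : Fin 4 → V → ℝ} (hY : ∀ μ, ContDiff ℝ 1 (Y μ)) (z : ℝ × ℝ) :
    fderiv ℝ (fluxT Y) z (1, 0) + fderiv ℝ (fluxR Y) z (0, 1)
      = z.2 ^ 2 * ∫ ω, divV Y (pt z.1 z.2 ω) ∂sphMeas := by
  have hsq : HasFDerivAt (fun z : ℝ × ℝ => z.2 ^ 2) _ z := (hasFDerivAt_snd (𝕜 := ℝ) (p := z)).pow 2
  have hT : HasFDerivAt (fluxT Y) _ z :=
    hsq.mul (hasFDerivAt_sphMeas_integral ((hY 0).comp contDiff_pt) z)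
  have hR : HasFDerivAt (fluxR Y) _ z :=
    hsq.mul (hasFDerivAt_sphMeas_integral (contDiff_radialPart hY) z)
  have hrd : ∀ ω, fderiv ℝ (fun p : (ℝ × ℝ) × E3 => radialPart Y p.1 p.2) (z, ω) ((0, 1), 0)
      = ∑ i : Fin 3, ω i * ∑ j : Fin 3, ω j * pd j.succ (Y i.succ) (pt z.1 z.2 ω) := by
    intro ω
    have hp : ∀ i : Fin 3, HasFDerivAt (fun p : (ℝ × ℝ) × E3 => p.2 i)
        ((EuclideanSpace.proj i : E3 →L[ℝ] ℝ).comp (ContinuousLinearMap.snd ℝ (ℝ × ℝ) E3)) (z, ω) :=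
      fun i => ((EuclideanSpace.proj i : E3 →L[ℝ] ℝ).comp
        (ContinuousLinearMap.snd ℝ (ℝ × ℝ) E3)).hasFDerivAt
    have h : HasFDerivAt (fun p : (ℝ × ℝ) × E3 => radialPart Y p.1 p.2) _ (z, ω) :=
      HasFDerivAt.fun_sum fun i _ => (hp i).mul
        ((((hY i.succ).comp contDiff_pt).differentiable one_ne_zero (z, ω)).hasFDerivAt)
    rw [h.fderiv]
    simp only [sum_apply, add_apply, smul_apply, ContinuousLinearMap.comp_apply, smul_eq_mul]
    refine Finset.sum_congr rfl fun i _ => ?_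
    have := fderiv_comp_pt (hY i.succ) z ω 0 1 0
    simp at this
    simp
    left
    exact this
  have hpt : Continuous fun ω : E3 => pt z.1 z.2 ω := 
    continuous_pt.comp (by fun_prop : Continuous fun ω : E3 => (z, ω))
  have hc : ∀ i : Fin 3, Continuous fun ω : E3 => Y i.succ (pt z.1 z.2 ω) := fun i =>
    (hY _).continuous.comp hpt
  have hcd : ∀ μ ν, Continuous fun ω : E3 => pd μ (Y ν) (pt z.1 z.2 ω) := fun μ ν =>
    (continuous_pd (hY ν) μ).comp hpt
  have hkey := sphMeas_integral_div hY z
  have i1 : Integrable (fun ω => ∑ i : Fin 3, pd i.succ (Y i.succ) (pt z.1 z.2 ω)) sphMeas :=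
    integrable_sphMeas (by fun_prop)
  have i2 : Integrable (fun ω => ∑ i : Fin 3, ω i * Y i.succ (pt z.1 z.2 ω)) sphMeas :=
    integrable_sphMeas (by fun_prop)
  have i3 : Integrable (fun ω => ∑ i : Fin 3, ω i * ∑ j : Fin 3,
      ω j * pd j.succ (Y i.succ) (pt z.1 z.2 ω)) sphMeas :=
    integrable_sphMeas (by fun_prop)
  have i0 : Integrable (fun ω => pd 0 (Y 0) (pt z.1 z.2 ω)) sphMeas :=
    integrable_sphMeas (hcd 0 0)
  have i12 := (i1.const_mul z.2).sub (i2.const_mul 2)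
  simp only [Pi.sub_def] at i12
  rw [integral_sub i12 (i3.const_mul _),
    integral_sub (i1.const_mul _) (i2.const_mul _), integral_const_mul, integral_const_mul,
    integral_const_mul] at hkey
  have hdiv : ∫ ω, divV Y (pt z.1 z.2 ω) ∂sphMeas = ∫ ω, pd 0 (Y 0) (pt z.1 z.2 ω) ∂sphMeas
      + ∫ ω, ∑ i : Fin 3, pd i.succ (Y i.succ) (pt z.1 z.2 ω) ∂sphMeas := by
    rw [← integral_add i0 i1]
    simp only [divV, Fin.sum_univ_succ (n := 3)]
  rw [hT.fderiv, hR.fderiv, hdiv]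
  simp only [add_apply, smul_apply]
  rw [sphMeas_integral_fderiv_apply ((hY 0).comp contDiff_pt),
    sphMeas_integral_fderiv_apply (contDiff_radialPart hY)]
  have e0 : ∫ ω, fderiv ℝ (Y 0 ∘ fun p : (ℝ × ℝ) × E3 => pt p.1.1 p.1.2 p.2) (z, ω) ((1, 0), 0) ∂sphMeas
      = ∫ ω, pd 0 (Y 0) (pt z.1 z.2 ω) ∂sphMeas := by
    refine integral_congr_ae (.of_forall fun ω => ?_)
    have := fderiv_comp_pt (hY 0) z ω 1 0 0
    simp at this
    exact this
  simp only [hrd, e0]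
  simp [radialPart]
  linear_combination (-z.2) * hkey

end

section

/-- The real inner product on `ℂ`. -/
def ip (a b : ℂ) : ℝ := (a * (starRingEnd ℂ) b).re

lemma ip_eq (a b : ℂ) : ip a b = a.re * b.re + a.im * b.im := by simp [ip]

lemma ip_self (a : ℂ) : ip a a = ‖a‖ ^ 2 := by
  rw [ip_eq, ← Complex.normSq_eq_norm_sq, Complex.normSq_apply]

lemma abs_ip_le (a b : ℂ) : |ip a b| ≤ ‖a‖ * ‖b‖ := by
  refine (Complex.abs_re_le_norm _).trans ?_
  simp

variable {A : V → Fin 4 → ℝ}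

lemma hasFDerivAt_ip {a b : V → ℂ} {p : V} (ha : DifferentiableAt ℝ a p)
    (hb : DifferentiableAt ℝ b p) (x : V) :
    fderiv ℝ (fun q => ip (a q) (b q)) p x
      = ip (fderiv ℝ a p x) (b p) + ip (a p) (fderiv ℝ b p x) := by
  have h1 : HasFDerivAt (fun q => ip (a q) (b q)) _ p :=
    Complex.reCLM.hasFDerivAt.comp p
      (ha.hasFDerivAt.mul (Complex.conjCLE.toContinuousLinearMap.hasFDerivAt.comp p hb.hasFDerivAt))
  rw [h1.fderiv]
  simp [ip_eq]
  ring

lemma pd_ip (μ : Fin 4) {a b : V → ℂ} {p : V} (ha : DifferentiableAt ℝ a p)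
    (hb : DifferentiableAt ℝ b p) :
    pd μ (fun q => ip (a q) (b q)) p = ip (covD A μ a p) (b p) + ip (a p) (covD A μ b p) := by
  rw [pd, hasFDerivAt_ip ha hb]
  simp [covD, pdC, ip_eq]
  ring

lemma contDiff_ip {n : WithTop ℕ∞} {a b : V → ℂ} (ha : ContDiff ℝ n a) (hb : ContDiff ℝ n b) :
    ContDiff ℝ n fun q => ip (a q) (b q) :=
  Complex.reCLM.contDiff.comp
    (ha.mul (Complex.conjCLE.toContinuousLinearMap.contDiff.comp hb))

lemma contDiff_covD (hA : ContDiff ℝ (⊤ : ℕ∞) A) {f : V → ℂ} (hf : ContDiff ℝ (⊤ : ℕ∞) f)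
    (μ : Fin 4) : ContDiff ℝ (⊤ : ℕ∞) (covD A μ f) := by
  have h1 : ContDiff ℝ (⊤ : ℕ∞) (pdC μ f) :=
    (hf.fderiv_right (m := (⊤ : ℕ∞)) (by simp)).clm_apply contDiff_const
  have h2 : ContDiff ℝ (⊤ : ℕ∞) fun p => ((A p μ : ℝ) : ℂ) :=
    Complex.ofRealCLM.contDiff.comp (contDiff_pi.1 hA μ)
  exact h1.add ((contDiff_const.mul h2).mul hf)

lemma curv_antisymm (p : V) (μ ν : Fin 4) : curv A p μ ν = -curv A p ν μ := by
  simp [curv]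

lemma covD2_eq (hA : ContDiff ℝ (⊤ : ℕ∞) A) {f : V → ℂ} (hf : ContDiff ℝ (⊤ : ℕ∞) f)
    (p : V) (μ ν : Fin 4) :
    covD2 A μ ν f p = fderiv ℝ (fderiv ℝ f) p (Pi.single μ 1) (Pi.single ν 1)
      + Complex.I * (pd μ (fun q => A q ν) p * f p + A p ν * pdC μ f p + A p μ * pdC ν f p)
      - A p μ * A p ν * f p := by
  have hf' : DifferentiableAt ℝ (fderiv ℝ f) p :=
    (hf.fderiv_right (m := (⊤ : ℕ∞)) (by simp)).differentiable (by simp) p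
  have hAν : DifferentiableAt ℝ (fun q => A q ν) p := (contDiff_pi.1 hA ν).differentiable (by simp) p
  have h1 : HasFDerivAt (pdC ν f) _ p := hf'.hasFDerivAt.clm_apply (hasFDerivAt_const _ _)
  have h2 : HasFDerivAt (fun q => Complex.I * (A q ν : ℂ) * f q) _ p :=
    ((Complex.ofRealCLM.hasFDerivAt.comp p hAν.hasFDerivAt).const_mul Complex.I).mul
      (hf.differentiable (by simp) p).hasFDerivAt
  have h : HasFDerivAt (covD A ν f) _ p := h1.add h2
  rw [covD2, pdC, h.fderiv]
  simp [covD, pdC, pd]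
  ring_nf
  simp
  ring

lemma covD2_comm (hA : ContDiff ℝ (⊤ : ℕ∞) A) {f : V → ℂ} (hf : ContDiff ℝ (⊤ : ℕ∞) f)
    (p : V) (μ ν : Fin 4) :
    covD2 A μ ν f p - covD2 A ν μ f p = Complex.I * curv A p μ ν * f p := by
  have hs : IsSymmSndFDerivAt ℝ f p := (hf.contDiffAt).isSymmSndFDerivAt (by
    simp only [minSmoothness_of_isRCLikeNormedField]
    exact WithTop.coe_le_coe.2 (le_top : (2 : ℕ∞) ≤ ⊤))
  rw [covD2_eq hA hf, covD2_eq hA hf, hs.eq (Pi.single μ 1) (Pi.single ν 1), curv]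
  push_cast
  ring

lemma covD_real_mul {f : V → ℝ} {a : V → ℂ} {p : V} (hf : DifferentiableAt ℝ f p)
    (ha : DifferentiableAt ℝ a p) (μ : Fin 4) :
    covD A μ (fun q => (f q : ℂ) * a q) p = pd μ f p * a p + f p * covD A μ a p := by
  have h : HasFDerivAt (fun q => (f q : ℂ) * a q) _ p :=
    (Complex.ofRealCLM.hasFDerivAt.comp p hf.hasFDerivAt).mul ha.hasFDerivAt
  rw [covD, pdC, h.fderiv]
  simp [covD, pdC, pd]
  ring

lemma covD_add {a b : V → ℂ} {p : V} (ha : DifferentiableAt ℝ a p)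
    (hb : DifferentiableAt ℝ b p) (μ : Fin 4) :
    covD A μ (fun q => a q + b q) p = covD A μ a p + covD A μ b p := by
  have h : HasFDerivAt (fun q => a q + b q) _ p := ha.hasFDerivAt.add hb.hasFDerivAt
  rw [covD, pdC, h.fderiv]
  simp [covD, pdC]
  ring

lemma pd_coord (μ ν : Fin 4) (p : V) :
    pd μ (fun q : V => q ν) p = if ν = μ then 1 else 0 := by
  have h : HasFDerivAt (fun q : V => q ν) (ContinuousLinearMap.proj ν : V →L[ℝ] ℝ) p :=
    (ContinuousLinearMap.proj ν : V →L[ℝ] ℝ).hasFDerivAt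
  rw [pd, h.fderiv]
  simp [Pi.single_apply]

/-- `d` lists the partial derivatives of `f` at `p`. -/
def HasPd (f : V → ℝ) (p : V) (d : Fin 4 → ℝ) : Prop :=
  DifferentiableAt ℝ f p ∧ ∀ μ, pd μ f p = d μ

/-- `d` lists the covariant derivatives of `a` at `p`. -/
def HasCovD (A : V → Fin 4 → ℝ) (a : V → ℂ) (p : V) (d : Fin 4 → ℂ) : Prop :=
  DifferentiableAt ℝ a p ∧ ∀ μ, covD A μ a p = d μ

section Rules

variable {f g : V → ℝ} {a b : V → ℂ} {p : V} {d e : Fin 4 → ℝ} {m n : Fin 4 → ℂ}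

lemma HasPd.mul (hf : HasPd f p d) (hg : HasPd g p e) :
    HasPd (fun q => f q * g q) p fun μ => d μ * g p + f p * e μ := by
  refine ⟨hf.1.mul hg.1, fun μ => ?_⟩
  have h : HasFDerivAt (fun q => f q * g q) _ p := hf.1.hasFDerivAt.mul hg.1.hasFDerivAt
  beta_reduce
  rw [← hf.2, ← hg.2, pd, h.fderiv]
  simp [pd]
  ring

lemma HasPd.add (hf : HasPd f p d) (hg : HasPd g p e) :
    HasPd (fun q => f q + g q) p fun μ => d μ + e μ := by
  refine ⟨hf.1.add hg.1, fun μ => ?_⟩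
  have h : HasFDerivAt (fun q => f q + g q) _ p := hf.1.hasFDerivAt.add hg.1.hasFDerivAt
  beta_reduce
  rw [← hf.2, ← hg.2, pd, h.fderiv]
  simp [pd]

lemma HasPd.const_mul (hf : HasPd f p d) (c : ℝ) :
    HasPd (fun q => c * f q) p fun μ => c * d μ := by
  refine ⟨hf.1.const_mul c, fun μ => ?_⟩
  have h : HasFDerivAt (fun q => c * f q) _ p := hf.1.hasFDerivAt.const_mul c
  beta_reduce
  rw [← hf.2, pd, h.fderiv]
  simp [pd]

lemma hasPd_coord (ν : Fin 4) (p : V) :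
    HasPd (fun q : V => q ν) p fun μ => if ν = μ then 1 else 0 :=
  ⟨differentiableAt_apply ν p, fun μ => pd_coord μ ν p⟩

lemma HasCovD.ip (ha : HasCovD A a p m) (hb : HasCovD A b p n) :
    HasPd (fun q => ip (a q) (b q)) p fun μ => MKG.ip (m μ) (b p) + MKG.ip (a p) (n μ) := by
  refine ⟨?_, fun μ => by rw [pd_ip μ ha.1 hb.1, ha.2, hb.2]⟩
  exact (Complex.reCLM.differentiableAt.comp p
    (ha.1.mul (Complex.conjCLE.toContinuousLinearMap.differentiableAt.comp p hb.1)))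

lemma HasCovD.real_mul (hf : HasPd f p d) (ha : HasCovD A a p m) :
    HasCovD A (fun q => (f q : ℂ) * a q) p fun μ => d μ * a p + f p * m μ :=
  ⟨(Complex.ofRealCLM.differentiableAt.comp p hf.1).mul ha.1, fun μ => by
    rw [covD_real_mul hf.1 ha.1, hf.2, ha.2]⟩

lemma HasCovD.add (ha : HasCovD A a p m) (hb : HasCovD A b p n) :
    HasCovD A (fun q => a q + b q) p fun μ => m μ + n μ :=
  ⟨ha.1.add hb.1, fun μ => by rw [covD_add ha.1 hb.1, ha.2, hb.2]⟩

end Rules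

/-- The contraction `F_{μν} J^ν`. -/
def lorentz (A : V → Fin 4 → ℝ) (φ : V → ℂ) (μ : Fin 4) (p : V) : ℝ :=
  ∑ ν, curv A p μ ν * (eta ν * Jsf A φ p ν)

/-- The energy current associated with `∂_t`. -/
def energyCur (A : V → Fin 4 → ℝ) (φ : V → ℂ) : Fin 4 → V → ℝ
  | 0 => fun q => 1 / 2 * (ip (covD A 0 φ q) (covD A 0 φ q) + (ip (covD A 1 φ q) (covD A 1 φ q)
      + (ip (covD A 2 φ q) (covD A 2 φ q) + ip (covD A 3 φ q) (covD A 3 φ q))))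
  | 1 => fun q => -1 * ip (covD A 1 φ q) (covD A 0 φ q)
  | 2 => fun q => -1 * ip (covD A 2 φ q) (covD A 0 φ q)
  | 3 => fun q => -1 * ip (covD A 3 φ q) (covD A 0 φ q)

section Identities

variable {φ : V → ℂ} (hA : ContDiff ℝ (⊤ : ℕ∞) A) (hφ : ContDiff ℝ (⊤ : ℕ∞) φ)

include hA hφ

lemma hasCovD_covD (μ : Fin 4) (p : V) :
    HasCovD A (covD A μ φ) p fun ν => covD2 A ν μ φ p :=
  ⟨(contDiff_covD hA hφ μ).differentiable (by simp) p, fun _ => rfl⟩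

lemma contDiff_energyCur (μ : Fin 4) : ContDiff ℝ 1 (energyCur A φ μ) := by
  have h : ∀ μ ν, ContDiff ℝ 1 fun q => ip (covD A μ φ q) (covD A ν φ q) := fun μ ν =>
    contDiff_ip ((contDiff_covD hA hφ μ).of_le (by simp)) ((contDiff_covD hA hφ ν).of_le (by simp))
  fin_cases μ
  · exact contDiff_const.mul ((h 0 0).add ((h 1 1).add ((h 2 2).add (h 3 3))))
  · exact contDiff_const.mul (h 1 0)
  · exact contDiff_const.mul (h 2 0)
  · exact contDiff_const.mul (h 3 0)

lemma divV_energyCur (p : V) :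
    divV (energyCur A φ) p = -ip (boxA A φ p) (covD A 0 φ p) - lorentz A φ 0 p := by
  have hD := fun μ => hasCovD_covD hA hφ μ p
  have h0 := (((hD 0).ip (hD 0)).add (((hD 1).ip (hD 1)).add
    (((hD 2).ip (hD 2)).add ((hD 3).ip (hD 3))))).const_mul (1 / 2)
  have h1 := ((hD 1).ip (hD 0)).const_mul (-1)
  have h2 := ((hD 2).ip (hD 0)).const_mul (-1)
  have h3 := ((hD 3).ip (hD 0)).const_mul (-1)
  have c1 := covD2_comm hA hφ p 1 0
  have c2 := covD2_comm hA hφ p 2 0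
  have c3 := covD2_comm hA hφ p 3 0
  rw [sub_eq_iff_eq_add] at c1 c2 c3
  have f0 : curv A p 0 0 = 0 := by simp [curv]
  rw [divV, Fin.sum_univ_four]
  simp only [energyCur]
  rw [h0.2, h1.2, h2.2, h3.2]
  simp only [c1, c2, c3, lorentz, Jsf, boxA, Fin.sum_univ_four, ip_eq, f0,
    curv_antisymm p 1 0, curv_antisymm p 2 0, curv_antisymm p 3 0]
  simp [eta]
  ring

end Identities

end

section

variable {A : V → Fin 4 → ℝ} {φ : V → ℂ}

/-- The contraction `x^j D_j φ`. -/
def scal (A : V → Fin 4 → ℝ) (φ : V → ℂ) (q : V) : ℂ :=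
  ((q 1 : ℝ) : ℂ) * covD A 1 φ q + (((q 2 : ℝ) : ℂ) * covD A 2 φ q + ((q 3 : ℝ) : ℂ) * covD A 3 φ q)

/-- The multiplier `χ (x^j D_j φ + φ)`. -/
def multM (χ : V → ℝ) (A : V → Fin 4 → ℝ) (φ : V → ℂ) (q : V) : ℂ :=
  (χ q : ℂ) * (scal A φ q + φ q)

/-- The Lagrangian density, up to a factor. -/
def lagr (A : V → Fin 4 → ℝ) (φ : V → ℂ) (q : V) : ℝ :=
  ip (covD A 0 φ q) (covD A 0 φ q) + -1 * (ip (covD A 1 φ q) (covD A 1 φ q)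
      + (ip (covD A 2 φ q) (covD A 2 φ q) + ip (covD A 3 φ q) (covD A 3 φ q)))

/-- The spatial components of the Morawetz current. -/
def morJ (χ ζ : V → ℝ) (A : V → Fin 4 → ℝ) (φ : V → ℂ) (j : Fin 4) (q : V) : ℝ :=
  ip (covD A j φ q) (multM χ A φ q)
    + (1 / 2 * ((χ q * q j) * lagr A φ q) + -1 / 2 * ((ζ q * q j) * ip (φ q) (φ q)))

/-- The Morawetz current of the radial multiplier with profile `χ`. -/
def morCur (χ ζ : V → ℝ) (A : V → Fin 4 → ℝ) (φ : V → ℂ) : Fin 4 → V → ℝ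
  | 0 => fun q => -1 * ip (covD A 0 φ q) (multM χ A φ q)
  | 1 => morJ χ ζ A φ 1
  | 2 => morJ χ ζ A φ 2
  | 3 => morJ χ ζ A φ 3

variable {χ ζ ξ : V → ℝ} (hA : ContDiff ℝ (⊤ : ℕ∞) A) (hφ : ContDiff ℝ (⊤ : ℕ∞) φ)

include hA hφ

lemma contDiff_morCur (hχ : ContDiff ℝ (⊤ : ℕ∞) χ) (hζ : ContDiff ℝ (⊤ : ℕ∞) ζ) (μ : Fin 4) :
    ContDiff ℝ 1 (morCur χ ζ A φ μ) := by
  have hD := contDiff_covD hA hφ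
  have hX : ∀ μ : Fin 4, ContDiff ℝ (⊤ : ℕ∞) fun q : V => q μ := fun μ => contDiff_apply ℝ ℝ μ
  have hX' : ∀ μ : Fin 4, ContDiff ℝ (⊤ : ℕ∞) fun q : V => ((q μ : ℝ) : ℂ) := fun μ =>
    Complex.ofRealCLM.contDiff.comp (hX μ)
  have hS : ContDiff ℝ (⊤ : ℕ∞) (scal A φ) :=
    ((hX' 1).mul (hD 1)).add (((hX' 2).mul (hD 2)).add ((hX' 3).mul (hD 3)))
  have hM : ContDiff ℝ (⊤ : ℕ∞) (multM χ A φ) :=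
    (Complex.ofRealCLM.contDiff.comp hχ).mul (hS.add hφ)
  have hl : ContDiff ℝ (⊤ : ℕ∞) (lagr A φ) :=
    (contDiff_ip (hD 0) (hD 0)).add (contDiff_const.mul ((contDiff_ip (hD 1) (hD 1)).add
      ((contDiff_ip (hD 2) (hD 2)).add (contDiff_ip (hD 3) (hD 3)))))
  have hj : ∀ j, ContDiff ℝ 1 (morJ χ ζ A φ j) := fun j =>
    ((contDiff_ip (hD j) hM).add ((contDiff_const.mul ((hχ.mul (hX j)).mul hl)).add
      (contDiff_const.mul ((hζ.mul (hX j)).mul (contDiff_ip hφ hφ))))).of_le (by simp)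
  fin_cases μ
  · exact (contDiff_const.mul (contDiff_ip (hD 0) hM)).of_le (by simp)
  · exact hj 1
  · exact hj 2
  · exact hj 3

lemma divV_morCur (p : V)
    (hχ : HasPd χ p fun μ => if μ = 0 then 0 else ζ p * p μ)
    (hζ : HasPd ζ p fun μ => if μ = 0 then 0 else ξ p * p μ) :
    divV (morCur χ ζ A φ) p = ip (boxA A φ p) (multM χ A φ p)
      + 1 / 2 * (χ p + (p 1 ^ 2 + p 2 ^ 2 + p 3 ^ 2) * ζ p) * ip (covD A 0 φ p) (covD A 0 φ p)
      + 1 / 2 * (χ p - (p 1 ^ 2 + p 2 ^ 2 + p 3 ^ 2) * ζ p) * (ip (covD A 1 φ p) (covD A 1 φ p)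
        + (ip (covD A 2 φ p) (covD A 2 φ p) + ip (covD A 3 φ p) (covD A 3 φ p)))
      + ζ p * ip (scal A φ p) (scal A φ p)
      - 1 / 2 * (3 * ζ p + (p 1 ^ 2 + p 2 ^ 2 + p 3 ^ 2) * ξ p) * ip (φ p) (φ p)
      + χ p * (p 1 * lorentz A φ 1 p + p 2 * lorentz A φ 2 p + p 3 * lorentz A φ 3 p) := by
  have hD := fun μ => hasCovD_covD hA hφ μ p
  have hf : HasCovD A φ p fun μ => covD A μ φ p := ⟨hφ.differentiable (by simp) p, fun _ => rfl⟩
  have hX := fun ν => hasPd_coord ν p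
  have hS := ((HasCovD.real_mul (hX 1) (hD 1)).add
    ((HasCovD.real_mul (hX 2) (hD 2)).add (HasCovD.real_mul (hX 3) (hD 3))))
  have hM := HasCovD.real_mul hχ (hS.add hf)
  have hl := ((hD 0).ip (hD 0)).add ((((hD 1).ip (hD 1)).add
    (((hD 2).ip (hD 2)).add ((hD 3).ip (hD 3)))).const_mul (-1))
  have hJ := fun j => ((hD j).ip hM).add (((((hχ.mul (hX j)).mul hl)).const_mul (1 / 2)).add
    ((((hζ.mul (hX j)).mul (hf.ip hf))).const_mul (-1 / 2)))
  have h0 := ((hD 0).ip hM).const_mul (-1)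
  have c10 := covD2_comm hA hφ p 1 0
  have c20 := covD2_comm hA hφ p 2 0
  have c30 := covD2_comm hA hφ p 3 0
  have c21 := covD2_comm hA hφ p 2 1
  have c31 := covD2_comm hA hφ p 3 1
  have c32 := covD2_comm hA hφ p 3 2
  rw [sub_eq_iff_eq_add] at c10 c20 c30 c21 c31 c32
  have f0 : ∀ μ, curv A p μ μ = 0 := by simp [curv]
  have e1 : pd 0 (morCur χ ζ A φ 0) p = _ := h0.2 0
  have e2 : pd 1 (morCur χ ζ A φ 1) p = _ := (hJ 1).2 1
  have e3 : pd 2 (morCur χ ζ A φ 2) p = _ := (hJ 2).2 2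
  have e4 : pd 3 (morCur χ ζ A φ 3) p = _ := (hJ 3).2 3
  rw [divV, Fin.sum_univ_four, e1, e2, e3, e4]
  clear e1 e2 e3 e4 h0 hJ hl hM hS
  simp only [c10, c20, c30, c21, c31, c32, lorentz, Jsf, boxA, Fin.sum_univ_four, ip_eq, f0,
    curv_antisymm p 1 0, curv_antisymm p 2 0, curv_antisymm p 3 0, curv_antisymm p 2 1,
    curv_antisymm p 3 1, curv_antisymm p 3 2, multM, scal]
  simp [eta]
  ring

end

section

/-- The spatial radius squared. -/
def rsq (q : V) : ℝ := q 1 ^ 2 + q 2 ^ 2 + q 3 ^ 2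

lemma rsq_nonneg (q : V) : 0 ≤ rsq q := by unfold rsq; positivity

lemma rad_sq (q : V) : rad q ^ 2 = rsq q := by
  rw [rad, Real.sq_sqrt (by positivity), Fin.sum_univ_three, rsq]; rfl

lemma rad_nonneg (q : V) : 0 ≤ rad q := Real.sqrt_nonneg _

/-- `(1 + |x|²)^a`. -/
def japPow (a : ℝ) (q : V) : ℝ := (1 + rsq q) ^ a

lemma one_add_rsq_pos (q : V) : 0 < 1 + rsq q := by linarith [rsq_nonneg q]

lemma japPow_pos (a : ℝ) (q : V) : 0 < japPow a q := Real.rpow_pos_of_pos (one_add_rsq_pos q) a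

lemma japPow_add (a b : ℝ) (q : V) : japPow (a + b) q = japPow a q * japPow b q :=
  Real.rpow_add (one_add_rsq_pos q) a b

lemma contDiff_rsq : ContDiff ℝ (⊤ : ℕ∞) rsq := by
  have hX : ∀ μ : Fin 4, ContDiff ℝ (⊤ : ℕ∞) fun q : V => q μ := fun μ => contDiff_apply ℝ ℝ μ
  exact (((hX 1).pow 2).add ((hX 2).pow 2)).add ((hX 3).pow 2)

lemma contDiff_japPow (a : ℝ) : ContDiff ℝ (⊤ : ℕ∞) (japPow a) :=
  (contDiff_const.add contDiff_rsq).rpow_const_of_ne fun q => (one_add_rsq_pos q).ne'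

lemma hasPd_japPow (a : ℝ) (p : V) :
    HasPd (japPow a) p fun μ => if μ = 0 then 0 else 2 * a * japPow (a - 1) p * p μ := by
  refine ⟨(contDiff_japPow a).differentiable (by simp) p, fun μ => ?_⟩
  have hX : ∀ ν : Fin 4, HasFDerivAt (fun q : V => q ν) (ContinuousLinearMap.proj ν : V →L[ℝ] ℝ) p :=
    fun ν => (ContinuousLinearMap.proj ν : V →L[ℝ] ℝ).hasFDerivAt
  have h : HasFDerivAt (fun q => (1 + (q 1 ^ 2 + q 2 ^ 2 + q 3 ^ 2)) ^ a) _ p :=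
    ((((hX 1).pow 2).add ((hX 2).pow 2)).add ((hX 3).pow 2)).const_add 1 |>.rpow_const (p := a)
      (Or.inl (one_add_rsq_pos p).ne')
  have h' : fderiv ℝ (japPow a) p = _ := h.fderiv
  rw [pd, h']
  fin_cases μ <;> simp [japPow, rsq] <;> ring

/-- `(1 + |x|²)^{-1/2}`. -/
def alp : V → ℝ := japPow (-1 / 2)

/-- `(1 + |x|²)^{-ε/2}`. -/
def bet (ε : ℝ) : V → ℝ := japPow (-ε / 2)

lemma alp_pos (q : V) : 0 < alp q := japPow_pos _ q

lemma bet_pos (ε : ℝ) (q : V) : 0 < bet ε q := japPow_pos _ q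

lemma bet_le_one {ε : ℝ} (hε : 0 < ε) (q : V) : bet ε q ≤ 1 :=
  Real.rpow_le_one_of_one_le_of_nonpos (by linarith [rsq_nonneg q]) (by linarith)

lemma alp_sq (q : V) : alp q ^ 2 = japPow (-1) q := by
  rw [sq, alp, ← japPow_add]; norm_num

lemma alp_sq_mul (q : V) : alp q ^ 2 * (1 + rsq q) = 1 := by
  rw [alp_sq, japPow, Real.rpow_neg_one, inv_mul_cancel₀ (one_add_rsq_pos q).ne']

lemma alp_le_one (q : V) : alp q ≤ 1 :=
  Real.rpow_le_one_of_one_le_of_nonpos (by linarith [rsq_nonneg q]) (by norm_num)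

lemma hasPd_alp (p : V) : HasPd alp p fun μ => if μ = 0 then 0 else -alp p ^ 3 * p μ := by
  have h := hasPd_japPow (-1 / 2) p
  have : japPow (-1 / 2 - 1) p = alp p ^ 3 := by
    rw [pow_succ', alp_sq, alp, ← japPow_add]; norm_num
  refine ⟨h.1, fun μ => (h.2 μ).trans ?_⟩
  rw [this]
  beta_reduce
  split_ifs <;> ring

lemma hasPd_bet (ε : ℝ) (p : V) :
    HasPd (bet ε) p fun μ => if μ = 0 then 0 else -ε * (bet ε p * alp p ^ 2) * p μ := by
  have h := hasPd_japPow (-ε / 2) p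
  have : japPow (-ε / 2 - 1) p = bet ε p * alp p ^ 2 := by
    rw [alp_sq, bet, ← japPow_add]; norm_num [sub_eq_add_neg]
  refine ⟨h.1, fun μ => (h.2 μ).trans ?_⟩
  rw [this]
  beta_reduce
  split_ifs <;> ring

/-- The size of the Morawetz multiplier. -/
def cZ (ε : ℝ) : ℝ := (1 + ε) * (3 + ε)

/-- The profile of the Morawetz multiplier. -/
def chiP (ε : ℝ) (q : V) : ℝ := alp q * (cZ ε + -1 * bet ε q)

/-- The first radial derivative of `chiP`, divided by the radius. -/
def zetaP (ε : ℝ) (q : V) : ℝ := alp q * (alp q * (alp q * (-cZ ε + (1 + ε) * bet ε q)))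

/-- The first radial derivative of `zetaP`, divided by the radius. -/
def xiP (ε : ℝ) (q : V) : ℝ := cZ ε * alp q ^ 5 * (3 - bet ε q)

lemma hasPd_const_add {f : V → ℝ} {p : V} {d : Fin 4 → ℝ} (hf : HasPd f p d) (c : ℝ) :
    HasPd (fun q => c + f q) p d :=
  ⟨hf.1.const_add c, fun μ => by rw [pd, (hf.1.hasFDerivAt.const_add c).fderiv]; exact hf.2 μ⟩

lemma hasPd_chiP (ε : ℝ) (p : V) :
    HasPd (chiP ε) p fun μ => if μ = 0 then 0 else zetaP ε p * p μ := by
  have h := (hasPd_alp p).mul (hasPd_const_add ((hasPd_bet ε p).const_mul (-1)) (cZ ε))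
  refine ⟨h.1, fun μ => (h.2 μ).trans ?_⟩
  beta_reduce
  unfold zetaP
  split_ifs <;> ring

lemma hasPd_zetaP (ε : ℝ) (p : V) :
    HasPd (zetaP ε) p fun μ => if μ = 0 then 0 else xiP ε p * p μ := by
  have h := (hasPd_alp p).mul ((hasPd_alp p).mul ((hasPd_alp p).mul
    (hasPd_const_add ((hasPd_bet ε p).const_mul (1 + ε)) (-cZ ε))))
  refine ⟨h.1, fun μ => (h.2 μ).trans ?_⟩
  beta_reduce
  unfold xiP cZ
  split_ifs <;> ring

lemma contDiff_chiP (ε : ℝ) : ContDiff ℝ (⊤ : ℕ∞) (chiP ε) :=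
  (contDiff_japPow _).mul (contDiff_const.add (contDiff_const.mul (contDiff_japPow _)))

lemma contDiff_zetaP (ε : ℝ) : ContDiff ℝ (⊤ : ℕ∞) (zetaP ε) :=
  (contDiff_japPow _).mul ((contDiff_japPow _).mul ((contDiff_japPow _).mul
    (contDiff_const.add (contDiff_const.mul (contDiff_japPow _)))))

section Bounds

variable {ε : ℝ} (hε : 0 < ε) (q : V)

lemma one_le_alp_mul : 1 ≤ alp q * (1 + rad q) := by
  have h1 := alp_sq_mul q
  rw [← rad_sq] at h1
  have h2 := alp_pos q
  have h3 := rad_nonneg q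
  by_contra! h
  have : (alp q * (1 + rad q)) ^ 2 < 1 := by
    have : 0 ≤ alp q * (1 + rad q) := by positivity
    nlinarith
  nlinarith [mul_nonneg h3 (sq_nonneg (alp q))]

lemma alp_mul_le : alp q * (1 + rad q) ≤ 2 := by
  have h1 := alp_sq_mul q
  rw [← rad_sq] at h1
  have h2 := alp_pos q
  have h3 := rad_nonneg q
  have : (alp q * (1 + rad q)) ^ 2 ≤ 2 := by nlinarith [mul_nonneg (sq_nonneg (alp q)) (sq_nonneg (1 - rad q))]
  nlinarith [sq_nonneg (alp q * (1 + rad q) - 1)]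

lemma alp_mul_rad_le : alp q * rad q ≤ 1 := by
  have h1 := alp_sq_mul q
  rw [← rad_sq] at h1
  have h2 := alp_pos q
  have h3 := rad_nonneg q
  have : (alp q * rad q) ^ 2 ≤ 1 := by nlinarith [sq_nonneg (alp q)]
  nlinarith [mul_nonneg h2.le h3]

include hε

lemma rplus_rpow_le : rplus q ^ (-(1 + ε)) ≤ alp q * bet ε q := by
  have h : alp q * bet ε q = ((1 + rsq q) ^ ((1 : ℝ) / 2)) ^ (-(1 + ε)) := by
    rw [alp, bet, ← japPow_add, ← Real.rpow_mul (one_add_rsq_pos q).le, japPow]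
    congr 1; ring
  rw [h, ← Real.sqrt_eq_rpow]
  refine Real.rpow_le_rpow_of_nonpos (Real.sqrt_pos.2 (one_add_rsq_pos q)) ?_ (by linarith)
  rw [Real.sqrt_le_left (by unfold rplus; linarith [rad_nonneg q]), ← rad_sq, rplus]
  nlinarith [rad_nonneg q]

lemma cZ_ge : 3 + ε ≤ cZ ε ∧ 1 + ε ≤ cZ ε ∧ 3 ≤ cZ ε := by
  unfold cZ; refine ⟨?_, ?_, ?_⟩ <;> nlinarith

lemma chiP_nonneg : 0 ≤ chiP ε q := by
  have := cZ_ge hε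
  have := bet_le_one hε q
  exact mul_nonneg (alp_pos q).le (by linarith)

omit hε in
lemma chiP_le : chiP ε q ≤ cZ ε * alp q := by
  have := bet_pos ε q
  have := alp_pos q
  unfold chiP
  nlinarith

lemma abs_zetaP_le : |zetaP ε q| ≤ cZ ε * alp q ^ 3 := by
  have h1 := cZ_ge hε
  have h2 := bet_le_one hε q
  have h3 := bet_pos ε q
  have h4 : zetaP ε q = alp q ^ 3 * (-cZ ε + (1 + ε) * bet ε q) := by unfold zetaP; ring
  rw [h4, abs_mul, abs_of_pos (pow_pos (alp_pos q) 3), mul_comm]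
  refine mul_le_mul_of_nonneg_right ?_ (pow_pos (alp_pos q) 3).le
  rw [abs_le]
  constructor <;> nlinarith

lemma radial_deriv_ge : ε * (alp q * bet ε q) ≤ chiP ε q + rsq q * zetaP ε q := by
  have h1 := alp_sq_mul q
  have h2 := cZ_ge hε
  have h3 := bet_le_one hε q
  have h5 := bet_pos ε q
  have h4 : chiP ε q + rsq q * zetaP ε q
      = ε * (alp q * bet ε q) + alp q ^ 3 * (cZ ε - (1 + ε) * bet ε q) := by
    have : rsq q * zetaP ε q = alp q * (alp q ^ 2 * (1 + rsq q)) * (-cZ ε + (1 + ε) * bet ε q)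
      - alp q ^ 3 * (-cZ ε + (1 + ε) * bet ε q) := by unfold zetaP; ring
    rw [this, h1, chiP]; ring
  rw [h4]
  have : 0 ≤ alp q ^ 3 * (cZ ε - (1 + ε) * bet ε q) :=
    mul_nonneg (pow_pos (alp_pos q) 3).le (by nlinarith)
  linarith

lemma angular_coeff_ge : 1 / 2 * alp q ≤ 1 / 2 * (chiP ε q - rsq q * zetaP ε q) := by
  have h1 := alp_sq_mul q
  have h2 := cZ_ge hε
  have h3 := bet_le_one hε q
  have h5 := bet_pos ε q
  have h6 := alp_pos q
  have h8 := alp_le_one q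
  have h4 : chiP ε q - rsq q * zetaP ε q
      = alp q * (2 * cZ ε - (2 + ε) * bet ε q) - alp q ^ 3 * (cZ ε - (1 + ε) * bet ε q) := by
    have : rsq q * zetaP ε q = alp q * (alp q ^ 2 * (1 + rsq q)) * (-cZ ε + (1 + ε) * bet ε q)
      - alp q ^ 3 * (-cZ ε + (1 + ε) * bet ε q) := by unfold zetaP; ring
    rw [this, h1, chiP]; ring
  have h7 : alp q ^ 3 ≤ alp q := by nlinarith [mul_pos h6 h6]
  have : alp q ^ 3 * (cZ ε - (1 + ε) * bet ε q) ≤ alp q * (cZ ε - (1 + ε) * bet ε q) :=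
    mul_le_mul_of_nonneg_right h7 (by nlinarith)
  rw [h4]
  nlinarith

lemma zeroth_coeff_ge :
    ε * (1 + ε) * (alp q ^ 3 * bet ε q) ≤ -(3 * zetaP ε q + rsq q * xiP ε q) := by
  have h1 := alp_sq_mul q
  have h2 := cZ_ge hε
  have h3 := bet_le_one hε q
  have h4 : -(3 * zetaP ε q + rsq q * xiP ε q)
      = ε * (1 + ε) * (alp q ^ 3 * bet ε q) + cZ ε * alp q ^ 5 * (3 - bet ε q) := by
    have : rsq q * xiP ε q = cZ ε * (alp q ^ 3 * (alp q ^ 2 * (1 + rsq q))) * (3 - bet ε q)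
      - cZ ε * alp q ^ 5 * (3 - bet ε q) := by unfold xiP; ring
    rw [this, h1, zetaP, cZ]; ring
  rw [h4]
  have : 0 ≤ cZ ε * alp q ^ 5 * (3 - bet ε q) :=
    mul_nonneg (mul_nonneg (by linarith) (pow_pos (alp_pos q) 5).le) (by linarith)
  linarith

end Bounds

end

section

variable {A : V → Fin 4 → ℝ} {φ : V → ℂ} {p : V}

/-- The radial component of the gradient. -/
def dRad (A : V → Fin 4 → ℝ) (φ : V → ℂ) (p : V) : ℂ := scal A φ p / (rad p : ℂ)

lemma dirD_Lv : dirD A (Lv p) φ p = covD A 0 φ p + dRad A φ p := by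
  simp [dirD, Fin.sum_univ_four, Lv, dRad, scal]; ring

lemma dirD_Lbv : dirD A (Lbv p) φ p = covD A 0 φ p - dRad A φ p := by
  simp [dirD, Fin.sum_univ_four, Lbv, dRad, scal]; ring

lemma FJcontr_Lv : FJcontr (curv A) A φ Lv p = lorentz A φ 0 p
    + (p 1 * lorentz A φ 1 p + p 2 * lorentz A φ 2 p + p 3 * lorentz A φ 3 p) / rad p := by
  simp [FJcontr, lorentz, Fin.sum_univ_four, Lv]; ring

lemma FJcontr_Lbv : FJcontr (curv A) A φ Lbv p = lorentz A φ 0 p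
    - (p 1 * lorentz A φ 1 p + p 2 * lorentz A φ 2 p + p 3 * lorentz A φ 3 p) / rad p := by
  simp [FJcontr, lorentz, Fin.sum_univ_four, Lbv]; ring

/-- The square of the spatial gradient. -/
def gradSq (A : V → Fin 4 → ℝ) (φ : V → ℂ) (p : V) : ℝ :=
  ‖covD A 1 φ p‖ ^ 2 + ‖covD A 2 φ p‖ ^ 2 + ‖covD A 3 φ p‖ ^ 2

lemma norm_sq_eq (a : ℂ) : ‖a‖ ^ 2 = a.re * a.re + a.im * a.im := by
  rw [← Complex.normSq_eq_norm_sq, Complex.normSq_apply]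

lemma scal_eq (hp : 0 < rad p) : scal A φ p = rad p * dRad A φ p := by
  rw [dRad, mul_div_cancel₀]; exact_mod_cast hp.ne'

lemma eDslash_eq (hp : 0 < rad p) :
    eDslash A φ p = gradSq A φ p - ‖dRad A φ p‖ ^ 2 := by
  have h1 : ∀ j : Fin 3, dirD A (Pv p j) φ p
      = covD A j.succ φ p - ((p j.succ / rad p : ℝ) : ℂ) * dRad A φ p := by
    intro j
    have h2 : dRad A φ p = (((p 1 / rad p : ℝ) : ℂ)) * covD A 1 φ p
      + ((p 2 / rad p : ℝ) : ℂ) * covD A 2 φ p + ((p 3 / rad p : ℝ) : ℂ) * covD A 3 φ p := by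
      simp [dRad, scal]; ring
    rw [h2]
    fin_cases j <;> simp [dirD, Fin.sum_univ_four, Pv] <;> ring
  have h3 : (p 1 / rad p) ^ 2 + (p 2 / rad p) ^ 2 + (p 3 / rad p) ^ 2 = 1 := by
    have := rad_sq p
    unfold rsq at this
    field_simp
    linarith
  have h4 : dRad A φ p = (((p 1 / rad p : ℝ) : ℂ)) * covD A 1 φ p
      + ((p 2 / rad p : ℝ) : ℂ) * covD A 2 φ p + ((p 3 / rad p : ℝ) : ℂ) * covD A 3 φ p := by
    simp [dRad, scal]; ring
  rw [eDslash, Fin.sum_univ_three, h1, h1, h1, gradSq]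
  have hre := congrArg Complex.re h4
  have him := congrArg Complex.im h4
  generalize dRad A φ p = d at *
  simp only [norm_sq_eq, Complex.sub_re, Complex.sub_im, Complex.re_ofReal_mul,
    Complex.im_ofReal_mul, Complex.add_re, Complex.add_im, Fin.succ_zero_eq_one,
    Fin.succ_one_eq_two, show (2 : Fin 3).succ = 3 from rfl] at *
  generalize p 1 / rad p = x1 at *
  generalize p 2 / rad p = x2 at *
  generalize p 3 / rad p = x3 at *
  linear_combination (d.re * d.re + d.im * d.im) * h3 + 2 * d.re * hre + 2 * d.im * him

lemma eDslash_nonneg : 0 ≤ eDslash A φ p := Finset.sum_nonneg fun _ _ => by positivity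

lemma eD_eq : eD A φ p = ‖covD A 0 φ p‖ ^ 2 + gradSq A φ p := by
  rw [eD, Fin.sum_univ_four, gradSq]; ring

lemma eD_eq_frame (hp : 0 < rad p) :
    eD A φ p = ‖covD A 0 φ p‖ ^ 2 + ‖dRad A φ p‖ ^ 2 + eDslash A φ p := by
  rw [eDslash_eq hp, eD_eq]; ring

/-- The bulk density controlled by the Morawetz estimate. -/
def gDen (ε : ℝ) (A : V → Fin 4 → ℝ) (φ : V → ℂ) (p : V) : ℝ :=
  rplus p ^ (-(1 + ε)) * eDbar A φ p + eDslash A φ p / (1 + rad p)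

/-- The weighted density of the inhomogeneity. -/
def wDen (ε : ℝ) (A : V → Fin 4 → ℝ) (φ : V → ℂ) (p : V) : ℝ :=
  rplus p ^ (1 + ε) * ‖boxA A φ p‖ ^ 2

/-- The density of the Lorentz force error terms. -/
def kDen (A : V → Fin 4 → ℝ) (φ : V → ℂ) (p : V) : ℝ :=
  |FJcontr (curv A) A φ Lv p| + |FJcontr (curv A) A φ Lbv p|

lemma rplus_pos : 0 < rplus p := by have := rad_nonneg p; unfold rplus; linarith

lemma kDen_nonneg : 0 ≤ kDen A φ p := by unfold kDen; positivity

lemma wDen_nonneg {ε : ℝ} : 0 ≤ wDen ε A φ p := by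
  have := rplus_pos (p := p); unfold wDen; positivity

lemma eD_nonneg : 0 ≤ eD A φ p := Finset.sum_nonneg fun _ _ => by positivity

lemma eDbar_nonneg : 0 ≤ eDbar A φ p := by
  have := eD_nonneg (A := A) (φ := φ) (p := p); unfold eDbar; positivity

lemma gDen_nonneg {ε : ℝ} : 0 ≤ gDen ε A φ p := by
  have := rplus_pos (p := p)
  have := rad_nonneg p
  have := eDslash_nonneg (A := A) (φ := φ) (p := p)
  have := eDbar_nonneg (A := A) (φ := φ) (p := p)
  unfold gDen; positivity

lemma mul_le_weighted {m m' δ x y : ℝ} (hm : m * m' = 1) (hm0 : 0 < m) (hδ : 0 < δ) :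
    x * y ≤ δ * (m * x ^ 2) + 1 / (4 * δ) * (m' * y ^ 2) := by
  have h : m' = 1 / m := by field_simp; linarith
  have h2 : δ * (m * x ^ 2) + 1 / (4 * δ) * (m' * y ^ 2) - x * y
      = (2 * δ * m * x - y) ^ 2 / (4 * δ * m) := by
    rw [h]; field_simp; ring
  have : 0 ≤ (2 * δ * m * x - y) ^ 2 / (4 * δ * m) := by positivity
  linarith

variable {ε : ℝ}

lemma weights (p : V) : rplus p ^ (-(1 + ε)) * rplus p ^ (1 + ε) = 1 := by
  rw [← Real.rpow_add rplus_pos]; simp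

/-- Pointwise bound for the divergence of the energy current. -/
lemma abs_divV_energyCur_le (hA : ContDiff ℝ (⊤ : ℕ∞) A) (hφ : ContDiff ℝ (⊤ : ℕ∞) φ)
    {δ : ℝ} (hδ : 0 < δ) :
    |divV (energyCur A φ) p| ≤ δ * gDen ε A φ p + 1 / (4 * δ) * wDen ε A φ p + kDen A φ p := by
  have hm0 : 0 < rplus p ^ (-(1 + ε)) := Real.rpow_pos_of_pos rplus_pos _
  have h1 := mul_le_weighted (x := ‖covD A 0 φ p‖) (y := ‖boxA A φ p‖) (weights (ε := ε) p) hm0 hδ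
  have h2 := abs_ip_le (boxA A φ p) (covD A 0 φ p)
  have h3 : lorentz A φ 0 p
      = 1 / 2 * (FJcontr (curv A) A φ Lv p + FJcontr (curv A) A φ Lbv p) := by
    rw [FJcontr_Lv, FJcontr_Lbv]; ring
  have h4 : |lorentz A φ 0 p| ≤ kDen A φ p := by
    rw [h3, abs_mul, kDen]
    have := abs_add_le (FJcontr (curv A) A φ Lv p) (FJcontr (curv A) A φ Lbv p)
    have h5 : |(1 / 2 : ℝ)| = 1 / 2 := by norm_num
    rw [h5]
    have := abs_nonneg (FJcontr (curv A) A φ Lv p + FJcontr (curv A) A φ Lbv p)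
    linarith
  have h6 : rplus p ^ (-(1 + ε)) * ‖covD A 0 φ p‖ ^ 2 ≤ gDen ε A φ p := by
    have := eDslash_nonneg (A := A) (φ := φ) (p := p)
    have := rad_nonneg p
    have h7 : 0 ≤ gradSq A φ p := by unfold gradSq; positivity
    have h8 : ‖covD A 0 φ p‖ ^ 2 ≤ eDbar A φ p := by
      rw [eDbar, eD_eq]
      have : 0 ≤ ‖φ p‖ ^ 2 / rplus p ^ 2 := by positivity
      linarith
    have h9 : 0 ≤ eDslash A φ p / (1 + rad p) := by positivity
    unfold gDen
    nlinarith [mul_le_mul_of_nonneg_left h8 hm0.le]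
  have h7 := mul_le_mul_of_nonneg_left h6 hδ.le
  rw [divV_energyCur hA hφ]
  have h8 := abs_sub (-ip (boxA A φ p) (covD A 0 φ p)) (lorentz A φ 0 p)
  rw [abs_neg] at h8
  unfold wDen
  nlinarith

lemma norm_multM_sq_le (hε : 0 < ε) (hp : 0 < rad p) :
    ‖multM (chiP ε) A φ p‖ ^ 2 ≤ 8 * cZ ε ^ 2 * eDbar A φ p := by
  have hc := cZ_ge hε
  have h0 := chiP_nonneg hε p
  have h1 : chiP ε p * rad p ≤ cZ ε := by
    have := chiP_le (ε := ε) p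
    have := alp_mul_rad_le p
    nlinarith
  have h2 : chiP ε p ≤ 2 * cZ ε / rplus p := by
    rw [le_div_iff₀ rplus_pos]
    have := chiP_le (ε := ε) p
    have := alp_mul_le p
    have h3 := rplus_pos (p := p)
    unfold rplus at *
    nlinarith
  have h3 : ‖multM (chiP ε) A φ p‖ ≤ cZ ε * ‖dRad A φ p‖ + 2 * cZ ε * (‖φ p‖ / rplus p) := by
    rw [multM, norm_mul, Complex.norm_real, Real.norm_of_nonneg h0, scal_eq hp]
    have h4 : ‖(rad p : ℂ) * dRad A φ p + φ p‖ ≤ rad p * ‖dRad A φ p‖ + ‖φ p‖ := by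
      refine (norm_add_le _ _).trans ?_
      rw [norm_mul, Complex.norm_real, Real.norm_of_nonneg hp.le]
    have h5 := mul_le_mul_of_nonneg_left h4 h0
    have h6 := mul_le_mul_of_nonneg_right h1 (norm_nonneg (dRad A φ p))
    have h7 := mul_le_mul_of_nonneg_right h2 (norm_nonneg (φ p))
    have : 2 * cZ ε / rplus p * ‖φ p‖ = 2 * cZ ε * (‖φ p‖ / rplus p) := by ring
    nlinarith
  have h4 : ‖dRad A φ p‖ ^ 2 + (‖φ p‖ / rplus p) ^ 2 ≤ eDbar A φ p := by
    rw [eDbar, eD_eq_frame hp, div_pow]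
    have := eDslash_nonneg (A := A) (φ := φ) (p := p)
    nlinarith [sq_nonneg ‖covD A 0 φ p‖]
  have h5 : 0 ≤ ‖φ p‖ / rplus p := div_nonneg (norm_nonneg _) rplus_pos.le
  generalize ‖φ p‖ / rplus p = y at *
  have h6 := pow_le_pow_left₀ (norm_nonneg _) h3 2
  have h7 := mul_le_mul_of_nonneg_left h4 (by positivity : 0 ≤ 8 * cZ ε ^ 2)
  nlinarith [sq_nonneg (cZ ε * ‖dRad A φ p‖ - 2 * cZ ε * y), sq_nonneg (cZ ε * ‖dRad A φ p‖)]

/-- Pointwise coercivity of the divergence of the Morawetz current. -/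
lemma exists_divV_morCur_ge (hε : 0 < ε) : ∃ c > 0, ∃ C > 0, ∀ (A : V → Fin 4 → ℝ) (φ : V → ℂ),
    ContDiff ℝ (⊤ : ℕ∞) A → ContDiff ℝ (⊤ : ℕ∞) φ → ∀ p, 0 < rad p →
    c * gDen ε A φ p ≤ divV (morCur (chiP ε) (zetaP ε) A φ) p
      + C * (wDen ε A φ p + kDen A φ p) := by
  obtain ⟨c₀, hc0, hc1, hc2⟩ : ∃ c₀ : ℝ, 0 < c₀ ∧ c₀ ≤ ε / 2 ∧ c₀ ≤ 1 / 4 :=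
    ⟨min (ε / 2) (1 / 4), by positivity, min_le_left _ _, min_le_right _ _⟩
  have hc := cZ_ge hε
  have hcZ : 0 < cZ ε := by linarith
  set δ := c₀ / 2 / (8 * cZ ε ^ 2) with hδdef
  have hδ : 0 < δ := by positivity
  refine ⟨c₀ / 2, by positivity, 1 / (4 * δ) + cZ ε, by positivity, fun A φ hA hφ p hp => ?_⟩
  have hm0 : 0 < rplus p ^ (-(1 + ε)) := Real.rpow_pos_of_pos rplus_pos _
  rw [divV_morCur hA hφ p (hasPd_chiP ε p) (hasPd_zetaP ε p)]
  have h1 := mul_le_weighted (x := ‖multM (chiP ε) A φ p‖) (y := ‖boxA A φ p‖)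
    (weights (ε := ε) p) hm0 hδ
  have h2 := abs_le.1 (abs_ip_le (boxA A φ p) (multM (chiP ε) A φ p))
  have h3 := mul_le_mul_of_nonneg_left
    (mul_le_mul_of_nonneg_left (norm_multM_sq_le (A := A) (φ := φ) hε hp) hm0.le) hδ.le
  have h4 : δ * (rplus p ^ (-(1 + ε)) * (8 * cZ ε ^ 2 * eDbar A φ p))
      = c₀ / 2 * (rplus p ^ (-(1 + ε)) * eDbar A φ p) := by
    rw [hδdef]; field_simp
  rw [h4] at h3
  have hL : p 1 * lorentz A φ 1 p + p 2 * lorentz A φ 2 p + p 3 * lorentz A φ 3 p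
      = rad p * (1 / 2 * (FJcontr (curv A) A φ Lv p - FJcontr (curv A) A φ Lbv p)) := by
    rw [FJcontr_Lv, FJcontr_Lbv]; field_simp; ring
  have hL2 : -(cZ ε * kDen A φ p) ≤ chiP ε p * (p 1 * lorentz A φ 1 p + p 2 * lorentz A φ 2 p
      + p 3 * lorentz A φ 3 p) := by
    have h5 : chiP ε p * rad p ≤ cZ ε := by
      have := chiP_le (ε := ε) p
      have := alp_mul_rad_le p
      nlinarith
    have h6 : 0 ≤ chiP ε p * rad p := mul_nonneg (chiP_nonneg hε p) hp.le
    have h7 : -kDen A φ p ≤ 1 / 2 * (FJcontr (curv A) A φ Lv p - FJcontr (curv A) A φ Lbv p) := by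
      have e1 := neg_abs_le (FJcontr (curv A) A φ Lv p)
      have e2 := le_abs_self (FJcontr (curv A) A φ Lbv p)
      have e3 := abs_nonneg (FJcontr (curv A) A φ Lv p)
      have e4 := abs_nonneg (FJcontr (curv A) A φ Lbv p)
      unfold kDen
      linarith
    rw [hL, ← mul_assoc]
    have := kDen_nonneg (A := A) (φ := φ) (p := p)
    nlinarith
  have hB := radial_deriv_ge hε p
  have hC := angular_coeff_ge hε p
  have hE := zeroth_coeff_ge hε p
  have hr := rplus_rpow_le hε p
  have ha1 : 1 / (1 + rad p) ≤ alp p := by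
    rw [div_le_iff₀ (by linarith)]; exact one_le_alp_mul p
  have hds := eDslash_nonneg (A := A) (φ := φ) (p := p)
  have hb := bet_le_one hε p
  have hap := alp_pos p
  have hbp := bet_pos ε p
  -- the three coercive contributions
  have k1 : c₀ * rplus p ^ (-(1 + ε)) * (‖covD A 0 φ p‖ ^ 2 + ‖dRad A φ p‖ ^ 2) ≤
      1 / 2 * (chiP ε p + rsq p * zetaP ε p) * (‖covD A 0 φ p‖ ^ 2 + ‖dRad A φ p‖ ^ 2) := by
    refine mul_le_mul_of_nonneg_right ?_ (by positivity)
    have e1 := mul_le_mul hc1 hr (by positivity) (by positivity)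
    linarith
  have k2 : c₀ * (rplus p ^ (-(1 + ε)) * eDslash A φ p + eDslash A φ p / (1 + rad p)) ≤
      1 / 2 * (chiP ε p - rsq p * zetaP ε p) * eDslash A φ p := by
    have : c₀ * (rplus p ^ (-(1 + ε)) * eDslash A φ p + eDslash A φ p / (1 + rad p))
      = (c₀ * (rplus p ^ (-(1 + ε)) + 1 / (1 + rad p))) * eDslash A φ p := by ring
    rw [this]
    refine mul_le_mul_of_nonneg_right ?_ hds
    have e1 : alp p * bet ε p ≤ alp p := mul_le_of_le_one_right hap.le hb
    have e2 : 0 < 1 / (1 + rad p) := by positivity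
    have e3 := mul_le_mul hc2 (add_le_add (hr.trans e1) ha1) (by positivity) (by positivity)
    linarith
  have k3 : c₀ * (rplus p ^ (-(1 + ε)) * (‖φ p‖ ^ 2 / rplus p ^ 2)) ≤
      1 / 2 * (-(3 * zetaP ε p + rsq p * xiP ε p)) * ‖φ p‖ ^ 2 := by
    have : c₀ * (rplus p ^ (-(1 + ε)) * (‖φ p‖ ^ 2 / rplus p ^ 2))
      = (c₀ * (rplus p ^ (-(1 + ε)) * (1 / (1 + rad p)) ^ 2)) * ‖φ p‖ ^ 2 := by
      rw [rplus]; field_simp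
    rw [this]
    refine mul_le_mul_of_nonneg_right ?_ (by positivity)
    have e1 : (1 / (1 + rad p)) ^ 2 ≤ alp p ^ 2 := pow_le_pow_left₀ (by positivity) ha1 2
    have e2 : rplus p ^ (-(1 + ε)) * (1 / (1 + rad p)) ^ 2 ≤ alp p * bet ε p * alp p ^ 2 :=
      mul_le_mul hr e1 (by positivity) (by positivity)
    have e3 : 0 < alp p ^ 3 * bet ε p := by positivity
    have e5 : alp p * bet ε p * alp p ^ 2 = alp p ^ 3 * bet ε p := by ring
    rw [e5] at e2
    have e6 := mul_le_mul hc1 e2 (by positivity) (by positivity)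
    have e7 : 0 ≤ ε * ε * (alp p ^ 3 * bet ε p) := by positivity
    linarith
  simp only [ip_self, scal_eq hp, norm_mul, Complex.norm_real, Real.norm_of_nonneg hp.le]
  have hg : ‖covD A 1 φ p‖ ^ 2 + (‖covD A 2 φ p‖ ^ 2 + ‖covD A 3 φ p‖ ^ 2)
      = eDslash A φ p + ‖dRad A φ p‖ ^ 2 := by rw [eDslash_eq hp, gradSq]; ring
  have hw := wDen_nonneg (A := A) (φ := φ) (p := p) (ε := ε)
  have hk := kDen_nonneg (A := A) (φ := φ) (p := p)
  have hgn : 0 ≤ eDslash A φ p / (1 + rad p) := by positivity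
  have hr2 : p 1 ^ 2 + p 2 ^ 2 + p 3 ^ 2 = rsq p := rfl
  rw [hr2, hg, mul_pow, rad_sq]
  have hgd : gDen ε A φ p = rplus p ^ (-(1 + ε)) * eDbar A φ p + eDslash A φ p / (1 + rad p) := rfl
  have heb : rplus p ^ (-(1 + ε)) * eDbar A φ p = rplus p ^ (-(1 + ε)) * (‖covD A 0 φ p‖ ^ 2
    + ‖dRad A φ p‖ ^ 2) + rplus p ^ (-(1 + ε)) * eDslash A φ p
    + rplus p ^ (-(1 + ε)) * (‖φ p‖ ^ 2 / rplus p ^ 2) := by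
    rw [eDbar, eD_eq_frame hp]; ring
  have hwd : rplus p ^ (1 + ε) * ‖boxA A φ p‖ ^ 2 = wDen ε A φ p := rfl
  rw [hwd] at h1
  have hkd : 0 ≤ 1 / (4 * δ) * kDen A φ p := by positivity
  have hwd2 : 0 ≤ cZ ε * wDen ε A φ p := by positivity
  have hmul : ‖boxA A φ p‖ * ‖multM (chiP ε) A φ p‖ = ‖multM (chiP ε) A φ p‖ * ‖boxA A φ p‖ :=
    mul_comm _ _
  have hc0g : 0 ≤ c₀ * (eDslash A φ p / (1 + rad p)) := by positivity
  rw [hgd]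
  rw [heb] at h3 ⊢
  linear_combination k1 + k2 + k3 + h1 + h3 + hL2 + h2.1 + hkd + hwd2 + hc0g / 2

end

section

variable {A : V → Fin 4 → ℝ} {φ : V → ℂ} {p : V} {ε : ℝ}

lemma rad_pt {t r : ℝ} (hr : 0 ≤ r) {ω : E3} (hω : ‖ω‖ = 1) : rad (pt t r ω) = r := by
  have h : ω 0 ^ 2 + ω 1 ^ 2 + ω 2 ^ 2 = 1 := by rw [← norm_sq_e3, hω]; norm_num
  have h2 : rad (pt t r ω) ^ 2 = r ^ 2 := by
    rw [rad_sq, rsq]; simp [pt]; linear_combination r ^ 2 * h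
  exact (sq_eq_sq₀ (rad_nonneg _) hr).1 h2

/-- The radial component of a vector field. -/
def rdir (Y : Fin 4 → V → ℝ) (p : V) : ℝ :=
  (p 1 * Y 1 p + p 2 * Y 2 p + p 3 * Y 3 p) / rad p

lemma radialPart_eq_rdir (Y : Fin 4 → V → ℝ) {z : ℝ × ℝ} (hz : 0 < z.2) {ω : E3}
    (hω : ‖ω‖ = 1) : radialPart Y z ω = rdir Y (pt z.1 z.2 ω) := by
  rw [rdir, rad_pt hz.le hω, radialPart, Fin.sum_univ_three, eq_div_iff hz.ne']
  simp [pt]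
  ring

/-- Integral over the sphere of radius `z.2` at time `z.1`, without the area factor. -/
def avg (F : V → ℝ) (z : ℝ × ℝ) : ℝ := ∫ ω, F (pt z.1 z.2 ω) ∂sphMeas

lemma continuous_avg {F : V → ℝ} (hF : Continuous F) : Continuous (avg F) :=
  continuous_sphMeas_integral (F := fun q : (ℝ × ℝ) × E3 => F (pt q.1.1 q.1.2 q.2))
    (hF.comp continuous_pt)

lemma continuous_pt_right (z : ℝ × ℝ) : Continuous fun ω : E3 => pt z.1 z.2 ω :=
  continuous_pt.comp (continuous_const.prodMk continuous_id)

/-- The flux density through the surfaces with conormal `dt + σ dr`. -/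
def fluxS (σ : ℝ) (Y : Fin 4 → V → ℝ) (z : ℝ × ℝ) : ℝ := fluxT Y z + σ * fluxR Y z

lemma fluxS_eq {Y : Fin 4 → V → ℝ} (hY : ∀ μ, ContDiff ℝ 1 (Y μ)) (σ : ℝ) (z : ℝ × ℝ) :
    fluxS σ Y z = ∫ ω, z.2 ^ 2 * (Y 0 (pt z.1 z.2 ω) + σ * radialPart Y z ω) ∂sphMeas := by
  have h1 : Integrable (fun ω => Y 0 (pt z.1 z.2 ω)) sphMeas :=
    integrable_sphMeas ((hY 0).continuous.comp (continuous_pt_right z))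
  have h2 : Integrable (fun ω => radialPart Y z ω) sphMeas :=
    integrable_sphMeas ((contDiff_radialPart hY).continuous.comp
      (continuous_const.prodMk continuous_id))
  rw [integral_const_mul, integral_add h1 (h2.const_mul σ), integral_const_mul, fluxS, fluxT, fluxR]
  ring

lemma fluxS_zero_radius {Y : Fin 4 → V → ℝ} (σ t : ℝ) : fluxS σ Y (t, 0) = 0 := by
  simp [fluxS, fluxT, fluxR]

lemma fluxS_eq_avg {Y : Fin 4 → V → ℝ} (hY : ∀ μ, ContDiff ℝ 1 (Y μ)) (σ : ℝ) {z : ℝ × ℝ}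
    (hz : 0 < z.2) {F : V → ℝ}
    (hF : ∀ p, 0 < rad p → F p = rad p ^ 2 * (Y 0 p + σ * rdir Y p)) :
    fluxS σ Y z = avg F z := by
  rw [fluxS_eq hY]
  refine integral_congr_ae ?_
  filter_upwards [ae_sphMeas] with ω hω
  rw [hF _ (by rwa [rad_pt hz.le hω]), radialPart_eq_rdir Y hz hω, rad_pt hz.le hω]

/-! ### Pointwise flux identities -/

lemma energyCur_zero : energyCur A φ 0 p = 1 / 2 * eD A φ p := by
  simp only [energyCur, ip_self, eD, Fin.sum_univ_four]; ring

lemma ip_smul_left (c : ℝ) (a b : ℂ) : ip ((c : ℂ) * a) b = c * ip a b := by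
  simp [ip_eq]; ring

lemma ip_comm (a b : ℂ) : ip a b = ip b a := by simp [ip_eq]; ring

lemma ip_add_left (a b c : ℂ) : ip (a + b) c = ip a c + ip b c := by simp [ip_eq]; ring

lemma ip_dRad (b : ℂ) : ip (dRad A φ p) b
    = (p 1 * ip (covD A 1 φ p) b + p 2 * ip (covD A 2 φ p) b + p 3 * ip (covD A 3 φ p) b)
      / rad p := by
  have : dRad A φ p = ((1 / rad p : ℝ) : ℂ) * scal A φ p := by
    rw [dRad]; push_cast; ring
  rw [this, ip_smul_left, scal]
  simp only [ip_add_left, ip_smul_left]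
  ring

lemma rdir_energyCur : rdir (energyCur A φ) p = -ip (dRad A φ p) (covD A 0 φ p) := by
  rw [ip_dRad, rdir]
  simp only [energyCur]
  ring

lemma norm_add_sq_ip (a b : ℂ) : ‖a + b‖ ^ 2 = ‖a‖ ^ 2 + ‖b‖ ^ 2 + 2 * ip b a := by
  simp only [norm_sq_eq, ip_eq, Complex.add_re, Complex.add_im]; ring

lemma norm_sub_sq_ip (a b : ℂ) : ‖a - b‖ ^ 2 = ‖a‖ ^ 2 + ‖b‖ ^ 2 - 2 * ip b a := by
  simp only [norm_sq_eq, ip_eq, Complex.sub_re, Complex.sub_im]; ring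

lemma energy_flux_out (hp : 0 < rad p) :
    energyCur A φ 0 p + -1 * rdir (energyCur A φ) p
      = 1 / 2 * (‖covD A 0 φ p + dRad A φ p‖ ^ 2 + eDslash A φ p) := by
  rw [energyCur_zero, rdir_energyCur, norm_add_sq_ip, eD_eq_frame hp]; ring

lemma energy_flux_in (hp : 0 < rad p) :
    energyCur A φ 0 p + 1 * rdir (energyCur A φ) p
      = 1 / 2 * (‖covD A 0 φ p - dRad A φ p‖ ^ 2 + eDslash A φ p) := by
  rw [energyCur_zero, rdir_energyCur, norm_sub_sq_ip, eD_eq_frame hp]; ring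

lemma rdir_morCur (χ ζ : V → ℝ) (hp : 0 < rad p) : rdir (morCur χ ζ A φ) p
    = ip (dRad A φ p) (multM χ A φ p) + 1 / 2 * (χ p * rad p) * (‖covD A 0 φ p‖ ^ 2
        - ‖dRad A φ p‖ ^ 2 - eDslash A φ p) - 1 / 2 * (ζ p * rad p) * ‖φ p‖ ^ 2 := by
  have h2 : rad p ^ 2 = p 1 ^ 2 + p 2 ^ 2 + p 3 ^ 2 := rad_sq p
  rw [ip_dRad, rdir]
  simp only [morCur, morJ]
  have hl : lagr A φ p = ‖covD A 0 φ p‖ ^ 2 - ‖dRad A φ p‖ ^ 2 - eDslash A φ p := by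
    simp only [lagr, ip_self]
    rw [eDslash_eq hp, gradSq]; ring
  rw [hl, ip_self]
  field_simp
  linear_combination (-1) * (χ p * (‖covD A 0 φ p‖ ^ 2 - ‖dRad A φ p‖ ^ 2 - eDslash A φ p)
    - ζ p * ‖φ p‖ ^ 2) * h2

lemma profile_bounds (hε : 0 < ε) (p : V) : 0 ≤ chiP ε p * rad p ∧ chiP ε p * rad p ≤ cZ ε ∧
    |zetaP ε p| * rad p ^ 3 ≤ cZ ε := by
  have hc := cZ_ge hε
  have h1 := chiP_le (ε := ε) p
  have h2 := alp_mul_rad_le p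
  have h3 := rad_nonneg p
  have h4 := abs_zetaP_le hε p
  have h5 := alp_pos p
  refine ⟨mul_nonneg (chiP_nonneg hε p) h3, by nlinarith, ?_⟩
  have h6 := mul_le_mul_of_nonneg_right h4 (pow_nonneg h3 3)
  have h7 : (alp p * rad p) ^ 3 ≤ 1 := pow_le_one₀ (by positivity) h2
  have h8 : cZ ε * alp p ^ 3 * rad p ^ 3 = cZ ε * (alp p * rad p) ^ 3 := by ring
  nlinarith

lemma abs_null_flux_le {C f χ ζ r a b n d i s : ℝ} (hs : |s| ≤ 1) (hf : 0 ≤ χ * r)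
    (hf2 : χ * r ≤ C) (hζ : |ζ| * r ^ 3 ≤ C) (hr : 0 < r) (hd : 0 ≤ d)
    (hi : |i| ≤ b * n)
    (h : f = s / 2 * (χ * r) * b ^ 2 - χ * i - s / 2 * (χ * r) * d - s / 2 * (ζ * r) * n ^ 2)
    (ha : a = 1 / 2 * (b ^ 2 + d)) :
    |r ^ 2 * f| ≤ 4 * C * (r ^ 2 * a + n ^ 2) := by
  have hC : 0 ≤ C := hf.trans hf2
  have e1 : |s / 2 * (χ * r) * (r ^ 2 * b ^ 2)| ≤ C / 2 * (r ^ 2 * b ^ 2) := by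
    rw [abs_mul, abs_mul, abs_of_nonneg hf, abs_of_nonneg (by positivity : 0 ≤ r ^ 2 * b ^ 2),
      abs_div, abs_two]
    have : |s| / 2 * (χ * r) ≤ C / 2 := by nlinarith [abs_nonneg s]
    exact mul_le_mul_of_nonneg_right this (by positivity)
  have e2 : |s / 2 * (χ * r) * (r ^ 2 * d)| ≤ C / 2 * (r ^ 2 * d) := by
    rw [abs_mul, abs_mul, abs_of_nonneg hf, abs_of_nonneg (by positivity : 0 ≤ r ^ 2 * d),
      abs_div, abs_two]
    have : |s| / 2 * (χ * r) ≤ C / 2 := by nlinarith [abs_nonneg s]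
    exact mul_le_mul_of_nonneg_right this (by positivity)
  have e3 : |(χ * r) * (r * i)| ≤ C / 2 * (r ^ 2 * b ^ 2 + n ^ 2) := by
    rw [abs_mul, abs_of_nonneg hf, abs_mul, abs_of_pos hr]
    have h1 : r * |i| ≤ 1 / 2 * (r ^ 2 * b ^ 2 + n ^ 2) := by
      have := mul_le_mul_of_nonneg_left hi hr.le
      nlinarith [sq_nonneg (r * b - n)]
    have h2 : 0 ≤ r * |i| := by positivity
    have := mul_le_mul hf2 h1 h2 hC
    linarith
  have e4 : |s / 2 * (ζ * r ^ 3) * n ^ 2| ≤ C / 2 * n ^ 2 := by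
    rw [abs_mul, abs_mul, abs_div, abs_two, abs_of_nonneg (sq_nonneg n), abs_mul,
      abs_of_pos (pow_pos hr 3)]
    have h0 : 0 ≤ |ζ| * r ^ 3 := by positivity
    have : |s| / 2 * (|ζ| * r ^ 3) ≤ C / 2 := by nlinarith [abs_nonneg s]
    exact mul_le_mul_of_nonneg_right this (by positivity)
  have h5 : r ^ 2 * f = s / 2 * (χ * r) * (r ^ 2 * b ^ 2) - (χ * r) * (r * i)
      - s / 2 * (χ * r) * (r ^ 2 * d) - s / 2 * (ζ * r ^ 3) * n ^ 2 := by rw [h]; ring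
  rw [h5, ha]
  have h6 : 0 ≤ C * (r ^ 2 * d) := by positivity
  have h7 : 0 ≤ C * (r ^ 2 * b ^ 2) := by positivity
  have h8 : 0 ≤ C * n ^ 2 := by positivity
  rw [abs_le] at *
  constructor <;> nlinarith

lemma morawetz_flux_le (hε : 0 < ε) (hp : 0 < rad p) {σ : ℝ} (hσ : σ = 0 ∨ σ = -1 ∨ σ = 1) :
    |rad p ^ 2 * (morCur (chiP ε) (zetaP ε) A φ 0 p
        + σ * rdir (morCur (chiP ε) (zetaP ε) A φ) p)|
      ≤ 4 * cZ ε * (rad p ^ 2 * (energyCur A φ 0 p + σ * rdir (energyCur A φ) p) + ‖φ p‖ ^ 2) := by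
  obtain ⟨h1, h2, h3⟩ := profile_bounds hε p
  have hM : multM (chiP ε) A φ p = ((chiP ε p * rad p : ℝ) : ℂ) * dRad A φ p + (chiP ε p : ℂ) * φ p := by
    rw [multM, scal_eq hp]; push_cast; ring
  have hds := eDslash_nonneg (A := A) (φ := φ) (p := p)
  have h0 : morCur (chiP ε) (zetaP ε) A φ 0 p = -(chiP ε p * rad p * ip (dRad A φ p) (covD A 0 φ p)
      + chiP ε p * ip (covD A 0 φ p) (φ p)) := by
    simp only [morCur]
    rw [hM, ip_comm, ip_add_left, ip_smul_left, ip_smul_left, ip_comm (φ p)]; ring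
  have h4 : ip (dRad A φ p) (multM (chiP ε) A φ p) = chiP ε p * rad p * ‖dRad A φ p‖ ^ 2
      + chiP ε p * ip (dRad A φ p) (φ p) := by
    rw [hM, ip_comm, ip_add_left, ip_smul_left, ip_smul_left, ip_comm (φ p), ip_self]
  rcases hσ with rfl | rfl | rfl
  · have hC : 0 ≤ cZ ε := h1.trans h2
    simp only [zero_mul, add_zero]
    rw [h0, energyCur_zero, eD_eq_frame hp]
    have e1 := abs_ip_le (dRad A φ p) (covD A 0 φ p)
    have e2 := abs_ip_le (covD A 0 φ p) (φ p)
    have e5 : rad p ^ 2 * -(chiP ε p * rad p * ip (dRad A φ p) (covD A 0 φ p)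
      + chiP ε p * ip (covD A 0 φ p) (φ p))
      = -((chiP ε p * rad p) * (rad p ^ 2 * ip (dRad A φ p) (covD A 0 φ p)
        + rad p * ip (covD A 0 φ p) (φ p))) := by ring
    rw [e5, abs_neg, abs_mul, abs_of_nonneg h1]
    have e6 : |rad p ^ 2 * ip (dRad A φ p) (covD A 0 φ p) + rad p * ip (covD A 0 φ p) (φ p)|
        ≤ 2 * (rad p ^ 2 * (‖covD A 0 φ p‖ ^ 2 + ‖dRad A φ p‖ ^ 2 + eDslash A φ p)
          + ‖φ p‖ ^ 2) := by
      refine (abs_add_le _ _).trans ?_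
      rw [abs_mul, abs_mul, abs_of_pos hp, abs_of_pos (pow_pos hp 2)]
      have f1 := mul_le_mul_of_nonneg_left e1 (pow_pos hp 2).le
      have f2 := mul_le_mul_of_nonneg_left e2 hp.le
      have f3 : 0 ≤ rad p ^ 2 * eDslash A φ p := by positivity
      nlinarith [sq_nonneg (rad p * ‖dRad A φ p‖ - rad p * ‖covD A 0 φ p‖),
        sq_nonneg (rad p * ‖covD A 0 φ p‖ - ‖φ p‖), sq_nonneg (rad p * ‖covD A 0 φ p‖),
        sq_nonneg (rad p * ‖dRad A φ p‖), sq_nonneg ‖φ p‖]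
    have e7 := mul_le_mul h2 e6 (abs_nonneg _) hC
    refine e7.trans ?_
    have f3 : 0 ≤ cZ ε * ‖φ p‖ ^ 2 := by positivity
    linarith
  · have e1 := abs_ip_le (covD A 0 φ p + dRad A φ p) (φ p)
    have e2 := norm_add_sq_ip (covD A 0 φ p) (dRad A φ p)
    refine abs_null_flux_le (s := -1) (by norm_num) h1 h2 h3 hp hds e1 ?_
      (energy_flux_out hp)
    rw [rdir_morCur _ _ hp, h0, h4, ip_add_left, e2]
    ring
  · have e1 := abs_ip_le (covD A 0 φ p - dRad A φ p) (φ p)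
    have e2 := norm_sub_sq_ip (covD A 0 φ p) (dRad A φ p)
    have e3 : ip (covD A 0 φ p - dRad A φ p) (φ p) = ip (covD A 0 φ p) (φ p) - ip (dRad A φ p) (φ p) := by
      simp [ip_eq]; ring
    refine abs_null_flux_le (s := 1) (by norm_num) h1 h2 h3 hp hds e1 ?_
      (energy_flux_in hp)
    rw [rdir_morCur _ _ hp, h0, h4, e3, e2]
    ring

lemma energy_flux_nonneg (hp : 0 < rad p) {σ : ℝ} (hσ : σ = 0 ∨ σ = -1 ∨ σ = 1) :
    0 ≤ rad p ^ 2 * (energyCur A φ 0 p + σ * rdir (energyCur A φ) p) := by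
  have hds := eDslash_nonneg (A := A) (φ := φ) (p := p)
  refine mul_nonneg (by positivity) ?_
  rcases hσ with rfl | rfl | rfl
  · rw [zero_mul, add_zero, energyCur_zero]
    have := eD_nonneg (A := A) (φ := φ) (p := p)
    positivity
  · rw [energy_flux_out hp]; positivity
  · rw [energy_flux_in hp]; positivity

end

section

variable {A : V → Fin 4 → ℝ} {φ : V → ℂ} {p : V} {ε : ℝ}

/-! ### Continuity of the densities weighted by the squared radius -/

lemma continuous_rad : Continuous rad := by unfold rad; fun_prop

lemma coord_eq_zero_of_rad (h : rad p = 0) : p 1 = 0 ∧ p 2 = 0 ∧ p 3 = 0 := by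
  have h1 : p 1 ^ 2 + p 2 ^ 2 + p 3 ^ 2 = 0 := by
    have := rad_sq p; rw [h, rsq] at this; linarith
  refine ⟨?_, ?_, ?_⟩ <;> nlinarith [sq_nonneg (p 1), sq_nonneg (p 2), sq_nonneg (p 3)]

lemma rad_eq_zero_or_pos (p : V) : rad p = 0 ∨ 0 < rad p := (rad_nonneg p).eq_or_lt.imp Eq.symm id

lemma rad_sq_mul_eDslash (p : V) :
    rad p ^ 2 * eDslash A φ p = rad p ^ 2 * gradSq A φ p - ‖scal A φ p‖ ^ 2 := by
  rcases rad_eq_zero_or_pos p with h | h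
  · obtain ⟨h1, h2, h3⟩ := coord_eq_zero_of_rad h
    simp [h, scal, h1, h2, h3]
  · rw [eDslash_eq h, scal_eq h, norm_mul, Complex.norm_real, Real.norm_of_nonneg h.le]; ring

section Continuity

variable (hA : ContDiff ℝ (⊤ : ℕ∞) A) (hφ : ContDiff ℝ (⊤ : ℕ∞) φ)
include hA hφ

lemma continuous_covD (μ : Fin 4) : Continuous (covD A μ φ) := (contDiff_covD hA hφ μ).continuous

lemma continuous_covD2 (μ ν : Fin 4) : Continuous (covD2 A μ ν φ) :=
  continuous_covD hA (contDiff_covD hA hφ ν) μ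

lemma continuous_boxA : Continuous (boxA A φ) :=
  continuous_finsetSum _ fun μ _ => continuous_const.mul (continuous_covD2 hA hφ μ μ)

lemma continuous_lorentz (μ : Fin 4) : Continuous (lorentz A φ μ) := by
  have h : ∀ μ ν, Continuous fun p => curv A p μ ν := fun μ ν => by
    have h1 : ∀ μ ν, Continuous fun p => pd μ (fun q => A q ν) p := fun μ ν =>
      continuous_pd ((contDiff_pi.1 hA ν).of_le (by simp)) μ
    exact (h1 μ ν).sub (h1 ν μ)
  have hJ : ∀ ν, Continuous fun p => Jsf A φ p ν := fun ν =>
    Complex.continuous_im.comp (hφ.continuous.mul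
      (Complex.continuous_conj.comp (continuous_covD hA hφ ν)))
  exact continuous_finsetSum _ fun ν _ => (h μ ν).mul (continuous_const.mul (hJ ν))

lemma continuous_scal : Continuous (scal A φ) := by
  have h := continuous_covD hA hφ
  have h1 := h 1
  have h2 := h 2
  have h3 := h 3
  unfold scal
  fun_prop

lemma continuous_gradSq : Continuous (gradSq A φ) := by
  have h := continuous_covD hA hφ
  exact (((h 1).norm.pow 2).add ((h 2).norm.pow 2)).add ((h 3).norm.pow 2)

lemma continuous_eD : Continuous (eD A φ) :=
  continuous_finsetSum _ fun μ _ => (continuous_covD hA hφ μ).norm.pow 2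

lemma continuous_rad_sq_eDslash : Continuous fun p => rad p ^ 2 * eDslash A φ p := by
  simp only [rad_sq_mul_eDslash]
  exact ((continuous_rad.pow 2).mul (continuous_gradSq hA hφ)).sub
    ((continuous_scal hA hφ).norm.pow 2)

omit hA hφ in
lemma continuous_rplus_rpow (s : ℝ) : Continuous fun p => rplus p ^ s :=
  (continuous_const.add continuous_rad).rpow_const fun p => Or.inl (rplus_pos (p := p)).ne'

lemma continuous_rad_sq_gDen (ε : ℝ) : Continuous fun p => rad p ^ 2 * gDen ε A φ p := by
  have h : (fun p => rad p ^ 2 * gDen ε A φ p) = fun p =>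
      rad p ^ 2 * (rplus p ^ (-(1 + ε)) * (eD A φ p + ‖φ p‖ ^ 2 / rplus p ^ 2))
        + rad p ^ 2 * eDslash A φ p / (1 + rad p) := by
    funext p; rw [gDen, eDbar]; ring
  rw [h]
  have hr : Continuous rplus := continuous_const.add continuous_rad
  refine Continuous.add ?_ ?_
  · exact (continuous_rad.pow 2).mul ((continuous_rplus_rpow _).mul
      ((continuous_eD hA hφ).add ((hφ.continuous.norm.pow 2).div (hr.pow 2)
        fun p => (pow_pos rplus_pos 2).ne')))
  · exact (continuous_rad_sq_eDslash hA hφ).div hr fun p => (rplus_pos (p := p)).ne'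

lemma continuous_wDen (ε : ℝ) : Continuous (wDen ε A φ) :=
  (continuous_rplus_rpow _).mul ((continuous_boxA hA hφ).norm.pow 2)

lemma continuous_rad_sq_kDen : Continuous fun p => rad p ^ 2 * kDen A φ p := by
  have h : (fun p => rad p ^ 2 * kDen A φ p) = fun p =>
      |rad p ^ 2 * lorentz A φ 0 p
        + rad p * (p 1 * lorentz A φ 1 p + p 2 * lorentz A φ 2 p + p 3 * lorentz A φ 3 p)|
      + |rad p ^ 2 * lorentz A φ 0 p
        - rad p * (p 1 * lorentz A φ 1 p + p 2 * lorentz A φ 2 p + p 3 * lorentz A φ 3 p)| := by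
    funext p
    rw [kDen, mul_add, ← abs_of_nonneg (sq_nonneg (rad p)), ← abs_mul, ← abs_mul,
      abs_of_nonneg (sq_nonneg (rad p)), FJcontr_Lv, FJcontr_Lbv]
    rcases rad_eq_zero_or_pos p with h | h
    · simp [h]
    · congr 2 <;> field_simp
  rw [h]
  have hl := continuous_lorentz hA hφ
  have h0 := hl 0
  have h1 := hl 1
  have h2 := hl 2
  have h3 := hl 3
  have hr := continuous_rad
  fun_prop

/-! ### Averaged bulk and flux bounds -/

omit hA hφ in
lemma avg_mono {F G : V → ℝ} (hF : Continuous F) (hG : Continuous G) (h : ∀ p, F p ≤ G p)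
    (z : ℝ × ℝ) : avg F z ≤ avg G z :=
  integral_mono (integrable_sphMeas (hF.comp (continuous_pt_right z)))
    (integrable_sphMeas (hG.comp (continuous_pt_right z))) fun _ => h _

omit hA hφ in
lemma avg_nonneg {F : V → ℝ} (h : ∀ p, 0 ≤ F p) (z : ℝ × ℝ) : 0 ≤ avg F z :=
  integral_nonneg fun _ => h _

omit hA hφ in
lemma avg_add {F G : V → ℝ} (hF : Continuous F) (hG : Continuous G) (z : ℝ × ℝ) :
    avg (fun p => F p + G p) z = avg F z + avg G z :=
  integral_add (integrable_sphMeas (hF.comp (continuous_pt_right z)))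
    (integrable_sphMeas (hG.comp (continuous_pt_right z)))

omit hA hφ in
lemma avg_const_mul (c : ℝ) (F : V → ℝ) (z : ℝ × ℝ) :
    avg (fun p => c * F p) z = c * avg F z := integral_const_mul _ _

omit hA hφ in
lemma continuous_divV {Y : Fin 4 → V → ℝ} (hY : ∀ μ, ContDiff ℝ 1 (Y μ)) :
    Continuous (divV Y) := continuous_finsetSum _ fun μ _ => continuous_pd (hY μ) μ

omit hA hφ in
lemma sq_mul_avg {F : V → ℝ} {z : ℝ × ℝ} (hz : 0 ≤ z.2) :
    z.2 ^ 2 * (∫ ω, F (pt z.1 z.2 ω) ∂sphMeas) = avg (fun p => rad p ^ 2 * F p) z := by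
  rw [← integral_const_mul]
  refine integral_congr_ae ?_
  filter_upwards [ae_sphMeas] with ω hω
  rw [rad_pt hz hω]

/-- The averaged bulk density. -/
def gA (ε : ℝ) (A : V → Fin 4 → ℝ) (φ : V → ℂ) : ℝ × ℝ → ℝ :=
  avg fun p => rad p ^ 2 * gDen ε A φ p

/-- The averaged error density of the inhomogeneity. -/
def wA (ε : ℝ) (A : V → Fin 4 → ℝ) (φ : V → ℂ) : ℝ × ℝ → ℝ :=
  avg fun p => rad p ^ 2 * wDen ε A φ p

/-- The averaged error density of the Lorentz force. -/
def kA (A : V → Fin 4 → ℝ) (φ : V → ℂ) : ℝ × ℝ → ℝ := avg fun p => rad p ^ 2 * kDen A φ p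

/-- The averaged squared modulus of the field. -/
def nA (φ : V → ℂ) : ℝ × ℝ → ℝ := avg fun p => ‖φ p‖ ^ 2

lemma abs_div_energy_le {δ : ℝ} (hδ : 0 < δ) {z : ℝ × ℝ} (hz : 0 ≤ z.2) :
    |fderiv ℝ (fluxT (energyCur A φ)) z (1, 0) + fderiv ℝ (fluxR (energyCur A φ)) z (0, 1)|
      ≤ δ * gA ε A φ z + 1 / (4 * δ) * wA ε A φ z + kA A φ z := by
  have hE := contDiff_energyCur hA hφ
  have hg := continuous_rad_sq_gDen hA hφ ε
  have hw : Continuous fun p => rad p ^ 2 * wDen ε A φ p :=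
    (continuous_rad.pow 2).mul (continuous_wDen hA hφ ε)
  have hk := continuous_rad_sq_kDen hA hφ
  have hgw : Continuous fun p =>
      δ * (rad p ^ 2 * gDen ε A φ p) + 1 / (4 * δ) * (rad p ^ 2 * wDen ε A φ p) :=
    (hg.const_mul δ).add (hw.const_mul _)
  rw [fluxT_fluxR_div hE, sq_mul_avg hz, gA, wA, kA, ← avg_const_mul, ← avg_const_mul,
    ← avg_add (hg.const_mul δ) (hw.const_mul (1 / (4 * δ))),
    ← avg_add hgw hk]
  refine (abs_integral_le_integral_abs).trans ?_
  have hd : Continuous fun p => |rad p ^ 2 * divV (energyCur A φ) p| :=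
    ((continuous_rad.pow 2).mul (continuous_divV hE)).abs
  refine avg_mono hd (hgw.add hk) (fun p => ?_) z
  rw [abs_mul, abs_of_nonneg (sq_nonneg (rad p))]
  have := mul_le_mul_of_nonneg_left (abs_divV_energyCur_le (p := p) (ε := ε) hA hφ hδ)
    (sq_nonneg (rad p))
  refine this.trans (le_of_eq ?_)
  simp only [Pi.add_apply]
  ring

end Continuity

lemma exists_div_morawetz_ge (hε : 0 < ε) : ∃ c > 0, ∃ C > 0, ∀ (A : V → Fin 4 → ℝ) (φ : V → ℂ),
    ContDiff ℝ (⊤ : ℕ∞) A → ContDiff ℝ (⊤ : ℕ∞) φ → ∀ z : ℝ × ℝ, 0 ≤ z.2 →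
    c * gA ε A φ z ≤ fderiv ℝ (fluxT (morCur (chiP ε) (zetaP ε) A φ)) z (1, 0)
      + fderiv ℝ (fluxR (morCur (chiP ε) (zetaP ε) A φ)) z (0, 1)
      + C * (wA ε A φ z + kA A φ z) := by
  obtain ⟨c, hc, C, hC, h⟩ := exists_divV_morCur_ge hε
  refine ⟨c, hc, C, hC, fun A φ hA hφ z hz => ?_⟩
  have hM := contDiff_morCur hA hφ (contDiff_chiP ε) (contDiff_zetaP ε)
  have hg := continuous_rad_sq_gDen hA hφ ε
  have hw : Continuous fun p => rad p ^ 2 * wDen ε A φ p :=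
    (continuous_rad.pow 2).mul (continuous_wDen hA hφ ε)
  have hk := continuous_rad_sq_kDen hA hφ
  have hd : Continuous fun p => rad p ^ 2 * divV (morCur (chiP ε) (zetaP ε) A φ) p :=
    (continuous_rad.pow 2).mul (continuous_divV hM)
  have hwk : Continuous fun p => C * (rad p ^ 2 * wDen ε A φ p + rad p ^ 2 * kDen A φ p) :=
    (hw.add hk).const_mul C
  rw [fluxT_fluxR_div hM, sq_mul_avg hz, gA, wA, kA, ← avg_add hw hk, ← avg_const_mul,
    ← avg_const_mul, ← avg_add hd hwk]
  refine avg_mono (hg.const_mul c) (hd.add hwk) (fun p => ?_) z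
  rcases rad_eq_zero_or_pos p with h0 | h0
  · simp [h0]
  · have := mul_le_mul_of_nonneg_left (h A φ hA hφ p h0) (sq_nonneg (rad p))
    simp only [Pi.add_apply]
    linarith

lemma continuous_nA (hφ : ContDiff ℝ (⊤ : ℕ∞) φ) : Continuous (nA φ) :=
  continuous_avg (hφ.continuous.norm.pow 2)

lemma fluxS_energy_nonneg (hA : ContDiff ℝ (⊤ : ℕ∞) A) (hφ : ContDiff ℝ (⊤ : ℕ∞) φ) {σ : ℝ}
    (hσ : σ = 0 ∨ σ = -1 ∨ σ = 1) {z : ℝ × ℝ} (hz : 0 ≤ z.2) :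
    0 ≤ fluxS σ (energyCur A φ) z := by
  obtain ⟨t, r⟩ := z
  rcases hz.eq_or_lt with h | h
  · have h' : r = 0 := h.symm
    rw [h', fluxS_zero_radius]
  · rw [fluxS_eq (contDiff_energyCur hA hφ)]
    refine integral_nonneg_of_ae ?_
    filter_upwards [ae_sphMeas] with ω hω
    rw [radialPart_eq_rdir _ h hω]
    have hr : rad (pt t r ω) = r := rad_pt h.le hω
    have := energy_flux_nonneg (A := A) (φ := φ) (p := pt t r ω) (by rw [hr]; exact h) hσ
    rwa [hr] at this

lemma abs_fluxS_morawetz_le (hε : 0 < ε) (hA : ContDiff ℝ (⊤ : ℕ∞) A)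
    (hφ : ContDiff ℝ (⊤ : ℕ∞) φ) {σ : ℝ}
    (hσ : σ = 0 ∨ σ = -1 ∨ σ = 1) {z : ℝ × ℝ} (hz : 0 ≤ z.2) :
    |fluxS σ (morCur (chiP ε) (zetaP ε) A φ) z|
      ≤ 4 * cZ ε * (fluxS σ (energyCur A φ) z + nA φ z) := by
  have hc := cZ_ge hε
  have hn := avg_nonneg (F := fun p => ‖φ p‖ ^ 2) (fun p => by positivity) z
  obtain ⟨t, r⟩ := z
  rcases hz.eq_or_lt with h | h
  · have h' : r = 0 := h.symm
    rw [h'] at hn ⊢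
    rw [fluxS_zero_radius, fluxS_zero_radius, abs_zero, nA]
    have : 0 ≤ cZ ε := by linarith
    positivity
  · have hE := contDiff_energyCur hA hφ
    have hM := contDiff_morCur hA hφ (contDiff_chiP ε) (contDiff_zetaP ε)
    have hint : ∀ {Y : Fin 4 → V → ℝ}, (∀ μ, ContDiff ℝ 1 (Y μ)) → Integrable (fun ω =>
        (t, r).2 ^ 2 * (Y 0 (pt (t, r).1 (t, r).2 ω) + σ * radialPart Y (t, r) ω)) sphMeas := fun hY =>
      integrable_sphMeas (continuous_const.mul (((hY 0).continuous.comp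
        (continuous_pt_right (t, r))).add (continuous_const.mul
        ((contDiff_radialPart hY).continuous.comp (continuous_const.prodMk continuous_id)))))
    have hN : Integrable (fun ω => ‖φ (pt (t, r).1 (t, r).2 ω)‖ ^ 2) sphMeas :=
      integrable_sphMeas ((hφ.continuous.comp (continuous_pt_right (t, r))).norm.pow 2)
    rw [fluxS_eq hE, fluxS_eq hM, nA, avg, ← integral_add (hint hE) hN, ← integral_const_mul]
    refine (abs_integral_le_integral_abs).trans (integral_mono_ae (hint hM).abs
      (((hint hE).add hN).const_mul _) ?_)
    filter_upwards [ae_sphMeas] with ω hω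
    rw [radialPart_eq_rdir _ h hω, radialPart_eq_rdir _ h hω]
    have hr : rad (pt t r ω) = r := rad_pt h.le hω
    have := morawetz_flux_le (A := A) (φ := φ) (p := pt t r ω) hε (by rw [hr]; exact h) hσ
    rwa [hr] at this

end

section

variable {A : V → Fin 4 → ℝ} {φ : V → ℂ} {p : V} {ε : ℝ}

lemma contDiff_norm_sq {n : WithTop ℕ∞} (hφ : ContDiff ℝ n φ) :
    ContDiff ℝ n fun p => ‖φ p‖ ^ 2 := by
  simp only [← ip_self]
  exact contDiff_ip hφ hφ

lemma pd_norm_sq (A : V → Fin 4 → ℝ) (μ : Fin 4) (hφ : DifferentiableAt ℝ φ p) :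
    pd μ (fun q => ‖φ q‖ ^ 2) p = 2 * ip (covD A μ φ p) (φ p) := by
  simp only [← ip_self]
  rw [pd_ip (A := A) μ hφ hφ, ip_comm (φ p)]
  ring

/-- The derivative of `φ` along `a ∂_t + b ∂_r`. -/
def dirTR (a b : ℝ) (A : V → Fin 4 → ℝ) (φ : V → ℂ) (p : V) : ℂ :=
  (a : ℂ) * covD A 0 φ p + (b : ℂ) * dRad A φ p

lemma fderiv_norm_sq_pt (A : V → Fin 4 → ℝ) (hφ : ContDiff ℝ 1 φ) {z : ℝ × ℝ} (hz : 0 < z.2)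
    {ω : E3} (hω : ‖ω‖ = 1) (a b : ℝ) :
    fderiv ℝ (fun q : (ℝ × ℝ) × E3 => ‖φ (pt q.1.1 q.1.2 q.2)‖ ^ 2) (z, ω) ((a, b), 0)
      = 2 * ip (dirTR a b A φ (pt z.1 z.2 ω)) (φ (pt z.1 z.2 ω)) := by
  have hd := (hφ.differentiable (by simp)) (pt z.1 z.2 ω)
  have h := fderiv_comp_pt (contDiff_norm_sq hφ) z ω a b 0
  refine h.trans ?_
  have hr := rad_pt (t := z.1) hz.le hω
  simp only [pd_norm_sq A _ hd, Fin.sum_univ_three]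
  rw [dirTR, ip_add_left, ip_smul_left, ip_smul_left, ip_dRad, hr]
  have e1 : (Fin.succ 0 : Fin 4) = 1 := rfl
  have e2 : (Fin.succ 1 : Fin 4) = 2 := rfl
  have e3 : (Fin.succ 2 : Fin 4) = 3 := rfl
  rw [e1, e2, e3]
  have p1 : pt z.1 z.2 ω 1 = z.2 * ω 0 := by simp [pt]
  have p2 : pt z.1 z.2 ω 2 = z.2 * ω 1 := by simp [pt]
  have p3 : pt z.1 z.2 ω 3 = z.2 * ω 2 := by simp [pt]
  rw [p1, p2, p3]
  simp
  field_simp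

lemma contDiff_nA (hφ : ContDiff ℝ 1 φ) : ContDiff ℝ 1 (nA φ) :=
  contDiff_sphMeas_integral (F := fun q : (ℝ × ℝ) × E3 => ‖φ (pt q.1.1 q.1.2 q.2)‖ ^ 2)
    ((contDiff_norm_sq hφ).comp contDiff_pt)

/-- The admissible conormals together with the tangent of the surface. -/
def IsDir (σ a b : ℝ) : Prop :=
  (σ = 0 ∧ a = 0 ∧ b = 1) ∨ (σ = -1 ∧ a = 1 ∧ b = 1) ∨ (σ = 1 ∧ a = 1 ∧ b = -1)

lemma IsDir.conormal {σ a b : ℝ} (h : IsDir σ a b) : σ = 0 ∨ σ = -1 ∨ σ = 1 := by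
  rcases h with h | h | h
  exacts [Or.inl h.1, Or.inr (Or.inl h.1), Or.inr (Or.inr h.1)]

lemma norm_dirTR_sq_le {σ a b : ℝ} (h : IsDir σ a b) (hp : 0 < rad p) :
    ‖dirTR a b A φ p‖ ^ 2 ≤ 2 * (energyCur A φ 0 p + σ * rdir (energyCur A φ) p) := by
  have hds := eDslash_nonneg (A := A) (φ := φ) (p := p)
  rcases h with ⟨rfl, rfl, rfl⟩ | ⟨rfl, rfl, rfl⟩ | ⟨rfl, rfl, rfl⟩
  · rw [energyCur_zero, eD_eq_frame hp]
    simp [dirTR]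
    nlinarith [sq_nonneg ‖covD A 0 φ p‖]
  · rw [energy_flux_out hp]
    simp [dirTR]
    linarith
  · rw [energy_flux_in hp]
    simp [dirTR, ← sub_eq_add_neg]
    linarith

lemma abs_radius_mul_fderiv_nA_le (hA : ContDiff ℝ (⊤ : ℕ∞) A) (hφ : ContDiff ℝ (⊤ : ℕ∞) φ)
    {σ a b : ℝ} (h : IsDir σ a b) {z : ℝ × ℝ} (hz : 0 ≤ z.2) :
    |z.2 * fderiv ℝ (nA φ) z (a, b)| ≤ 1 / 2 * nA φ z + 4 * fluxS σ (energyCur A φ) z := by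
  have hn := avg_nonneg (F := fun p => ‖φ p‖ ^ 2) (fun p => by positivity) z
  have hE := contDiff_energyCur hA hφ
  have hφ1 : ContDiff ℝ 1 φ := hφ.of_le (by simp)
  have he := fluxS_energy_nonneg hA hφ h.conormal hz
  rcases hz.eq_or_lt with h0 | h0
  · rw [← h0, zero_mul, abs_zero, nA]
    positivity
  have hF : ContDiff ℝ 1 fun q : (ℝ × ℝ) × E3 => ‖φ (pt q.1.1 q.1.2 q.2)‖ ^ 2 :=
    (contDiff_norm_sq hφ1).comp contDiff_pt
  have hd : fderiv ℝ (nA φ) z (a, b)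
      = ∫ ω, fderiv ℝ (fun q : (ℝ × ℝ) × E3 => ‖φ (pt q.1.1 q.1.2 q.2)‖ ^ 2) (z, ω) ((a, b), 0)
          ∂sphMeas := by
    rw [← sphMeas_integral_fderiv_apply hF]
    exact congrArg (fun L => L (a, b)) (hasFDerivAt_sphMeas_integral hF z).fderiv
  have hEi : Integrable (fun ω => z.2 ^ 2 * (energyCur A φ 0 (pt z.1 z.2 ω)
      + σ * radialPart (energyCur A φ) z ω)) sphMeas :=
    integrable_sphMeas (continuous_const.mul (((hE 0).continuous.comp
      (continuous_pt_right z)).add (continuous_const.mul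
        ((contDiff_radialPart hE).continuous.comp (continuous_const.prodMk continuous_id)))))
  have hN : Integrable (fun ω => ‖φ (pt z.1 z.2 ω)‖ ^ 2) sphMeas :=
    integrable_sphMeas ((hφ.continuous.comp (continuous_pt_right z)).norm.pow 2)
  have hD : Continuous fun ω =>
      fderiv ℝ (fun q : (ℝ × ℝ) × E3 => ‖φ (pt q.1.1 q.1.2 q.2)‖ ^ 2) (z, ω) ((a, b), 0) :=
    ((hF.continuous_fderiv (by simp)).comp (continuous_const.prodMk continuous_id)).clm_apply
      continuous_const
  rw [hd, fluxS_eq hE, nA, avg, ← integral_const_mul, ← integral_const_mul, ← integral_const_mul,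
    ← integral_add (hN.const_mul _) (hEi.const_mul _)]
  refine abs_integral_le_integral_abs.trans (integral_mono_ae
    (integrable_sphMeas (hD.const_mul z.2)).abs ((hN.const_mul _).add (hEi.const_mul _)) ?_)
  filter_upwards [ae_sphMeas] with ω hω
  rw [fderiv_norm_sq_pt A hφ1 h0 hω, radialPart_eq_rdir _ h0 hω]
  have hr : 0 < rad (pt z.1 z.2 ω) := by rwa [rad_pt h0.le hω]
  have h1 := norm_dirTR_sq_le (A := A) (φ := φ) h hr
  have h2 := abs_ip_le (dirTR a b A φ (pt z.1 z.2 ω)) (φ (pt z.1 z.2 ω))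
  rw [abs_mul, abs_mul, abs_two, abs_of_pos h0]
  have h3 := mul_le_mul_of_nonneg_left h2 h0.le
  have h4 := mul_le_mul_of_nonneg_left h1 (sq_nonneg z.2)
  nlinarith [sq_nonneg (2 * (z.2 * ‖dirTR a b A φ (pt z.1 z.2 ω)‖) - ‖φ (pt z.1 z.2 ω)‖)]

end

section

variable {A : V → Fin 4 → ℝ} {φ : V → ℂ} {p : V} {ε : ℝ}

/-- A Hardy inequality on a half-line for functions vanishing at infinity. -/
lemma ofReal_mul_le_lintegral_of_tendsto_zero {h d Y : ℝ → ℝ} {r : ℝ} (hr : 0 < r)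
    (hd : ∀ ρ, r ≤ ρ → HasDerivAt h (d ρ) ρ) (h0 : ∀ ρ, 0 ≤ h ρ) (hY : Continuous Y)
    (hY0 : ∀ ρ, r ≤ ρ → 0 ≤ Y ρ)
    (hb : ∀ ρ, r ≤ ρ → d ρ ^ 2 ≤ 4 * h ρ * Y ρ) (ht : Filter.Tendsto h Filter.atTop (nhds 0)) :
    ENNReal.ofReal (r * h r) ≤ ∫⁻ ρ in Ici r, ENNReal.ofReal (ρ ^ 2 * Y ρ) := by
  rcases eq_or_ne (∫⁻ ρ in Ici r, ENNReal.ofReal (ρ ^ 2 * Y ρ)) ⊤ with htop | htop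
  · rw [htop]; exact le_top
  set I := (∫⁻ ρ in Ici r, ENNReal.ofReal (ρ ^ 2 * Y ρ)) with hI
  rw [← ENNReal.ofReal_toReal htop]
  refine ENNReal.ofReal_le_ofReal ?_
  have hYc : Continuous fun ρ => ρ ^ 2 * Y ρ := (continuous_pow 2).mul hY
  have hint : ∀ T, r ≤ T → ∫ ρ in r..T, ρ ^ 2 * Y ρ ≤ I.toReal := fun T hT => by
    rw [intervalIntegral.integral_of_le hT, integral_eq_lintegral_of_nonneg_ae]
    · refine ENNReal.toReal_mono htop (lintegral_mono_set fun x hx => le_of_lt hx.1)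
    · filter_upwards [ae_restrict_mem measurableSet_Ioc] with ρ hρ
      exact mul_nonneg (sq_nonneg ρ) (hY0 ρ hρ.1.le)
    · exact hYc.aestronglyMeasurable
  have key : ∀ c : ℝ, 0 < c → r / (1 + c * r) * h r ≤ I.toReal := fun c hc => by
    have hpos : ∀ ρ, r ≤ ρ → 0 < 1 + c * ρ := fun ρ hρ => by
      have : 0 < c * ρ := mul_pos hc (hr.trans_le hρ)
      linarith
    have hder : ∀ ρ, r ≤ ρ → HasDerivAt (fun ρ => -(ρ / (1 + c * ρ) * h ρ))
        (-(1 / (1 + c * ρ) ^ 2 * h ρ + ρ / (1 + c * ρ) * d ρ)) ρ := fun ρ hρ => by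
      have h1 : HasDerivAt (fun ρ : ℝ => 1 + c * ρ) c ρ := by
        simpa using ((hasDerivAt_id ρ).const_mul c).const_add 1
      have h2 := ((hasDerivAt_id ρ).div h1 (hpos ρ hρ).ne').mul (hd ρ hρ)
      refine h2.neg.congr_deriv ?_
      simp only [id]
      congr 3
      ring
    have hle : ∀ T, r ≤ T → r / (1 + c * r) * h r ≤ 1 / c * h T + I.toReal := fun T hT => by
      have h1 := intervalIntegral.sub_le_integral_of_hasDeriv_right_of_le hT
        (fun ρ hρ => (hder ρ hρ.1).continuousAt.continuousWithinAt)
        (fun ρ hρ => (hder ρ hρ.1.le).hasDerivWithinAt)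
        (φ := fun ρ => ρ ^ 2 * Y ρ) hYc.continuousOn.integrableOn_Icc (fun ρ hρ => by
          have hp := hpos ρ hρ.1.le
          have hY1 := hY0 ρ hρ.1.le
          have hb1 := hb ρ hρ.1.le
          have hh := h0 ρ
          set q := 1 / (1 + c * ρ) with hq
          have hq0 : 0 < q := by positivity
          have e1 : 1 / (1 + c * ρ) ^ 2 = q ^ 2 := by rw [hq, div_pow, one_pow]
          have e2 : ρ / (1 + c * ρ) = q * ρ := by rw [hq]; ring
          rw [e1, e2]
          have hs : 0 ≤ q ^ 2 * h ρ + ρ ^ 2 * Y ρ := by positivity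
          have h3 : (q * ρ * d ρ) ^ 2 ≤ (q ^ 2 * h ρ + ρ ^ 2 * Y ρ) ^ 2 := by
            have := mul_le_mul_of_nonneg_left hb1 (sq_nonneg (q * ρ))
            nlinarith [sq_nonneg (q ^ 2 * h ρ - ρ ^ 2 * Y ρ)]
          have := abs_le_of_sq_le_sq h3 hs
          linarith [(abs_le.1 this).1])
      have h2 : T / (1 + c * T) ≤ 1 / c := by
        rw [div_le_div_iff₀ (hpos T hT) hc]; linarith
      have h3 := mul_le_mul_of_nonneg_right h2 (h0 T)
      have := hint T hT
      linarith
    have hlim : Filter.Tendsto (fun T => 1 / c * h T + I.toReal) Filter.atTop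
        (nhds (1 / c * 0 + I.toReal)) := (ht.const_mul _).add_const _
    rw [mul_zero, zero_add] at hlim
    exact ge_of_tendsto hlim ((Filter.eventually_ge_atTop r).mono hle)
  have hlim : Filter.Tendsto (fun c : ℝ => r / (1 + c * r) * h r) (nhdsWithin 0 (Ioi 0))
      (nhds (r / (1 + 0 * r) * h r)) := by
    refine Filter.Tendsto.mono_left ?_ nhdsWithin_le_nhds
    have : ContinuousAt (fun c : ℝ => r / (1 + c * r) * h r) 0 := by
      refine ContinuousAt.mul (ContinuousAt.div continuousAt_const (by fun_prop) (by simp))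
        continuousAt_const
    exact this
  have := le_of_tendsto hlim (eventually_mem_nhdsWithin.mono key)
  simpa using this

lemma ofReal_avg {F : V → ℝ} (hF : Continuous F) (h0 : ∀ p, 0 ≤ F p) (z : ℝ × ℝ) :
    ENNReal.ofReal (avg F z) = ∫⁻ ω, ENNReal.ofReal (F (pt z.1 z.2 ω)) ∂sphMeas :=
  ofReal_integral_eq_lintegral_ofReal (integrable_sphMeas (hF.comp (continuous_pt_right z)))
    (Filter.Eventually.of_forall fun _ => h0 _)

/-- If `φ` tends to zero along every ray, its mean on a sphere is controlled by the flux
through the surface emanating from that sphere. -/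
lemma ofReal_radius_mul_nA_le (hA : ContDiff ℝ (⊤ : ℕ∞) A) (hφ : ContDiff ℝ (⊤ : ℕ∞) φ)
    {σ a t r : ℝ} (h : IsDir σ a 1) (hr : 0 < r)
    (ht : ∀ ω : E3, ‖ω‖ = 1 →
      Filter.Tendsto (fun ρ => φ (pt (t + a * ρ) ρ ω)) Filter.atTop (nhds 0)) :
    ENNReal.ofReal (r * nA φ (t + a * r, r))
      ≤ 2 * ∫⁻ ρ in Ici r, ENNReal.ofReal (fluxS σ (energyCur A φ) (t + a * ρ, ρ)) := by
  have hφ1 : ContDiff ℝ 1 φ := hφ.of_le (by simp)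
  have hE := contDiff_energyCur hA hφ
  have hF : ContDiff ℝ 1 fun q : (ℝ × ℝ) × E3 => ‖φ (pt q.1.1 q.1.2 q.2)‖ ^ 2 :=
    (contDiff_norm_sq hφ1).comp contDiff_pt
  obtain ⟨Y, hYdef⟩ : ∃ Y : ℝ → E3 → ℝ, Y = fun ρ ω =>
    2 * (energyCur A φ 0 (pt (t + a * ρ) ρ ω)
      + σ * radialPart (energyCur A φ) (t + a * ρ, ρ) ω) := ⟨_, rfl⟩
  have hYc : Continuous fun q : ℝ × E3 => Y q.1 q.2 := by
    have hc : Continuous fun q : ℝ × E3 => (((t + a * q.1, q.1), q.2) : (ℝ × ℝ) × E3) := by fun_prop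
    rw [hYdef]
    exact continuous_const.mul ((((hE 0).continuous.comp continuous_pt).comp hc).add
      (continuous_const.mul ((contDiff_radialPart hE).continuous.comp hc)))
  have hbound : ∀ ρ, r ≤ ρ → ∀ ω : E3, ‖ω‖ = 1 →
      ‖dirTR a 1 A φ (pt (t + a * ρ) ρ ω)‖ ^ 2 ≤ Y ρ ω := fun ρ hρ ω hω => by
    have hρ0 := hr.trans_le hρ
    have := norm_dirTR_sq_le (A := A) (φ := φ) (p := pt (t + a * ρ) ρ ω) h
      (by rwa [rad_pt hρ0.le hω])
    rw [hYdef]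
    dsimp only
    rwa [radialPart_eq_rdir _ (z := (t + a * ρ, ρ)) hρ0 hω]
  have hder : ∀ ρ, r ≤ ρ → ∀ ω : E3, ‖ω‖ = 1 →
      HasDerivAt (fun ρ => ‖φ (pt (t + a * ρ) ρ ω)‖ ^ 2)
        (2 * ip (dirTR a 1 A φ (pt (t + a * ρ) ρ ω)) (φ (pt (t + a * ρ) ρ ω))) ρ :=
      fun ρ hρ ω hω => by
    have hρ0 := hr.trans_le hρ
    have h1 := fderiv_norm_sq_pt A hφ1 (z := (t + a * ρ, ρ)) hρ0 hω a 1
    have h2 : HasDerivAt (fun ρ : ℝ => (((t + a * ρ, ρ), ω) : (ℝ × ℝ) × E3)) ((a, 1), 0) ρ := by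
      have h3 : HasDerivAt (fun ρ : ℝ => t + a * ρ) a ρ := by
        simpa using ((hasDerivAt_id ρ).const_mul a).const_add t
      exact (h3.prodMk (hasDerivAt_id ρ)).prodMk (hasDerivAt_const ρ ω)
    exact (HasFDerivAt.comp_hasDerivAt ρ
      ((hF.differentiable one_ne_zero) ((t + a * ρ, ρ), ω)).hasFDerivAt h2).congr_deriv h1
  have hpt : ∀ ω : E3, ‖ω‖ = 1 → ENNReal.ofReal (r * ‖φ (pt (t + a * r) r ω)‖ ^ 2)
      ≤ ∫⁻ ρ in Ici r, ENNReal.ofReal (ρ ^ 2 * Y ρ ω) := fun ω hω => by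
    refine ofReal_mul_le_lintegral_of_tendsto_zero hr
      (h := fun ρ => ‖φ (pt (t + a * ρ) ρ ω)‖ ^ 2)
      (d := fun ρ => 2 * ip (dirTR a 1 A φ (pt (t + a * ρ) ρ ω)) (φ (pt (t + a * ρ) ρ ω)))
      (Y := fun ρ => Y ρ ω) (fun ρ hρ => ?_) (fun ρ => by positivity)
      (hYc.comp (by fun_prop : Continuous fun ρ : ℝ => (ρ, ω)))
      (fun ρ hρ => (sq_nonneg _).trans (hbound ρ hρ ω hω)) (fun ρ hρ => ?_) ?_
    · exact hder ρ hρ ω hω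
    · have h1 := abs_ip_le (dirTR a 1 A φ (pt (t + a * ρ) ρ ω)) (φ (pt (t + a * ρ) ρ ω))
      have h2 := hbound ρ hρ ω hω
      have h3 := mul_self_le_mul_self (abs_nonneg _) h1
      rw [abs_mul_abs_self] at h3
      have h4 := mul_le_mul_of_nonneg_left h2 (sq_nonneg ‖φ (pt (t + a * ρ) ρ ω)‖)
      nlinarith
    · have := ((ht ω hω).norm).pow 2
      simpa using this
  have hN : Continuous fun p => r * ‖φ p‖ ^ 2 := continuous_const.mul (hφ.continuous.norm.pow 2)
  have e1 : r * nA φ (t + a * r, r) = avg (fun p => r * ‖φ p‖ ^ 2) (t + a * r, r) := by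
    rw [avg_const_mul, nA]
  rw [e1, ofReal_avg hN (fun p => by positivity)]
  calc _ ≤ ∫⁻ ω, (∫⁻ ρ in Ici r, ENNReal.ofReal (ρ ^ 2 * Y ρ ω)) ∂sphMeas := by
        refine lintegral_mono_ae ?_
        filter_upwards [ae_sphMeas] with ω hω using hpt ω hω
    _ = ∫⁻ ρ in Ici r, (∫⁻ ω, ENNReal.ofReal (ρ ^ 2 * Y ρ ω) ∂sphMeas) := by
        refine lintegral_lintegral_swap ?_
        have : Continuous fun q : E3 × ℝ => q.2 ^ 2 * Y q.2 q.1 :=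
          (continuous_snd.pow 2).mul (hYc.comp (continuous_snd.prodMk continuous_fst))
        exact this.measurable.ennreal_ofReal.aemeasurable
    _ = ∫⁻ ρ in Ici r, 2 * ENNReal.ofReal (fluxS σ (energyCur A φ) (t + a * ρ, ρ)) := by
        refine setLIntegral_congr_fun measurableSet_Ici fun ρ hρ => ?_
        have hc : Continuous fun ω => ρ ^ 2 * Y ρ ω :=
          continuous_const.mul (hYc.comp (continuous_const.prodMk continuous_id))
        have e2 : ∀ x : ℝ, (2 : ENNReal) * ENNReal.ofReal x = ENNReal.ofReal (2 * x) := fun x => by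
          rw [ENNReal.ofReal_mul (by norm_num), ENNReal.ofReal_ofNat]
        rw [← ofReal_integral_eq_lintegral_ofReal (integrable_sphMeas hc) ?_, fluxS_eq hE,
          e2, ← integral_const_mul]
        · congr 2
          funext ω
          simp only [hYdef]
          ring
        · filter_upwards [ae_sphMeas] with ω hω
          exact mul_nonneg (sq_nonneg ρ) ((sq_nonneg _).trans (hbound ρ hρ ω hω))
    _ = _ := by
        rw [lintegral_const_mul']
        norm_num

end

/-! ## Divergence theorem on planar regions -/

/-- The divergence of a planar vector field. -/
def div2 (P Q : ℝ × ℝ → ℝ) (z : ℝ × ℝ) : ℝ := fderiv ℝ P z (1, 0) + fderiv ℝ Q z (0, 1)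

lemma continuous_div2 {P Q : ℝ × ℝ → ℝ} (hP : ContDiff ℝ 1 P) (hQ : ContDiff ℝ 1 Q) :
    Continuous (div2 P Q) :=
  ((hP.continuous_fderiv one_ne_zero).clm_apply continuous_const).add
    ((hQ.continuous_fderiv one_ne_zero).clm_apply continuous_const)

lemma integral_div2_box {P Q : ℝ × ℝ → ℝ} (hP : ContDiff ℝ 1 P) (hQ : ContDiff ℝ 1 Q)
    (a₁ b₁ a₂ b₂ : ℝ) :
    (∫ x in a₁..b₁, ∫ y in a₂..b₂, div2 P Q (x, y)) =
      (((∫ x in a₁..b₁, Q (x, b₂)) - ∫ x in a₁..b₁, Q (x, a₂)) + ∫ y in a₂..b₂, P (b₁, y)) -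
        ∫ y in a₂..b₂, P (a₁, y) :=
  integral2_divergence_prod_of_hasFDerivAt P Q (fderiv ℝ P) (fderiv ℝ Q) a₁ a₂ b₁ b₂
    hP.continuous.continuousOn hQ.continuous.continuousOn
    (fun x _ => (hP.differentiable one_ne_zero x).hasFDerivAt)
    (fun x _ => (hQ.differentiable one_ne_zero x).hasFDerivAt)
    ((continuous_div2 hP hQ).continuousOn.integrableOn_compact
      (isCompact_uIcc.prod isCompact_uIcc))

/-- The divergence theorem on a region bounded below by the line `y = l * x + k`. -/
lemma integral_div2_trapezoid {P Q : ℝ × ℝ → ℝ} (hP : ContDiff ℝ 1 P) (hQ : ContDiff ℝ 1 Q)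
    (l k a b d : ℝ) :
    (∫ x in a..b, ∫ y in (l * x + k)..d, div2 P Q (x, y)) =
      (∫ x in a..b, Q (x, d)) - (∫ x in a..b, (Q (x, l * x + k) - l * P (x, l * x + k)))
        + (∫ y in (l * b + k)..d, P (b, y)) - ∫ y in (l * a + k)..d, P (a, y) := by
  obtain ⟨w, hw⟩ : ∃ w : ℝ → ℝ, w = fun x => d - (l * x + k) := ⟨_, rfl⟩
  obtain ⟨Ψ, hΨ⟩ : ∃ Ψ : ℝ × ℝ → ℝ × ℝ, Ψ = fun z => (z.1, l * z.1 + k + w z.1 * z.2) := ⟨_, rfl⟩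
  have hΨc : ContDiff ℝ 1 Ψ := by rw [hΨ, hw]; fun_prop
  have hwc : ContDiff ℝ 1 fun z : ℝ × ℝ => w z.1 := by rw [hw]; fun_prop
  have hΨd (z : ℝ × ℝ) : HasFDerivAt Ψ (fderiv ℝ Ψ z) z :=
    (hΨc.differentiable one_ne_zero z).hasFDerivAt
  have hΨ1 (z : ℝ × ℝ) : fderiv ℝ Ψ z (1, 0) = (1, l * (1 - z.2)) := by
    have h : HasDerivAt (fun s : ℝ => Ψ (z.1 + s, z.2)) (1, l * (1 - z.2)) 0 := by
      rw [hΨ, hw]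
      refine HasDerivAt.prodMk ((hasDerivAt_id (0 : ℝ)).const_add _) ?_
      have := ((((hasDerivAt_id (0 : ℝ)).const_add z.1).const_mul l).add_const k)
      exact (this.add ((this.const_sub d).mul_const z.2)).congr_deriv (by ring)
    have h2 : HasDerivAt (fun s : ℝ => (z.1 + s, z.2)) ((1 : ℝ), (0 : ℝ)) 0 :=
      ((hasDerivAt_id (0 : ℝ)).const_add _).prodMk (hasDerivAt_const _ _)
    have h3 := (show HasFDerivAt Ψ (fderiv ℝ Ψ z) (z.1 + 0, z.2) by
      simpa using hΨd z).comp_hasDerivAt (0 : ℝ) h2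
    exact h3.unique h
  have hΨ2 (z : ℝ × ℝ) : fderiv ℝ Ψ z (0, 1) = (0, w z.1) := by
    have h : HasDerivAt (fun s : ℝ => Ψ (z.1, z.2 + s)) (0, w z.1) 0 := by
      rw [hΨ]
      refine HasDerivAt.prodMk (hasDerivAt_const _ _) ?_
      exact ((((hasDerivAt_id (0 : ℝ)).const_add z.2).const_mul (w z.1)).const_add
        (l * z.1 + k)).congr_deriv (by ring)
    have h2 : HasDerivAt (fun s : ℝ => (z.1, z.2 + s)) ((0 : ℝ), (1 : ℝ)) 0 :=
      (hasDerivAt_const _ _).prodMk ((hasDerivAt_id (0 : ℝ)).const_add _)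
    have h3 := (show HasFDerivAt Ψ (fderiv ℝ Ψ z) (z.1, z.2 + 0) by
      simpa using hΨd z).comp_hasDerivAt (0 : ℝ) h2
    exact h3.unique h
  have hw1 (z : ℝ × ℝ) (e : ℝ × ℝ) : fderiv ℝ (fun z : ℝ × ℝ => w z.1) z e = -l * e.1 := by
    have : HasFDerivAt (fun z : ℝ × ℝ => w z.1) (-(l • ContinuousLinearMap.fst ℝ ℝ ℝ)) z := by
      rw [hw]
      exact ((hasFDerivAt_fst.const_mul l).add_const k).const_sub d
    rw [this.fderiv]
    simp
  have hs1 (z : ℝ × ℝ) : HasFDerivAt (fun z : ℝ × ℝ => l * (1 - z.2))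
      (l • -(ContinuousLinearMap.snd ℝ ℝ ℝ)) z := (hasFDerivAt_snd.const_sub 1).const_mul l
  have hPΨ : ContDiff ℝ 1 fun z => P (Ψ z) := hP.comp hΨc
  have hQΨ : ContDiff ℝ 1 fun z => Q (Ψ z) := hQ.comp hΨc
  have hsc : ContDiff ℝ 1 fun z : ℝ × ℝ => l * (1 - z.2) := by fun_prop
  have hchain {H : ℝ × ℝ → ℝ} (hH : ContDiff ℝ 1 H) (z e : ℝ × ℝ) :
      fderiv ℝ (fun z => H (Ψ z)) z e = fderiv ℝ H (Ψ z) (fderiv ℝ Ψ z e) := by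
    rw [fderiv_fun_comp z (hH.differentiable one_ne_zero _) (hΨc.differentiable one_ne_zero z)]
    rfl
  have hdir (L : ℝ × ℝ →L[ℝ] ℝ) (x y : ℝ) : L (x, y) = x * L (1, 0) + y * L (0, 1) := by
    have : ((x, y) : ℝ × ℝ) = x • (1, 0) + y • (0, 1) := by simp
    rw [this, map_add, map_smul, map_smul]
    rfl
  have key (z : ℝ × ℝ) :
      div2 (fun z => w z.1 * P (Ψ z)) (fun z => Q (Ψ z) - l * (1 - z.2) * P (Ψ z)) z
        = w z.1 * div2 P Q (Ψ z) := by
    have e1 := fderiv_fun_mul (hwc.differentiable one_ne_zero z) (hPΨ.differentiable one_ne_zero z)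
    have e2 := fderiv_fun_mul (hsc.differentiable one_ne_zero z) (hPΨ.differentiable one_ne_zero z)
    have e3 := fderiv_fun_sub (hQΨ.differentiable one_ne_zero z)
      ((hsc.mul hPΨ).differentiable one_ne_zero z)
    rw [div2, e1, e3, e2, (hs1 z).fderiv]
    simp only [add_apply, sub_apply, smul_apply, smul_eq_mul, hw1,
      hchain hP, hchain hQ, hΨ1, hΨ2, neg_apply, ContinuousLinearMap.coe_snd', div2]
    rw [hdir _ 1 (l * (1 - z.2)), hdir (fderiv ℝ Q _) 0 (w z.1), hdir (fderiv ℝ P _) 0 (w z.1)]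
    ring
  have hsub (H : ℝ × ℝ → ℝ) (x : ℝ) :
      (∫ s in (0 : ℝ)..1, w x * H (Ψ (x, s))) = ∫ y in (l * x + k)..d, H (x, y) := by
    have := intervalIntegral.smul_integral_comp_add_mul (a := 0) (b := 1)
      (fun y => H (x, y)) (w x) (l * x + k)
    rw [intervalIntegral.integral_const_mul, hΨ]
    rw [smul_eq_mul] at this
    rw [this, hw]
    congr 1 <;> ring
  have main := integral_div2_box (hwc.mul hPΨ) (hQΨ.sub (hsc.mul hPΨ)) a b 0 1
  simp only [key] at main
  simp only [hsub] at main
  rw [main]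
  have h1 : ∀ x, Ψ (x, 1) = (x, d) := fun x => by rw [hΨ, hw]; simp
  have h0 : ∀ x, Ψ (x, 0) = (x, l * x + k) := fun x => by rw [hΨ]; simp
  simp only [h1, h0]
  simp

/-- The divergence theorem in null coordinates `t = u + v`, `r = v - u`. -/
lemma integral_div2_null {P Q : ℝ × ℝ → ℝ} (hP : ContDiff ℝ 1 P) (hQ : ContDiff ℝ 1 Q)
    (l k a b d : ℝ) :
    2 * (∫ u in a..b, ∫ v in (l * u + k)..d, div2 P Q (u + v, v - u)) =
      (∫ u in a..b, (P (u + d, d - u) + Q (u + d, d - u)))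
        - (∫ u in a..b, ((1 - l) * P (u + (l * u + k), l * u + k - u)
          + (1 + l) * Q (u + (l * u + k), l * u + k - u)))
        + (∫ v in (l * b + k)..d, (P (b + v, v - b) - Q (b + v, v - b)))
        - ∫ v in (l * a + k)..d, (P (a + v, v - a) - Q (a + v, v - a)) := by
  obtain ⟨Φ, hΦ⟩ : ∃ Φ : ℝ × ℝ →L[ℝ] ℝ × ℝ, ∀ z, Φ z = (z.1 + z.2, z.2 - z.1) :=
    ⟨(ContinuousLinearMap.fst ℝ ℝ ℝ + ContinuousLinearMap.snd ℝ ℝ ℝ).prod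
      (ContinuousLinearMap.snd ℝ ℝ ℝ - ContinuousLinearMap.fst ℝ ℝ ℝ), fun z => by simp⟩
  have hchain {H : ℝ × ℝ → ℝ} (hH : ContDiff ℝ 1 H) (z e : ℝ × ℝ) :
      fderiv ℝ (fun z => H (Φ z)) z e = fderiv ℝ H (Φ z) (Φ e) := by
    rw [fderiv_fun_comp z (hH.differentiable one_ne_zero _) Φ.differentiableAt, Φ.fderiv]
    rfl
  have hdir (L : ℝ × ℝ →L[ℝ] ℝ) (x y : ℝ) : L (x, y) = x * L (1, 0) + y * L (0, 1) := by
    have : ((x, y) : ℝ × ℝ) = x • (1, 0) + y • (0, 1) := by simp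
    rw [this, map_add, map_smul, map_smul]
    rfl
  have hm := integral_div2_trapezoid ((hP.sub hQ).comp Φ.contDiff) ((hP.add hQ).comp Φ.contDiff)
    l k a b d
  have key (z : ℝ × ℝ) : div2 ((fun z => P z - Q z) ∘ Φ) ((fun z => P z + Q z) ∘ Φ) z
      = 2 * div2 P Q (Φ z) := by
    rw [div2, div2]
    change fderiv ℝ (fun z => (fun z => P z - Q z) (Φ z)) z (1, 0)
      + fderiv ℝ (fun z => (fun z => P z + Q z) (Φ z)) z (0, 1) = _
    rw [hchain (hP.sub hQ), hchain (hP.add hQ),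
      fderiv_fun_sub (hP.differentiable one_ne_zero _) (hQ.differentiable one_ne_zero _),
      fderiv_fun_add (hP.differentiable one_ne_zero _) (hQ.differentiable one_ne_zero _), hΦ (1, 0),
      hΦ (0, 1)]
    simp only [sub_apply, add_apply]
    rw [hdir (fderiv ℝ P _) (1 + 0) (0 - 1), hdir (fderiv ℝ Q _) (1 + 0) (0 - 1),
      hdir (fderiv ℝ P _) (0 + 1) (1 - 0), hdir (fderiv ℝ Q _) (0 + 1) (1 - 0)]
    ring
  simp only [key] at hm
  simp only [intervalIntegral.integral_const_mul, hΦ, Function.comp_apply] at hm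
  rw [hm]
  congr 3
  refine intervalIntegral.integral_congr fun u _ => ?_
  ring

section

/-! ## Integrals along segments of the `(t, r)` half plane -/

section Segments
variable {A : V → Fin 4 → ℝ} {φ : V → ℂ} {ε : ℝ}

lemma continuous_fluxS {Y : Fin 4 → V → ℝ} (hY : ∀ μ, ContDiff ℝ 1 (Y μ)) (σ : ℝ) :
    Continuous (fluxS σ Y) :=
  (contDiff_fluxT hY).continuous.add (continuous_const.mul (contDiff_fluxR hY).continuous)

/-- The integral of `f` along `s ↦ (t₀ + a s, r₀ + b s)`, `s₀ ≤ s ≤ s₁`. -/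
def segI (t₀ r₀ a b s₀ s₁ : ℝ) (f : ℝ × ℝ → ℝ) : ℝ :=
  ∫ s in s₀..s₁, f (t₀ + a * s, r₀ + b * s)

lemma continuous_seg (t₀ r₀ a b : ℝ) : Continuous fun s : ℝ => (t₀ + a * s, r₀ + b * s) := by
  fun_prop

lemma segI_nonneg {t₀ r₀ a b s₀ s₁ : ℝ} {f : ℝ × ℝ → ℝ} (hs : s₀ ≤ s₁)
    (hr : ∀ s ∈ Icc s₀ s₁, 0 ≤ r₀ + b * s) (hf : ∀ z : ℝ × ℝ, 0 ≤ z.2 → 0 ≤ f z) :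
    0 ≤ segI t₀ r₀ a b s₀ s₁ f :=
  intervalIntegral.integral_nonneg hs fun s hs => hf _ (hr s hs)

lemma abs_segI_morawetz_le (hε : 0 < ε) (hA : ContDiff ℝ (⊤ : ℕ∞) A)
    (hφ : ContDiff ℝ (⊤ : ℕ∞) φ) {σ : ℝ} (hσ : σ = 0 ∨ σ = -1 ∨ σ = 1)
    {t₀ r₀ a b s₀ s₁ : ℝ} (hs : s₀ ≤ s₁) (hr : ∀ s ∈ Icc s₀ s₁, 0 ≤ r₀ + b * s) :
    |segI t₀ r₀ a b s₀ s₁ (fluxS σ (morCur (chiP ε) (zetaP ε) A φ))|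
      ≤ 4 * cZ ε * (segI t₀ r₀ a b s₀ s₁ (fluxS σ (energyCur A φ))
        + segI t₀ r₀ a b s₀ s₁ (nA φ)) := by
  have hγ := continuous_seg t₀ r₀ a b
  have hE : Continuous fun s => fluxS σ (energyCur A φ) (t₀ + a * s, r₀ + b * s) :=
    (continuous_fluxS (contDiff_energyCur hA hφ) σ).comp hγ
  have hM : Continuous fun s => fluxS σ (morCur (chiP ε) (zetaP ε) A φ) (t₀ + a * s, r₀ + b * s) :=
    (continuous_fluxS (contDiff_morCur hA hφ (contDiff_chiP ε) (contDiff_zetaP ε)) σ).comp hγ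
  have hn : Continuous fun s => nA φ (t₀ + a * s, r₀ + b * s) := (continuous_nA hφ).comp hγ
  refine (intervalIntegral.abs_integral_le_integral_abs hs).trans ?_
  rw [segI, segI, ← intervalIntegral.integral_add (hE.intervalIntegrable _ _)
    (hn.intervalIntegrable _ _), ← intervalIntegral.integral_const_mul]
  refine intervalIntegral.integral_mono_on hs (hM.abs.intervalIntegrable _ _)
    (((hE.add hn).const_mul _).intervalIntegrable _ _) fun s hs => ?_
  exact abs_fluxS_morawetz_le hε hA hφ hσ (hr s hs)

/-- Hardy's inequality along a segment. -/
lemma abs_radius_mul_nA_sub_le (hA : ContDiff ℝ (⊤ : ℕ∞) A) (hφ : ContDiff ℝ (⊤ : ℕ∞) φ)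
    {σ a b : ℝ} (h : IsDir σ a b) {t₀ r₀ s₀ s₁ : ℝ} (hs : s₀ ≤ s₁)
    (hr : ∀ s ∈ Icc s₀ s₁, 0 ≤ r₀ + b * s) :
    |(r₀ + b * s₁) * nA φ (t₀ + a * s₁, r₀ + b * s₁)
        - (r₀ + b * s₀) * nA φ (t₀ + a * s₀, r₀ + b * s₀) - b * segI t₀ r₀ a b s₀ s₁ (nA φ)|
      ≤ 1 / 2 * segI t₀ r₀ a b s₀ s₁ (nA φ)
        + 4 * segI t₀ r₀ a b s₀ s₁ (fluxS σ (energyCur A φ)) := by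
  have hγ := continuous_seg t₀ r₀ a b
  have hE : Continuous fun s => fluxS σ (energyCur A φ) (t₀ + a * s, r₀ + b * s) :=
    (continuous_fluxS (contDiff_energyCur hA hφ) σ).comp hγ
  have hn1 : ContDiff ℝ 1 (nA φ) := contDiff_nA (hφ.of_le (by simp))
  have hn : Continuous fun s => nA φ (t₀ + a * s, r₀ + b * s) := hn1.continuous.comp hγ
  have hd : Continuous fun s => (r₀ + b * s) * fderiv ℝ (nA φ) (t₀ + a * s, r₀ + b * s) (a, b) :=
    (by fun_prop : Continuous fun s : ℝ => r₀ + b * s).mul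
      (((hn1.continuous_fderiv one_ne_zero).comp hγ).clm_apply continuous_const)
  have hder (s : ℝ) : HasDerivAt
      (fun s => (r₀ + b * s) * nA φ (t₀ + a * s, r₀ + b * s))
      (b * nA φ (t₀ + a * s, r₀ + b * s)
        + (r₀ + b * s) * fderiv ℝ (nA φ) (t₀ + a * s, r₀ + b * s) (a, b)) s := by
    have h1 (c d : ℝ) : HasDerivAt (fun s : ℝ => c + d * s) d s := by
      simpa using ((hasDerivAt_id s).const_mul d).const_add c
    exact (h1 r₀ b).mul ((hn1.differentiable one_ne_zero _).hasFDerivAt.comp_hasDerivAt s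
      ((h1 t₀ a).prodMk (h1 r₀ b)))
  have hF := intervalIntegral.integral_eq_sub_of_hasDerivAt (fun s _ => hder s)
    (((hn.const_mul b).add hd).intervalIntegrable s₀ s₁)
  rw [← hF]
  have e1 := intervalIntegral.integral_add ((hn.const_mul b).intervalIntegrable (μ := volume) s₀ s₁)
    (hd.intervalIntegrable (μ := volume) s₀ s₁)
  rw [e1, intervalIntegral.integral_const_mul]
  simp only [segI]
  rw [add_sub_cancel_left]
  refine (intervalIntegral.abs_integral_le_integral_abs hs).trans ?_
  rw [← intervalIntegral.integral_const_mul, ← intervalIntegral.integral_const_mul,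
    ← intervalIntegral.integral_add ((hn.const_mul _).intervalIntegrable _ _)
    ((hE.const_mul _).intervalIntegrable _ _)]
  exact intervalIntegral.integral_mono_on hs (hd.abs.intervalIntegrable _ _)
    (((hn.const_mul _).add (hE.const_mul _)).intervalIntegrable _ _)
    fun s hs => abs_radius_mul_fderiv_nA_le hA hφ h (z := (t₀ + a * s, r₀ + b * s)) (hr s hs)

end Segments

/-- The region `a ≤ u ≤ b`, `l u + k ≤ v ≤ d` in the null coordinates `u`, `v` of the
`(t, r)` plane. -/
def trap (l k a b d : ℝ) : Set (ℝ × ℝ) :=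
  {z | a ≤ (z.1 - z.2) / 2 ∧ (z.1 - z.2) / 2 ≤ b ∧
    l * ((z.1 - z.2) / 2) + k ≤ (z.1 + z.2) / 2 ∧ (z.1 + z.2) / 2 ≤ d}

lemma isClosed_trap (l k a b d : ℝ) : IsClosed (trap l k a b d) := by
  simp only [trap, ofPred_and]
  refine .inter (isClosed_le ?_ ?_) (.inter (isClosed_le ?_ ?_)
    (.inter (isClosed_le ?_ ?_) (isClosed_le ?_ ?_))) <;> fun_prop

lemma isCompact_trap (l k a b d : ℝ) : IsCompact (trap l k a b d) := by
  have hc : IsCompact ((fun w : ℝ × ℝ => (w.1 + w.2, w.2 - w.1)) ''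
      (Icc a b ×ˢ Icc (k - |l| * (|a| + |b|)) d)) :=
    (isCompact_Icc.prod isCompact_Icc).image (by fun_prop)
  refine hc.of_isClosed_subset (isClosed_trap ..) fun z hz => ?_
  obtain ⟨h1, h2, h3, h4⟩ := hz
  refine ⟨((z.1 - z.2) / 2, (z.1 + z.2) / 2), ⟨⟨h1, h2⟩, ⟨?_, h4⟩⟩, ?_⟩
  · have h5 : |(z.1 - z.2) / 2| ≤ |a| + |b| := by
      rw [abs_le]
      constructor <;> [linarith [neg_abs_le a, abs_nonneg b]; linarith [le_abs_self b, abs_nonneg a]]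
    have h6 := mul_le_mul_of_nonneg_left h5 (abs_nonneg l)
    rw [← abs_mul] at h6
    have := neg_abs_le (l * ((z.1 - z.2) / 2))
    dsimp only
    linarith
  · ext <;> dsimp only <;> ring

lemma setIntegral_trap {f : ℝ × ℝ → ℝ} (hf : Continuous f) {l k a b d : ℝ} (hab : a ≤ b)
    (hd : ∀ u ∈ Icc a b, l * u + k ≤ d) :
    ∫ z in trap l k a b d, f z
      = 2 * ∫ u in a..b, ∫ v in (l * u + k)..d, f (u + v, v - u) := by
  obtain ⟨L, hL⟩ : ∃ L : ℝ × ℝ →L[ℝ] ℝ × ℝ, L =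
      (Matrix.toLin (Module.Basis.finTwoProd ℝ) (Module.Basis.finTwoProd ℝ)
        !![1, 1; -1, 1]).toContinuousLinearMap := ⟨_, rfl⟩
  have hLa : ∀ w : ℝ × ℝ, L w = (w.1 + w.2, w.2 - w.1) := fun w => by
    rw [hL]
    simp [Matrix.toLin_finTwoProd_apply]
    ring
  have hdet : L.det = 2 := by
    rw [hL]
    simp [LinearMap.det_toLin]
    norm_num
  obtain ⟨S, hS⟩ : ∃ S : Set (ℝ × ℝ), S =
    {w | a ≤ w.1 ∧ w.1 ≤ b ∧ l * w.1 + k ≤ w.2 ∧ w.2 ≤ d} := ⟨_, rfl⟩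
  have hSm : MeasurableSet S := by
    rw [hS]
    simp only [ofPred_and]
    refine IsClosed.measurableSet <| .inter (isClosed_le ?_ ?_) (.inter (isClosed_le ?_ ?_)
      (.inter (isClosed_le ?_ ?_) (isClosed_le ?_ ?_))) <;> fun_prop
  have himg : L '' S = trap l k a b d := by
    ext z
    constructor
    · rintro ⟨w, hw, rfl⟩
      rw [hS] at hw
      obtain ⟨h1, h2, h3, h4⟩ := hw
      have e1 : ((L w).1 - (L w).2) / 2 = w.1 := by rw [hLa]; ring
      have e2 : ((L w).1 + (L w).2) / 2 = w.2 := by rw [hLa]; ring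
      exact ⟨by rwa [e1], by rwa [e1], by rwa [e1, e2], by rwa [e2]⟩
    · intro hz
      refine ⟨((z.1 - z.2) / 2, (z.1 + z.2) / 2), by rw [hS]; exact hz, ?_⟩
      rw [hLa]
      ext <;> dsimp only <;> ring
  have hinj : InjOn L S := fun x _ y _ hxy => by
    rw [hLa, hLa, Prod.mk.injEq] at hxy
    ext <;> linarith [hxy.1, hxy.2]
  have h1 := integral_image_eq_integral_abs_det_fderiv_smul volume hSm
    (fun x _ => L.hasFDerivAt.hasFDerivWithinAt) hinj f
  rw [himg, hdet] at h1
  have hbd : S ⊆ Icc a b ×ˢ Icc (k - |l| * (|a| + |b|)) d := fun w hw => by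
    rw [hS] at hw
    obtain ⟨h1, h2, h3, h4⟩ := hw
    refine ⟨⟨h1, h2⟩, ?_, h4⟩
    have h5 : |w.1| ≤ |a| + |b| := by
      rw [abs_le]
      constructor <;> [linarith [neg_abs_le a, abs_nonneg b]; linarith [le_abs_self b, abs_nonneg a]]
    have h6 := mul_le_mul_of_nonneg_left h5 (abs_nonneg l)
    rw [← abs_mul] at h6
    linarith [neg_abs_le (l * w.1)]
  have hLc : Continuous fun w => f (L w) := hf.comp L.continuous
  have hint : Integrable (S.indicator fun w => f (L w)) (volume.prod volume) := by
    rw [integrable_indicator_iff hSm]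
    exact (hLc.continuousOn.integrableOn_compact (isCompact_Icc.prod isCompact_Icc)).mono_set hbd
  rw [h1]
  simp only [abs_two, smul_eq_mul]
  rw [integral_const_mul, ← integral_indicator hSm, Measure.volume_eq_prod, integral_prod _ hint]
  congr 1
  rw [intervalIntegral.integral_of_le hab, ← integral_Icc_eq_integral_Ioc,
    ← integral_indicator measurableSet_Icc]
  refine integral_congr_ae (Filter.Eventually.of_forall fun u => ?_)
  by_cases hu : u ∈ Icc a b
  · dsimp only
    rw [indicator_of_mem hu, intervalIntegral.integral_of_le (hd u hu),
      ← integral_Icc_eq_integral_Ioc, ← integral_indicator measurableSet_Icc]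
    refine integral_congr_ae (Filter.Eventually.of_forall fun v => ?_)
    by_cases hv : v ∈ Icc (l * u + k) d
    · have : (u, v) ∈ S := by rw [hS]; exact ⟨hu.1, hu.2, hv.1, hv.2⟩
      dsimp only
      rw [indicator_of_mem this, indicator_of_mem hv, hLa]
    · have : (u, v) ∉ S := by rw [hS]; exact fun h => hv ⟨h.2.2.1, h.2.2.2⟩
      dsimp only
      rw [indicator_of_notMem this, indicator_of_notMem hv]
  · dsimp only
    rw [indicator_of_notMem hu]
    have : ∀ v, S.indicator (fun w => f (L w)) (u, v) = 0 := fun v =>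
      indicator_of_notMem (by rw [hS]; exact fun h => hu ⟨h.1, h.2.1⟩) _
    simp [this]

lemma setIntegral_box {f : ℝ × ℝ → ℝ} (hf : Continuous f) {a b c d : ℝ} (hab : a ≤ b)
    (hcd : c ≤ d) :
    ∫ z in Icc a b ×ˢ Icc c d, f z = ∫ t in a..b, ∫ r in c..d, f (t, r) := by
  rw [Measure.volume_eq_prod, setIntegral_prod f
    (hf.continuousOn.integrableOn_compact (isCompact_Icc.prod isCompact_Icc)),
    intervalIntegral.integral_of_le hab, ← integral_Icc_eq_integral_Ioc]
  refine setIntegral_congr_fun measurableSet_Icc fun t _ => ?_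
  rw [intervalIntegral.integral_of_le hcd, ← integral_Icc_eq_integral_Ioc]

end

section

/-! ## The reduced energy estimates -/

section Reduced
variable {A : V → Fin 4 → ℝ} {φ : V → ℂ} {ε : ℝ}

lemma continuous_gA (hA : ContDiff ℝ (⊤ : ℕ∞) A) (hφ : ContDiff ℝ (⊤ : ℕ∞) φ) (ε : ℝ) :
    Continuous (gA ε A φ) := continuous_avg (continuous_rad_sq_gDen hA hφ ε)

lemma continuous_wA (hA : ContDiff ℝ (⊤ : ℕ∞) A) (hφ : ContDiff ℝ (⊤ : ℕ∞) φ) (ε : ℝ) :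
    Continuous (wA ε A φ) :=
  continuous_avg ((continuous_rad.pow 2).mul (continuous_wDen hA hφ ε))

lemma continuous_kA (hA : ContDiff ℝ (⊤ : ℕ∞) A) (hφ : ContDiff ℝ (⊤ : ℕ∞) φ) :
    Continuous (kA A φ) := continuous_avg (continuous_rad_sq_kDen hA hφ)

lemma setIntegral_div_energy_le (hA : ContDiff ℝ (⊤ : ℕ∞) A) (hφ : ContDiff ℝ (⊤ : ℕ∞) φ)
    {S : Set (ℝ × ℝ)} (hS : IsCompact S) (h0 : ∀ z ∈ S, 0 ≤ z.2) {δ : ℝ} (hδ : 0 < δ) :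
    ∫ z in S, div2 (fluxT (energyCur A φ)) (fluxR (energyCur A φ)) z
      ≤ δ * (∫ z in S, gA ε A φ z) + 1 / (4 * δ) * (∫ z in S, wA ε A φ z)
        + ∫ z in S, kA A φ z := by
  have hE := contDiff_energyCur hA hφ
  have hi {f : ℝ × ℝ → ℝ} (hf : Continuous f) : IntegrableOn f S :=
    hf.continuousOn.integrableOn_compact hS
  have hg := continuous_gA hA hφ ε
  have hw := continuous_wA hA hφ ε
  have hk := continuous_kA hA hφ
  rw [← integral_const_mul, ← integral_const_mul,
    ← integral_add (hi (hg.const_mul _)) (hi (hw.const_mul _)),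
    ← integral_add (hi (f := fun z => δ * gA ε A φ z + 1 / (4 * δ) * wA ε A φ z) (by fun_prop))
      (hi hk)]
  refine setIntegral_mono_on (hi (continuous_div2 (contDiff_fluxT hE) (contDiff_fluxR hE)))
    (hi (((hg.const_mul _).add (hw.const_mul _)).add hk)) hS.measurableSet fun z hz => ?_
  exact (le_abs_self _).trans (abs_div_energy_le hA hφ hδ (h0 z hz))

lemma exists_setIntegral_div_morawetz_ge (hε : 0 < ε) : ∃ c > 0, ∃ C > 0,
    ∀ (A : V → Fin 4 → ℝ) (φ : V → ℂ),
    ContDiff ℝ (⊤ : ℕ∞) A → ContDiff ℝ (⊤ : ℕ∞) φ → ∀ S : Set (ℝ × ℝ), IsCompact S →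
    (∀ z ∈ S, 0 ≤ z.2) →
    c * (∫ z in S, gA ε A φ z) ≤ (∫ z in S, div2 (fluxT (morCur (chiP ε) (zetaP ε) A φ))
      (fluxR (morCur (chiP ε) (zetaP ε) A φ)) z)
      + C * ((∫ z in S, wA ε A φ z) + ∫ z in S, kA A φ z) := by
  obtain ⟨c, hc, C, hC, h⟩ := exists_div_morawetz_ge hε
  refine ⟨c, hc, C, hC, fun A φ hA hφ S hS h0 => ?_⟩
  have hM := contDiff_morCur hA hφ (contDiff_chiP ε) (contDiff_zetaP ε)
  have hi {f : ℝ × ℝ → ℝ} (hf : Continuous f) : IntegrableOn f S :=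
    hf.continuousOn.integrableOn_compact hS
  have hg := continuous_gA hA hφ ε
  have hw := continuous_wA hA hφ ε
  have hk := continuous_kA hA hφ
  have hd := continuous_div2 (contDiff_fluxT hM) (contDiff_fluxR hM)
  rw [← integral_const_mul, ← integral_add (hi hw) (hi hk), ← integral_const_mul,
    ← integral_add (hi hd) (hi (f := fun z => C * (wA ε A φ z + kA A φ z)) (by fun_prop))]
  exact setIntegral_mono_on (hi (hg.const_mul _)) (hi (hd.add ((hw.add hk).const_mul _)))
    hS.measurableSet fun z hz => h A φ hA hφ z (h0 z hz)

lemma fluxR_zero_radius (Y : Fin 4 → V → ℝ) (t : ℝ) : fluxR Y (t, 0) = 0 := by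
  simp [fluxR]

lemma fluxS_zero (Y : Fin 4 → V → ℝ) (z : ℝ × ℝ) : fluxS 0 Y z = fluxT Y z := by
  simp [fluxS]

lemma fluxS_one (Y : Fin 4 → V → ℝ) (z : ℝ × ℝ) : fluxS 1 Y z = fluxT Y z + fluxR Y z := by
  simp [fluxS]

lemma fluxS_neg_one (Y : Fin 4 → V → ℝ) (z : ℝ × ℝ) :
    fluxS (-1) Y z = fluxT Y z - fluxR Y z := by
  simp [fluxS, sub_eq_add_neg]

lemma segI_slice (t a b : ℝ) (f : ℝ × ℝ → ℝ) : segI t 0 0 1 a b f = ∫ r in a..b, f (t, r) := by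
  simp [segI]

lemma segI_cone (u a b : ℝ) (f : ℝ × ℝ → ℝ) :
    segI u (-u) 1 1 a b f = ∫ v in a..b, f (u + v, v - u) := by
  simp [segI, neg_add_eq_sub]

lemma segI_inc (v a b : ℝ) (f : ℝ × ℝ → ℝ) :
    segI v v 1 (-1) a b f = ∫ u in a..b, f (u + v, v - u) := by
  simp [segI, add_comm, sub_eq_add_neg]

lemma integral_div2_interior {Y : Fin 4 → V → ℝ} (hY : ∀ μ, ContDiff ℝ 1 (Y μ)) {R u₁ u₂ d : ℝ}
    (hR : 0 ≤ R) (hu : u₁ ≤ u₂) (hd : u₂ + R ≤ d) :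
    (∫ z in Icc (2 * u₁ + R) (2 * u₂ + R) ×ˢ Icc 0 R, div2 (fluxT Y) (fluxR Y) z)
      + ∫ z in trap 1 R u₁ u₂ d, div2 (fluxT Y) (fluxR Y) z
    = segI (2 * u₂ + R) 0 0 1 0 R (fluxS 0 Y) + segI u₂ (-u₂) 1 1 (u₂ + R) d (fluxS (-1) Y)
      + segI d d 1 (-1) u₁ u₂ (fluxS 1 Y)
      - (segI (2 * u₁ + R) 0 0 1 0 R (fluxS 0 Y)
        + segI u₁ (-u₁) 1 1 (u₁ + R) d (fluxS (-1) Y)) := by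
  have hP := contDiff_fluxT hY
  have hQ := contDiff_fluxR hY
  rw [setIntegral_box (continuous_div2 hP hQ) (by linarith) hR,
    setIntegral_trap (continuous_div2 hP hQ) hu (fun u h => by linarith [h.2]),
    integral_div2_box hP hQ, integral_div2_null hP hQ]
  have h1 : (∫ x in (2 * u₁ + R)..(2 * u₂ + R), fluxR Y (x, R))
      = ∫ u in u₁..u₂, ((1 - 1) * fluxT Y (u + (1 * u + R), 1 * u + R - u)
          + (1 + 1) * fluxR Y (u + (1 * u + R), 1 * u + R - u)) := by
    rw [← intervalIntegral.smul_integral_comp_mul_add, smul_eq_mul,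
      ← intervalIntegral.integral_const_mul]
    refine intervalIntegral.integral_congr fun u _ => ?_
    ring_nf
  rw [h1]
  simp only [fluxR_zero_radius, intervalIntegral.integral_zero, segI_slice, segI_cone, segI_inc,
    fluxS_zero, fluxS_neg_one, fluxS_one, one_mul]
  ring

lemma integral_div2_exterior {Y : Fin 4 → V → ℝ} (hY : ∀ μ, ContDiff ℝ 1 (Y μ)) {u₁ u₂ : ℝ}
    (hu : u₁ ≤ u₂) :
    (∫ z in trap (-1) 0 u₁ u₂ (-u₁), div2 (fluxT Y) (fluxR Y) z)
    = segI u₂ (-u₂) 1 1 (-u₂) (-u₁) (fluxS (-1) Y)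
      + segI (-u₁) (-u₁) 1 (-1) u₁ u₂ (fluxS 1 Y)
      - segI 0 0 0 1 (-2 * u₂) (-2 * u₁) (fluxS 0 Y) := by
  have hP := contDiff_fluxT hY
  have hQ := contDiff_fluxR hY
  rw [setIntegral_trap (continuous_div2 hP hQ) hu (fun u h => by linarith [h.1]),
    integral_div2_null hP hQ]
  have h1 : segI 0 0 0 1 (-2 * u₂) (-2 * u₁) (fluxS 0 Y)
      = ∫ u in u₁..u₂, ((1 - -1) * fluxT Y (u + (-1 * u + 0), -1 * u + 0 - u)
          + (1 + -1) * fluxR Y (u + (-1 * u + 0), -1 * u + 0 - u)) := by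
    rw [segI_slice, intervalIntegral.integral_symm, ← intervalIntegral.smul_integral_comp_mul_left,
      smul_eq_mul, ← intervalIntegral.integral_const_mul, ← intervalIntegral.integral_neg]
    refine intervalIntegral.integral_congr fun u _ => ?_
    simp only [fluxS]
    ring_nf
  rw [h1]
  simp only [segI_cone, segI_inc, fluxS_neg_one, fluxS_one, add_zero, neg_one_mul,
    intervalIntegral.integral_same, sub_zero]
  ring

/-- The bulk terms and the Hardy terms can be absorbed. -/
lemma exists_absorption {c C K : ℝ} (hc : 0 < c) (hC : 0 < C) (hK : 0 < K) : ∃ C' > 0,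
    ∀ G W F e₁ e₂ e₃ h₁ h₂ h₃ m₁ m₂ m₃ N N' BE BM : ℝ,
    0 ≤ W → 0 ≤ F → 0 ≤ e₁ → 0 ≤ N →
    e₂ + e₃ = e₁ + BE → (∀ δ > 0, BE ≤ δ * G + 1 / (4 * δ) * W + F) →
    m₂ + m₃ = m₁ + BM → c * G ≤ BM + C * (W + F) →
    |m₁| ≤ K * (e₁ + h₁) → |m₂| ≤ K * (e₂ + h₂) → |m₃| ≤ K * (e₃ + h₃) →
    1 / 2 * h₁ ≤ N + 4 * e₁ → 1 / 2 * h₂ ≤ N' + 4 * e₂ → 1 / 2 * h₃ + N' ≤ N + 4 * e₃ →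
    G + e₂ + e₃ ≤ C' * (e₁ + N + W + F) := by
  obtain ⟨D, hD⟩ : ∃ D, D = 9 * K * (18 * K / (4 * c)) := ⟨_, rfl⟩
  have hD0 : 0 < D := by rw [hD]; positivity
  refine ⟨4 / c * (27 * K + D + C) + 1, by positivity, ?_⟩
  intro G W F e₁ e₂ e₃ h₁ h₂ h₃ m₁ m₂ m₃ N N' BE BM hW hF he hN hE hBE hM hBM b₁ b₂ b₃ k₁ k₂ k₃
  have t₁ := neg_abs_le m₁
  have t₂ := le_abs_self m₂
  have t₃ := le_abs_self m₃
  have h4 : K * (e₁ + h₁) + K * (e₂ + h₂) + K * (e₃ + h₃)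
      ≤ K * (18 * e₁ + 4 * N + 9 * BE) := by
    rw [← mul_add, ← mul_add]
    exact mul_le_mul_of_nonneg_left (by linarith) hK.le
  have h5 := hBE (c / (18 * K)) (by positivity)
  have h6 : 9 * K * BE ≤ c / 2 * G + D * W + 9 * K * F := by
    refine (mul_le_mul_of_nonneg_left h5 (by positivity)).trans_eq ?_
    rw [hD]
    field_simp
    ring
  have h7 : c / 2 * G ≤ (27 * K + D + C) * (e₁ + N + W + F) := by
    have p1 := mul_nonneg hK.le he
    have p2 := mul_nonneg hK.le hN
    have p3 := mul_nonneg hK.le hW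
    have p4 := mul_nonneg hK.le hF
    have p5 := mul_nonneg hD0.le (add_nonneg (add_nonneg he hN) hF)
    have p6 := mul_nonneg hC.le (add_nonneg he hN)
    nlinarith
  have h8 : 2 * G ≤ 4 / c * (27 * K + D + C) * (e₁ + N + W + F) := by
    have := mul_le_mul_of_nonneg_left h7 (by positivity : 0 ≤ 4 / c)
    rw [← mul_assoc, ← mul_assoc] at this
    refine le_trans (le_of_eq ?_) this
    field_simp
    ring
  have h9 := hBE 1 one_pos
  linarith

theorem exists_interior_energy_bound (hε : 0 < ε) : ∃ C > 0, ∀ (A : V → Fin 4 → ℝ) (φ : V → ℂ),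
    ContDiff ℝ (⊤ : ℕ∞) A → ContDiff ℝ (⊤ : ℕ∞) φ → ∀ R u₁ u₂ d : ℝ, 0 ≤ R → u₁ ≤ u₂ →
    u₂ + R ≤ d →
    ((∫ z in Icc (2 * u₁ + R) (2 * u₂ + R) ×ˢ Icc 0 R, gA ε A φ z)
        + ∫ z in trap 1 R u₁ u₂ d, gA ε A φ z)
      + (segI (2 * u₂ + R) 0 0 1 0 R (fluxS 0 (energyCur A φ))
        + segI u₂ (-u₂) 1 1 (u₂ + R) d (fluxS (-1) (energyCur A φ)))
      + segI d d 1 (-1) u₁ u₂ (fluxS 1 (energyCur A φ))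
    ≤ C * ((segI (2 * u₁ + R) 0 0 1 0 R (fluxS 0 (energyCur A φ))
        + segI u₁ (-u₁) 1 1 (u₁ + R) d (fluxS (-1) (energyCur A φ)))
      + (d - u₁) * nA φ (u₁ + d, d - u₁)
      + ((∫ z in Icc (2 * u₁ + R) (2 * u₂ + R) ×ˢ Icc 0 R, wA ε A φ z)
        + ∫ z in trap 1 R u₁ u₂ d, wA ε A φ z)
      + ((∫ z in Icc (2 * u₁ + R) (2 * u₂ + R) ×ˢ Icc 0 R, kA A φ z)
        + ∫ z in trap 1 R u₁ u₂ d, kA A φ z)) := by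
  obtain ⟨c, hc, C, hC, hmor⟩ := exists_setIntegral_div_morawetz_ge hε
  have hcZ := cZ_ge hε
  obtain ⟨C', hC', habs⟩ := exists_absorption hc hC (by linarith : 0 < 4 * cZ ε)
  refine ⟨C', hC', fun A φ hA hφ R u₁ u₂ d hR hu hd => ?_⟩
  have hE := contDiff_energyCur hA hφ
  have hM := contDiff_morCur hA hφ (contDiff_chiP ε) (contDiff_zetaP ε)
  have hbox : IsCompact (Icc (2 * u₁ + R) (2 * u₂ + R) ×ˢ Icc (0 : ℝ) R) :=
    isCompact_Icc.prod isCompact_Icc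
  have hbox0 : ∀ z ∈ Icc (2 * u₁ + R) (2 * u₂ + R) ×ˢ Icc (0 : ℝ) R, 0 ≤ z.2 :=
    fun z hz => hz.2.1
  have htrap := isCompact_trap 1 R u₁ u₂ d
  have htrap0 : ∀ z ∈ trap 1 R u₁ u₂ d, 0 ≤ z.2 := fun z hz => by
    have := hz.2.2.1
    linarith
  have hball : ∀ s ∈ Icc (0 : ℝ) R, 0 ≤ 0 + 1 * s := fun s hs => by linarith [hs.1]
  have hcone (u : ℝ) : ∀ s ∈ Icc (u + R) d, 0 ≤ -u + 1 * s := fun s hs => by linarith [hs.1]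
  have hinc : ∀ s ∈ Icc u₁ u₂, 0 ≤ d + -1 * s := fun s hs => by linarith [hs.2]
  have o : IsDir 0 0 1 := Or.inl ⟨rfl, rfl, rfl⟩
  have l : IsDir (-1) 1 1 := Or.inr (Or.inl ⟨rfl, rfl, rfl⟩)
  have b : IsDir 1 1 (-1) := Or.inr (Or.inr ⟨rfl, rfl, rfl⟩)
  have hn0 : ∀ z : ℝ × ℝ, 0 ≤ nA φ z := avg_nonneg fun p => by positivity
  have he0 {σ : ℝ} (hσ : σ = 0 ∨ σ = -1 ∨ σ = 1) (z : ℝ × ℝ) (hz : 0 ≤ z.2) :=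
    fluxS_energy_nonneg hA hφ hσ hz
  have hnn {S : Set (ℝ × ℝ)} {F : V → ℝ} (h : ∀ p, 0 ≤ F p) : 0 ≤ ∫ z in S, avg F z :=
    integral_nonneg fun z => avg_nonneg h z
  have hw0 : ∀ p, 0 ≤ rad p ^ 2 * wDen ε A φ p := fun p =>
    mul_nonneg (sq_nonneg _) (wDen_nonneg)
  have hk0 : ∀ p, 0 ≤ rad p ^ 2 * kDen A φ p := fun p =>
    mul_nonneg (sq_nonneg _) (kDen_nonneg)
  have gE := integral_div2_interior hE hR hu hd
  have gM := integral_div2_interior hM hR hu hd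
  have hball1 := abs_le.1 (abs_radius_mul_nA_sub_le hA hφ o (t₀ := 2 * u₁ + R) hR hball)
  have hball2 := abs_le.1 (abs_radius_mul_nA_sub_le hA hφ o (t₀ := 2 * u₂ + R) hR hball)
  have hcone1 := abs_le.1 (abs_radius_mul_nA_sub_le hA hφ l (t₀ := u₁) (by linarith) (hcone u₁))
  have hcone2 := abs_le.1 (abs_radius_mul_nA_sub_le hA hφ l (t₀ := u₂) hd (hcone u₂))
  have hinc1 := abs_le.1 (abs_radius_mul_nA_sub_le hA hφ b (t₀ := d) hu hinc)
  have p1 : ((d + 1 * u₁, d + -1 * u₁) : ℝ × ℝ) = (u₁ + d, d - u₁) := by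
    rw [Prod.mk.injEq]; constructor <;> ring
  have p2 : ((d + 1 * u₂, d + -1 * u₂) : ℝ × ℝ) = (u₂ + d, d - u₂) := by
    rw [Prod.mk.injEq]; constructor <;> ring
  have p3 (u : ℝ) : ((u + 1 * d, -u + 1 * d) : ℝ × ℝ) = (u + d, d - u) := by
    rw [Prod.mk.injEq]; constructor <;> ring
  have p4 (u : ℝ) : ((u + 1 * (u + R), -u + 1 * (u + R)) : ℝ × ℝ) = (2 * u + R, R) := by
    rw [Prod.mk.injEq]; constructor <;> ring
  have p5 (u : ℝ) : ((2 * u + R + 0 * R, 0 + 1 * R) : ℝ × ℝ) = (2 * u + R, R) := by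
    rw [Prod.mk.injEq]; constructor <;> ring
  rw [p1, p2] at hinc1
  rw [p3, p4] at hcone1 hcone2
  rw [p5] at hball1 hball2
  have ab {σ t₀ r₀ a b s₀ s₁ : ℝ} (hσ : IsDir σ a b) (hs : s₀ ≤ s₁)
      (hr : ∀ s ∈ Icc s₀ s₁, 0 ≤ r₀ + b * s) :=
    abs_segI_morawetz_le hε hA hφ hσ.conormal (t₀ := t₀) (a := a) hs hr
  refine (habs _ _ _ _
    (segI (2 * u₂ + R) 0 0 1 0 R (fluxS 0 (energyCur A φ))
        + segI u₂ (-u₂) 1 1 (u₂ + R) d (fluxS (-1) (energyCur A φ)))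
    (segI d d 1 (-1) u₁ u₂ (fluxS 1 (energyCur A φ)))
    (segI (2 * u₁ + R) 0 0 1 0 R (nA φ) + segI u₁ (-u₁) 1 1 (u₁ + R) d (nA φ))
    (segI (2 * u₂ + R) 0 0 1 0 R (nA φ) + segI u₂ (-u₂) 1 1 (u₂ + R) d (nA φ))
    (segI d d 1 (-1) u₁ u₂ (nA φ))
    (segI (2 * u₁ + R) 0 0 1 0 R (fluxS 0 (morCur (chiP ε) (zetaP ε) A φ))
      + segI u₁ (-u₁) 1 1 (u₁ + R) d (fluxS (-1) (morCur (chiP ε) (zetaP ε) A φ)))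
    (segI (2 * u₂ + R) 0 0 1 0 R (fluxS 0 (morCur (chiP ε) (zetaP ε) A φ))
      + segI u₂ (-u₂) 1 1 (u₂ + R) d (fluxS (-1) (morCur (chiP ε) (zetaP ε) A φ)))
    (segI d d 1 (-1) u₁ u₂ (fluxS 1 (morCur (chiP ε) (zetaP ε) A φ))) _
    ((d - u₂) * nA φ (u₂ + d, d - u₂)) _ _ ?_ ?_ ?_ ?_ (sub_eq_iff_eq_add'.1 gE.symm)
    (fun δ hδ => ?_) (sub_eq_iff_eq_add'.1 gM.symm) ?_ ?_ ?_ ?_ ?_ ?_ ?_)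
  · exact add_nonneg (hnn hw0) (hnn hw0)
  · exact add_nonneg (hnn hk0) (hnn hk0)
  · exact add_nonneg (segI_nonneg hR hball (he0 o.conormal))
      (segI_nonneg (by linarith) (hcone u₁) (he0 l.conormal))
  · exact mul_nonneg (by linarith) (hn0 _)
  · have a1 := setIntegral_div_energy_le (ε := ε) hA hφ hbox hbox0 hδ
    have a2 := setIntegral_div_energy_le (ε := ε) hA hφ htrap htrap0 hδ
    linarith
  · have a1 := hmor A φ hA hφ _ hbox hbox0
    have a2 := hmor A φ hA hφ _ htrap htrap0
    linarith
  · have a1 := ab (t₀ := 2 * u₁ + R) o hR hball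
    have a2 := ab (t₀ := u₁) l (by linarith) (hcone u₁)
    exact (abs_add_le _ _).trans (by linarith)
  · have a1 := ab (t₀ := 2 * u₂ + R) o hR hball
    have a2 := ab (t₀ := u₂) l hd (hcone u₂)
    exact (abs_add_le _ _).trans (by linarith)
  · exact ab b hu hinc
  · linarith [hball1.1, hcone1.1]
  · linarith [hball2.1, hcone2.1]
  · linarith [hinc1.2]

theorem exists_exterior_energy_bound (hε : 0 < ε) : ∃ C > 0, ∀ (A : V → Fin 4 → ℝ) (φ : V → ℂ),
    ContDiff ℝ (⊤ : ℕ∞) A → ContDiff ℝ (⊤ : ℕ∞) φ → ∀ u₁ u₂ : ℝ, u₁ ≤ u₂ → u₂ ≤ 0 →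
    (∫ z in trap (-1) 0 u₁ u₂ (-u₁), gA ε A φ z)
      + segI u₂ (-u₂) 1 1 (-u₂) (-u₁) (fluxS (-1) (energyCur A φ))
      + segI (-u₁) (-u₁) 1 (-1) u₁ u₂ (fluxS 1 (energyCur A φ))
    ≤ C * (segI 0 0 0 1 (-2 * u₂) (-2 * u₁) (fluxS 0 (energyCur A φ))
      + (-2 * u₁) * nA φ (0, -2 * u₁)
      + (∫ z in trap (-1) 0 u₁ u₂ (-u₁), wA ε A φ z)
      + ∫ z in trap (-1) 0 u₁ u₂ (-u₁), kA A φ z) := by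
  obtain ⟨c, hc, C, hC, hmor⟩ := exists_setIntegral_div_morawetz_ge hε
  have hcZ := cZ_ge hε
  obtain ⟨C', hC', habs⟩ := exists_absorption hc hC (by linarith : 0 < 4 * cZ ε)
  refine ⟨C', hC', fun A φ hA hφ u₁ u₂ hu hu0 => ?_⟩
  have hE := contDiff_energyCur hA hφ
  have hM := contDiff_morCur hA hφ (contDiff_chiP ε) (contDiff_zetaP ε)
  have htrap := isCompact_trap (-1) 0 u₁ u₂ (-u₁)
  have htrap0 : ∀ z ∈ trap (-1) 0 u₁ u₂ (-u₁), 0 ≤ z.2 := fun z hz => by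
    have h1 := hz.2.2.1
    have h2 := hz.2.1
    linarith
  have hbase : ∀ s ∈ Icc (-2 * u₂) (-2 * u₁), 0 ≤ 0 + 1 * s := fun s hs => by linarith [hs.1]
  have hcone : ∀ s ∈ Icc (-u₂) (-u₁), 0 ≤ -u₂ + 1 * s := fun s hs => by linarith [hs.1]
  have hinc : ∀ s ∈ Icc u₁ u₂, 0 ≤ -u₁ + -1 * s := fun s hs => by linarith [hs.2]
  have o : IsDir 0 0 1 := Or.inl ⟨rfl, rfl, rfl⟩
  have l : IsDir (-1) 1 1 := Or.inr (Or.inl ⟨rfl, rfl, rfl⟩)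
  have b : IsDir 1 1 (-1) := Or.inr (Or.inr ⟨rfl, rfl, rfl⟩)
  have hn0 : ∀ z : ℝ × ℝ, 0 ≤ nA φ z := avg_nonneg fun p => by positivity
  have hnn {S : Set (ℝ × ℝ)} {F : V → ℝ} (h : ∀ p, 0 ≤ F p) : 0 ≤ ∫ z in S, avg F z :=
    integral_nonneg fun z => avg_nonneg h z
  have gE := integral_div2_exterior hE hu
  have gM := integral_div2_exterior hM hu
  have hbase1 := abs_le.1 (abs_radius_mul_nA_sub_le hA hφ o (t₀ := 0) (by linarith) hbase)
  have hcone2 := abs_le.1 (abs_radius_mul_nA_sub_le hA hφ l (t₀ := u₂) (by linarith) hcone)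
  have hinc1 := abs_le.1 (abs_radius_mul_nA_sub_le hA hφ b (t₀ := -u₁) hu hinc)
  have p1 : ((-u₁ + 1 * u₁, -u₁ + -1 * u₁) : ℝ × ℝ) = (0, -2 * u₁) := by
    rw [Prod.mk.injEq]; constructor <;> ring
  have p2 : ((-u₁ + 1 * u₂, -u₁ + -1 * u₂) : ℝ × ℝ) = (u₂ - u₁, -u₁ - u₂) := by
    rw [Prod.mk.injEq]; constructor <;> ring
  have p3 : ((u₂ + 1 * -u₁, -u₂ + 1 * -u₁) : ℝ × ℝ) = (u₂ - u₁, -u₁ - u₂) := by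
    rw [Prod.mk.injEq]; constructor <;> ring
  have p4 (s : ℝ) : ((0 + 0 * s, 0 + 1 * s) : ℝ × ℝ) = (0, s) := by
    rw [Prod.mk.injEq]; constructor <;> ring
  rw [p1, p2] at hinc1
  rw [p3] at hcone2
  rw [p4, p4] at hbase1
  have k1 := mul_nonneg (by linarith : 0 ≤ -2 * u₂) (hn0 (0, -2 * u₂))
  have k2 := mul_nonneg (by linarith : 0 ≤ -u₂ + 1 * -u₂)
    (hn0 (u₂ + 1 * -u₂, -u₂ + 1 * -u₂))
  have ab {σ t₀ r₀ a b s₀ s₁ : ℝ} (hσ : IsDir σ a b) (hs : s₀ ≤ s₁)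
      (hr : ∀ s ∈ Icc s₀ s₁, 0 ≤ r₀ + b * s) :=
    abs_segI_morawetz_le hε hA hφ hσ.conormal (t₀ := t₀) (a := a) hs hr
  refine (habs _ _ _ _ _ _
    (segI 0 0 0 1 (-2 * u₂) (-2 * u₁) (nA φ)) (segI u₂ (-u₂) 1 1 (-u₂) (-u₁) (nA φ))
    (segI (-u₁) (-u₁) 1 (-1) u₁ u₂ (nA φ)) _ _ _ _
    ((-u₁ - u₂) * nA φ (u₂ - u₁, -u₁ - u₂)) _ _ ?_ ?_ ?_ ?_ (sub_eq_iff_eq_add'.1 gE.symm)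
    (fun δ hδ => setIntegral_div_energy_le hA hφ htrap htrap0 hδ)
    (sub_eq_iff_eq_add'.1 gM.symm) (hmor A φ hA hφ _ htrap htrap0)
    (ab o (by linarith) hbase) (ab l (by linarith) hcone) (ab b hu hinc) ?_ ?_ ?_)
  · exact hnn fun p => mul_nonneg (sq_nonneg _) (wDen_nonneg)
  · exact hnn fun p => mul_nonneg (sq_nonneg _) (kDen_nonneg)
  · exact segI_nonneg (by linarith) hbase fun z hz => fluxS_energy_nonneg hA hφ o.conormal hz
  · exact mul_nonneg (by linarith) (hn0 _)
  · linarith [hbase1.1]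
  · linarith [hcone2.1]
  · linarith [hinc1.2]

end Reduced

end

/-! ## Polar coordinates in spacetime -/

section SpacetimePolar

lemma continuous_stp : Continuous fun q : ℝ × E3 => stp q.1 q.2 := by
  refine continuous_pi fun i => ?_
  fin_cases i <;> simp [stp] <;> fun_prop

lemma continuous_stp_right (t : ℝ) : Continuous (stp t) :=
  continuous_stp.comp (continuous_const.prodMk continuous_id)

lemma measurePreserving_stp : MeasurePreserving fun q : ℝ × E3 => stp q.1 q.2 := by
  have h1 : MeasurePreserving (Prod.map (id : ℝ → ℝ) (@WithLp.ofLp 2 (Fin 3 → ℝ))) :=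
    (MeasurePreserving.id volume).prod (PiLp.volume_preserving_ofLp (Fin 3))
  have h2 := (volume_preserving_piFinSuccAbove (fun _ : Fin 4 => ℝ) 0).symm
  have h := h2.comp h1
  convert h using 1
  funext q
  ext i
  refine Fin.cases ?_ (fun j => ?_) i
  · simp [stp, MeasurableEquiv.piFinSuccAbove]
  · fin_cases j <;> simp [stp, MeasurableEquiv.piFinSuccAbove] <;> rfl

lemma lintegral_spacetime {f : V → ℝ≥0∞} (hf : Measurable f) :
    ∫⁻ p, f p = ∫⁻ t, ∫⁻ x : E3, f (stp t x) := by
  rw [← measurePreserving_stp.lintegral_comp hf]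
  exact lintegral_prod _ (hf.comp continuous_stp.measurable).aemeasurable

lemma stp_smul (t r : ℝ) (ω : E3) : stp t (r • ω) = pt t r ω := by simp [stp, pt]

lemma tC_pt (t r : ℝ) (ω : E3) : tC (pt t r ω) = t := rfl

/-- The constant relating Lebesgue measure on `ℝ³` to the product of `r² dr` with the Hausdorff
measure on the unit sphere. -/
def IsPolarConst (κ : NNReal) : Prop := ∀ f : E3 → ℝ≥0∞, Measurable f →
  ∫⁻ x, f x = κ * ∫⁻ r in Ioi (0 : ℝ), ENNReal.ofReal (r ^ 2) * ∫⁻ ω, f (r • ω) ∂sphMeas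

lemma volume_rad_eq_zero : volume {p : V | rad p = 0} = 0 := by
  refine measure_mono_null (t := {p : V | p 1 = 0}) (fun p hp => ?_)
    (Measure.pi_hyperplane (fun _ : Fin 4 => (volume : Measure ℝ)) 1 0)
  have h : ∑ i : Fin 3, (p i.succ) ^ 2 = 0 :=
    (Real.sqrt_eq_zero (Finset.sum_nonneg fun _ _ => sq_nonneg _)).1 hp
  have := (Finset.sum_eq_zero_iff_of_nonneg fun _ _ => sq_nonneg _).1 h 0 (Finset.mem_univ _)
  simpa using this

lemma ofReal_sq_mul_lintegral {g : V → ℝ} (hG : Continuous fun p => rad p ^ 2 * g p)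
    (g0 : ∀ p, 0 ≤ g p) (t : ℝ) {r : ℝ} (hr : 0 < r) :
    ENNReal.ofReal (r ^ 2) * ∫⁻ ω, ENNReal.ofReal (rad (pt t r ω) ^ 2 * g (pt t r ω)
      / rad (pt t r ω) ^ 2) ∂sphMeas
      = ENNReal.ofReal (avg (fun p => rad p ^ 2 * g p) (t, r)) := by
  rw [ofReal_avg hG (fun p => mul_nonneg (sq_nonneg _) (g0 p)),
    ← lintegral_const_mul' _ _ ENNReal.ofReal_ne_top]
  refine lintegral_congr_ae ?_
  filter_upwards [ae_sphMeas] with ω hω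
  rw [rad_pt hr.le hω, ← ENNReal.ofReal_mul (sq_nonneg r)]
  congr 1
  have : r ≠ 0 := hr.ne'
  field_simp

lemma lintegral_space {κ : NNReal} (hκ : IsPolarConst κ) {K : Set ℝ} (hK : MeasurableSet K)
    {g : V → ℝ} (hg : Continuous g) (g0 : ∀ p, 0 ≤ g p) (t : ℝ) :
    ∫⁻ x in {x : E3 | ‖x‖ ∈ K}, oR (g (stp t x))
      = κ * ∫⁻ r in K ∩ Ioi 0, ENNReal.ofReal (avg (fun p => rad p ^ 2 * g p) (t, r)) := by
  have hS : MeasurableSet {x : E3 | ‖x‖ ∈ K} := measurable_norm hK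
  have hst := continuous_stp_right t
  have hm : Measurable fun x => oR (g (stp t x)) :=
    ENNReal.measurable_ofReal.comp (hg.comp hst).measurable
  rw [← lintegral_indicator hS, hκ _ (hm.indicator hS), ← Measure.restrict_restrict hK, ← lintegral_indicator hK]
  congr 1
  refine setLIntegral_congr_fun measurableSet_Ioi fun r hr => ?_
  have hr' : 0 < r := hr
  have hn : ∀ᵐ ω ∂sphMeas, ‖r • ω‖ = r := by
    filter_upwards [ae_sphMeas] with ω hω
    rw [norm_smul, hω, mul_one, Real.norm_of_nonneg hr'.le]
  by_cases hrK : r ∈ K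
  · rw [indicator_of_mem hrK, ← ofReal_sq_mul_lintegral (((continuous_rad.pow 2).mul hg)) g0 t hr']
    congr 1
    refine lintegral_congr_ae ?_
    filter_upwards [ae_sphMeas, hn] with ω hω h
    rw [indicator_of_mem (by simpa [h] using hrK), stp_smul, rad_pt hr'.le hω, oR]
    congr 1
    field_simp
  · rw [indicator_of_notMem hrK, lintegral_congr_ae (g := fun _ => 0), lintegral_zero, mul_zero]
    filter_upwards [hn] with ω h
    rw [indicator_of_notMem (by simpa [h] using hrK)]

lemma lintegral_region {κ : NNReal} (hκ : IsPolarConst κ) {K : Set (ℝ × ℝ)} (hK : MeasurableSet K)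
    {g : V → ℝ} (hG : Continuous fun p => rad p ^ 2 * g p) (g0 : ∀ p, 0 ≤ g p) :
    ∫⁻ p in {p : V | (tC p, rad p) ∈ K}, oR (g p)
      = κ * ∫⁻ z in K ∩ {z | 0 < z.2}, ENNReal.ofReal (avg (fun p => rad p ^ 2 * g p) z) := by
  have hm : Measurable fun p : V => (tC p, rad p) :=
    ((measurable_pi_apply 0).prodMk continuous_rad.measurable)
  have hS : MeasurableSet {p : V | (tC p, rad p) ∈ K} := hm hK
  have hpos : MeasurableSet {z : ℝ × ℝ | 0 < z.2} := measurableSet_lt measurable_const measurable_snd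
  have hg' : Measurable fun p : V => ENNReal.ofReal (rad p ^ 2 * g p / rad p ^ 2) :=
    ENNReal.measurable_ofReal.comp (hG.measurable.div (continuous_rad.measurable.pow_const 2))
  have e1 : ∫⁻ p in {p : V | (tC p, rad p) ∈ K}, oR (g p)
      = ∫⁻ p in {p : V | (tC p, rad p) ∈ K}, ENNReal.ofReal (rad p ^ 2 * g p / rad p ^ 2) := by
    refine setLIntegral_congr_fun_ae hS ?_
    have : ∀ᵐ p : V, rad p ≠ 0 := by
      rw [ae_iff]; simpa using volume_rad_eq_zero
    filter_upwards [this] with p hp _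
    rw [oR]; congr 1; field_simp
  have hF : Measurable fun z : ℝ × ℝ => ENNReal.ofReal (avg (fun p => rad p ^ 2 * g p) z) :=
    ENNReal.measurable_ofReal.comp (continuous_avg hG).measurable
  rw [e1, ← lintegral_indicator hS, lintegral_spacetime (hg'.indicator hS),
    ← lintegral_indicator (hK.inter hpos), Measure.volume_eq_prod, lintegral_prod _
      (hF.indicator (hK.inter hpos)).aemeasurable, ← lintegral_const_mul _
      ((hF.indicator (hK.inter hpos)).lintegral_prod_right')]
  refine lintegral_congr fun t => ?_
  refine (hκ _ ((hg'.indicator hS).comp (continuous_stp_right t).measurable)).trans ?_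
  simp only [Function.comp_apply]
  congr 1
  rw [← lintegral_indicator measurableSet_Ioi]
  refine lintegral_congr fun r => ?_
  by_cases hr : 0 < r
  · rw [indicator_of_mem (show r ∈ Ioi 0 from hr)]
    by_cases hrK : (t, r) ∈ K
    · rw [indicator_of_mem (show (t, r) ∈ K ∩ {z : ℝ × ℝ | 0 < z.2} from ⟨hrK, hr⟩),
        ← ofReal_sq_mul_lintegral hG g0 t hr]
      congr 1
      refine lintegral_congr_ae ?_
      filter_upwards [ae_sphMeas] with ω hω
      rw [stp_smul, indicator_of_mem]
      simpa [rad_pt hr.le hω, tC_pt] using hrK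
    · rw [indicator_of_notMem (fun h => hrK h.1), lintegral_congr_ae (g := fun _ => 0),
        lintegral_zero, mul_zero]
      filter_upwards [ae_sphMeas] with ω hω
      rw [stp_smul, indicator_of_notMem]
      simpa [rad_pt hr.le hω, tC_pt] using hrK
  · rw [indicator_of_notMem (show r ∉ Ioi 0 from hr), indicator_of_notMem (fun h => hr h.2)]

end SpacetimePolar

section

/-! ## The fluxes and spacetime norms in terms of the reduced densities -/

section Conversion
variable {A : V → Fin 4 → ℝ} {φ : V → ℂ} {ε : ℝ}

lemma sphI_eq_two_mul_fluxS {Y : Fin 4 → V → ℝ} (hY : ∀ μ, ContDiff ℝ 1 (Y μ)) {σ : ℝ} {f : V → ℝ}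
    (hf : ∀ p, 0 < rad p → f p = 2 * (rad p ^ 2 * (Y 0 p + σ * rdir Y p)))
    (hf₀ : ∀ p, rad p = 0 → f p = 0)
    (hpos : ∀ p, 0 < rad p → 0 ≤ rad p ^ 2 * (Y 0 p + σ * rdir Y p)) (t : ℝ) {r : ℝ} (hr : 0 ≤ r) :
    sphI f t r = 2 * ENNReal.ofReal (fluxS σ Y (t, r)) := by
  change ∫⁻ ω, oR (f (pt t r ω)) ∂sphMeas = _
  rcases hr.eq_or_lt with rfl | hr
  · rw [fluxS_zero_radius, lintegral_congr_ae (g := fun _ => 0)]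
    · simp
    filter_upwards [ae_sphMeas] with ω hω
    rw [hf₀ _ (rad_pt le_rfl hω)]
    simp [oR]
  · have hc : Continuous fun ω : E3 => r ^ 2 * (Y 0 (pt t r ω) + σ * radialPart Y (t, r) ω) := by
      have h1 := (hY 0).continuous.comp (continuous_pt_right (t, r))
      have h2 : Continuous fun ω : E3 => radialPart Y (t, r) ω :=
        (contDiff_radialPart hY).continuous.comp (continuous_const.prodMk continuous_id)
      exact continuous_const.mul (h1.add (continuous_const.mul h2))
    have e : ∀ᵐ ω ∂sphMeas, r ^ 2 * (Y 0 (pt t r ω) + σ * radialPart Y (t, r) ω)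
        = rad (pt t r ω) ^ 2 * (Y 0 (pt t r ω) + σ * rdir Y (pt t r ω)) := by
      filter_upwards [ae_sphMeas] with ω hω
      rw [rad_pt hr.le hω, radialPart_eq_rdir Y (z := (t, r)) hr hω]
    rw [fluxS_eq hY, ofReal_integral_eq_lintegral_ofReal (integrable_sphMeas hc),
      ← lintegral_const_mul' _ _ ENNReal.ofNat_ne_top]
    · refine lintegral_congr_ae ?_
      filter_upwards [ae_sphMeas, e] with ω hω h
      have hp : 0 < rad (pt t r ω) := by rwa [rad_pt hr.le hω]
      rw [hf _ hp, h, oR, ENNReal.ofReal_mul zero_le_two]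
      simp
    · filter_upwards [ae_sphMeas, e] with ω hω h
      rw [h]
      exact hpos _ (by rwa [rad_pt hr.le hω])

variable (hA : ContDiff ℝ (⊤ : ℕ∞) A) (hφ : ContDiff ℝ (⊤ : ℕ∞) φ)
include hA hφ

lemma sphI_out {t r : ℝ} (hr : 0 ≤ r) :
    sphI (fun p => (eDL A φ p + eDslash A φ p) * rad p ^ 2) t r
      = 2 * ENNReal.ofReal (fluxS (-1) (energyCur A φ) (t, r)) :=
  sphI_eq_two_mul_fluxS (contDiff_energyCur hA hφ)
    (fun p hp => by rw [energy_flux_out hp, eDL, dirD_Lv]; ring)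
    (fun p hp => by simp [hp]) (fun p hp => energy_flux_nonneg hp (by simp)) t hr

lemma sphI_in {t r : ℝ} (hr : 0 ≤ r) :
    sphI (fun p => (eDLb A φ p + eDslash A φ p) * rad p ^ 2) t r
      = 2 * ENNReal.ofReal (fluxS 1 (energyCur A φ) (t, r)) :=
  sphI_eq_two_mul_fluxS (contDiff_energyCur hA hφ)
    (fun p hp => by rw [energy_flux_in hp, eDLb, dirD_Lbv]; ring)
    (fun p hp => by simp [hp]) (fun p hp => energy_flux_nonneg hp (by simp)) t hr

omit hA hφ in
lemma ofReal_segI {f : ℝ × ℝ → ℝ} (hf : Continuous f) {t₀ r₀ a b s₀ s₁ : ℝ} (hs : s₀ ≤ s₁)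
    (h0 : ∀ s ∈ Icc s₀ s₁, 0 ≤ f (t₀ + a * s, r₀ + b * s)) :
    ENNReal.ofReal (segI t₀ r₀ a b s₀ s₁ f)
      = ∫⁻ s in Icc s₀ s₁, ENNReal.ofReal (f (t₀ + a * s, r₀ + b * s)) := by
  have hc : Continuous fun s : ℝ => f (t₀ + a * s, r₀ + b * s) := hf.comp (by fun_prop)
  rw [segI, intervalIntegral.integral_of_le hs, ← integral_Icc_eq_integral_Ioc,
    ofReal_integral_eq_lintegral_ofReal (hc.continuousOn.integrableOn_compact isCompact_Icc)]
  filter_upwards [ae_restrict_mem measurableSet_Icc] with s hs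
  exact h0 s hs

lemma EphiHseg_eq {u v₀ v₁ : ℝ} (hu : u ≤ v₀) (hv : v₀ ≤ v₁) :
    EphiHseg A φ u v₀ v₁
      = 2 * ENNReal.ofReal (segI u (-u) 1 1 v₀ v₁ (fluxS (-1) (energyCur A φ))) := by
  rw [ofReal_segI (continuous_fluxS (contDiff_energyCur hA hφ) _) hv,
    ← lintegral_const_mul' _ _ ENNReal.ofNat_ne_top]
  · refine setLIntegral_congr_fun measurableSet_Icc fun v hv => ?_
    have : 0 ≤ v - u := by linarith [hv.1]
    rw [sphI_out hA hφ this]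
    congr 4 <;> ring
  · intro v hv
    exact fluxS_energy_nonneg hA hφ (by simp) (by simp only; linarith [hv.1])

lemma EphiHb_eq {v u₀ u₁ : ℝ} (hu : u₀ ≤ u₁) (hv : u₁ ≤ v) :
    EphiHb A φ v u₀ u₁
      = 2 * ENNReal.ofReal (segI v v 1 (-1) u₀ u₁ (fluxS 1 (energyCur A φ))) := by
  rw [ofReal_segI (continuous_fluxS (contDiff_energyCur hA hφ) _) hu,
    ← lintegral_const_mul' _ _ ENNReal.ofNat_ne_top]
  · refine setLIntegral_congr_fun measurableSet_Icc fun u hu => ?_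
    have : 0 ≤ v - u := by linarith [hu.2]
    rw [sphI_in hA hφ this]
    congr 4 <;> ring
  · intro u hu
    exact fluxS_energy_nonneg hA hφ (by simp) (by simp only; linarith [hu.2])

omit hA hφ in
lemma EphiHseg_le_EphiH (u v₀ v₁ : ℝ) : EphiHseg A φ u v₀ v₁ ≤ EphiH A φ u v₀ :=
  lintegral_mono_set Icc_subset_Ici_self

lemma avg_rad_sq_eD {z : ℝ × ℝ} (hz : 0 < z.2) :
    avg (fun p => rad p ^ 2 * eD A φ p) z = 2 * fluxS 0 (energyCur A φ) z := by
  rw [fluxS_eq_avg (contDiff_energyCur hA hφ) 0 hz (F := fun p => 1 / 2 * (rad p ^ 2 * eD A φ p)),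
    avg_const_mul]
  · ring
  · intro p _
    rw [energyCur_zero]; ring

lemma lintegral_slice {κ : NNReal} (hκ : IsPolarConst κ) {K : Set ℝ} (hK : MeasurableSet K) (t : ℝ) :
    ∫⁻ x in {x : E3 | ‖x‖ ∈ K}, oR (eD A φ (stp t x))
      = κ * (2 * ∫⁻ r in K ∩ Ioi 0, ENNReal.ofReal (fluxS 0 (energyCur A φ) (t, r))) := by
  rw [lintegral_space hκ hK (continuous_eD hA hφ) (fun _ => eD_nonneg),
    ← lintegral_const_mul' _ _ ENNReal.ofNat_ne_top]
  congr 1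
  refine setLIntegral_congr_fun (hK.inter measurableSet_Ioi) fun r hr => ?_
  rw [avg_rad_sq_eD hA hφ (z := (t, r)) hr.2, ENNReal.ofReal_mul zero_le_two]
  simp

lemma lIntBall_eq {κ : NNReal} (hκ : IsPolarConst κ) {R : ℝ} (hR : 0 ≤ R) (t : ℝ) :
    lIntBall t R (eD A φ)
      = κ * (2 * ENNReal.ofReal (segI t 0 0 1 0 R (fluxS 0 (energyCur A φ)))) := by
  have h : closedBall (0 : E3) R = {x : E3 | ‖x‖ ∈ Iic R} := by ext; simp
  rw [lIntBall, h, lintegral_slice hA hφ hκ measurableSet_Iic,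
    ofReal_segI (continuous_fluxS (contDiff_energyCur hA hφ) _) hR]
  · rw [Iic_inter_Ioi, Measure.restrict_congr_set Ioc_ae_eq_Icc]
    simp
  · intro r hr
    exact fluxS_energy_nonneg hA hφ (by simp) (by simpa using hr.1)

lemma lIntExt_eq {κ : NNReal} (hκ : IsPolarConst κ) {r₀ : ℝ} (hr₀ : 0 < r₀) (t : ℝ) :
    lIntExt t r₀ (eD A φ)
      = κ * (2 * ∫⁻ r in Ici r₀, ENNReal.ofReal (fluxS 0 (energyCur A φ) (t, r))) := by
  have h : Ici r₀ ∩ Ioi 0 = Ici r₀ := inter_eq_left.2 fun x hx => hr₀.trans_le hx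
  rw [← h]
  exact lintegral_slice hA hφ hκ measurableSet_Ici t

lemma ofReal_segI_le_lIntExt {κ : NNReal} (hκ : IsPolarConst κ) {r₀ r₁ : ℝ} (hr₀ : 0 < r₀)
    (h : r₀ ≤ r₁) (t : ℝ) :
    κ * (2 * ENNReal.ofReal (segI t 0 0 1 r₀ r₁ (fluxS 0 (energyCur A φ))))
      ≤ lIntExt t r₀ (eD A φ) := by
  rw [lIntExt_eq hA hφ hκ hr₀, ofReal_segI (continuous_fluxS (contDiff_energyCur hA hφ) _) h]
  · simp only [zero_mul, add_zero, one_mul, zero_add]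
    gcongr
    exact Icc_subset_Ici_self
  · intro r hr
    exact fluxS_energy_nonneg hA hφ (by simp) (by simpa using hr₀.le.trans hr.1)

lemma ofReal_mul_nA_le_lIntExt {κ : NNReal} (hκ : IsPolarConst κ) (hs : vanishSpatialInf φ)
    {r₀ r : ℝ} (hr₀ : 0 < r₀) (h : r₀ ≤ r) :
    κ * ENNReal.ofReal (r * nA φ (0, r)) ≤ lIntExt 0 r₀ (eD A φ) := by
  rw [lIntExt_eq hA hφ hκ hr₀]
  gcongr
  have := ofReal_radius_mul_nA_le hA hφ (σ := 0) (a := 0) (t := 0) (Or.inl ⟨rfl, rfl, rfl⟩)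
    (hr₀.trans_le h) (by simpa [vanishSpatialInf] using hs)
  simp only [zero_mul, add_zero] at this
  refine this.trans ?_
  gcongr

lemma ofReal_mul_nA_le_EphiH (hn : vanishNullInf φ) {u v₀ d : ℝ} (hu : u < d) (hd : v₀ ≤ d) : ENNReal.ofReal ((d - u) * nA φ (u + d, d - u)) ≤ EphiH A φ u v₀ := by
  have ht : ∀ ω : E3, ‖ω‖ = 1 →
      Filter.Tendsto (fun ρ => φ (pt (2 * u + 1 * ρ) ρ ω)) Filter.atTop (nhds 0) := by
    intro ω hω
    have := (hn u ω hω).comp (Filter.tendsto_atTop_add_const_right Filter.atTop u Filter.tendsto_id)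
    refine this.congr fun ρ => ?_
    simp only [Function.comp_apply, id]
    congr 2 <;> ring
  have h := ofReal_radius_mul_nA_le hA hφ (σ := -1) (a := 1) (t := 2 * u)
    (Or.inr (Or.inl ⟨rfl, rfl, rfl⟩)) (sub_pos.2 hu) ht
  rw [show 2 * u + 1 * (d - u) = u + d by ring] at h
  refine h.trans ?_
  have hshift : ∫⁻ ρ in Ici (d - u), ENNReal.ofReal (fluxS (-1) (energyCur A φ) (2 * u + 1 * ρ, ρ))
      = ∫⁻ v in Ici d, ENNReal.ofReal (fluxS (-1) (energyCur A φ) (u + v, v - u)) := by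
    have hm := measurePreserving_sub_right (volume : Measure ℝ) u
    have he : MeasurableEmbedding fun v : ℝ => v - u := (MeasurableEquiv.subRight u).measurableEmbedding
    rw [← hm.setLIntegral_comp_preimage_emb he]
    have : (fun v : ℝ => v - u) ⁻¹' Ici (d - u) = Ici d := by ext; simp
    rw [this]
    refine lintegral_congr fun v => ?_
    congr 3; ring
  rw [hshift, ← lintegral_const_mul' _ _ ENNReal.ofNat_ne_top, EphiH, lIntH]
  refine (setLIntegral_congr_fun measurableSet_Ici fun v hv' => ?_).trans_le
    (lintegral_mono_set (Ici_subset_Ici.2 hd))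
  exact (sphI_out hA hφ (by linarith [show d ≤ v from hv'])).symm

omit hA hφ in
lemma EphiH_le_of_forall_EphiHseg_le {u v₀ : ℝ} {B : ℝ≥0∞} (c : ℝ)
    (h : ∀ d, c ≤ d → EphiHseg A φ u v₀ d ≤ B) : EphiH A φ u v₀ ≤ B := by
  have hU : Ici v₀ = ⋃ n : ℕ, Icc v₀ (c + n) := by
    ext v
    simp only [mem_Ici, mem_iUnion, mem_Icc, exists_and_left, iff_self_and]
    intro _
    obtain ⟨n, hn⟩ := exists_nat_ge (v - c)
    exact ⟨n, by linarith⟩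
  have hmono : Monotone fun n : ℕ => Icc v₀ (c + n) := fun m n hmn =>
    Icc_subset_Icc_right (by gcongr)
  rw [EphiH, lIntH, hU, setLIntegral_iUnion_of_directed _ hmono.directed_le]
  exact iSup_le fun n : ℕ => h (c + n) (by simp)

omit hA hφ in
lemma lintegral_compact_region {κ : NNReal} (hκ : IsPolarConst κ) {K : Set (ℝ × ℝ)}
    (hK : IsCompact K) (hr : ∀ z ∈ K, 0 ≤ z.2) {g : V → ℝ}
    (hG : Continuous fun p => rad p ^ 2 * g p) (g0 : ∀ p, 0 ≤ g p) :
    ∫⁻ p in {p : V | (tC p, rad p) ∈ K}, oR (g p)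
      = κ * ENNReal.ofReal (∫ z in K, avg (fun p => rad p ^ 2 * g p) z) := by
  have hpos : MeasurableSet {z : ℝ × ℝ | 0 < z.2} := measurableSet_lt measurable_const measurable_snd
  rw [lintegral_region hκ hK.measurableSet hG g0, ofReal_integral_eq_lintegral_ofReal
    ((continuous_avg hG).continuousOn.integrableOn_compact hK)
    (Filter.Eventually.of_forall fun z => avg_nonneg (fun p => mul_nonneg (sq_nonneg _) (g0 p)) z)]
  congr 1
  rw [← lintegral_indicator (hK.measurableSet.inter hpos), ← lintegral_indicator hK.measurableSet]
  refine lintegral_congr fun z => ?_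
  by_cases hz : z ∈ K
  · rcases (hr z hz).eq_or_lt with h | h
    · rw [indicator_of_notMem (fun h' => h'.2.ne h), indicator_of_mem hz, avg,
        integral_congr_ae (g := fun _ => 0)]
      · simp
      filter_upwards [ae_sphMeas] with ω hω
      rw [rad_pt h.le hω, ← h]; simp
    · rw [indicator_of_mem (show z ∈ K ∩ {z | 0 < z.2} from ⟨hz, h⟩), indicator_of_mem hz]
  · rw [indicator_of_notMem (fun h' => hz h'.1), indicator_of_notMem hz]

end Conversion

end

section

/-! ## The energy estimates -/

section Final
variable {A : V → Fin 4 → ℝ} {φ : V → ℂ} {ε : ℝ}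

lemma wI_eDbar_le (ε : ℝ) (D : Set V) :
    wI (-(1 + ε)) 0 (eDbar A φ) D ≤ ∫⁻ p in D, oR (gDen ε A φ p) := by
  refine lintegral_mono fun p => ENNReal.ofReal_le_ofReal ?_
  have h : 0 ≤ eDslash A φ p / (1 + rad p) :=
    div_nonneg eDslash_nonneg (by linarith [rad_nonneg p])
  rw [gDen, Real.rpow_zero, one_mul]
  linarith

lemma lintegral_eDslash_le (ε : ℝ) (D : Set V) :
    ∫⁻ p in D, oR (eDslash A φ p / (1 + rad p)) ≤ ∫⁻ p in D, oR (gDen ε A φ p) := by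
  refine lintegral_mono fun p => ENNReal.ofReal_le_ofReal ?_
  have h : 0 ≤ rplus p ^ (-(1 + ε)) * eDbar A φ p :=
    mul_nonneg (Real.rpow_nonneg rplus_pos.le _) eDbar_nonneg
  rw [gDen]
  linarith

lemma wI_boxA_eq (ε : ℝ) (D : Set V) :
    wI (1 + ε) 0 (fun p => ‖boxA A φ p‖ ^ 2) D = ∫⁻ p in D, oR (wDen ε A φ p) := by
  refine lintegral_congr fun p => ?_
  rw [wDen, Real.rpow_zero, one_mul]

lemma ofReal_le_of_mul_le {κ : NNReal} (hκ : 0 < κ) {a : ℝ} {X : ℝ≥0∞}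
    (h : κ * ENNReal.ofReal a ≤ X) : ENNReal.ofReal a ≤ ENNReal.ofReal (1 / κ) * X := by
  have e : ENNReal.ofReal (1 / κ) * κ = 1 := by
    rw [← ENNReal.ofReal_coe_nnreal, ← ENNReal.ofReal_mul (by positivity),
      one_div_mul_cancel (by exact_mod_cast hκ.ne'), ENNReal.ofReal_one]
  calc ENNReal.ofReal a = ENNReal.ofReal (1 / κ) * (κ * ENNReal.ofReal a) := by
        rw [← mul_assoc, e, one_mul]
    _ ≤ _ := by gcongr

lemma mul_two_le {a b X : ℝ≥0∞} (h : a * (2 * b) ≤ X) : a * b ≤ X :=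
  (by gcongr; exact le_mul_of_one_le_left' one_le_two : a * b ≤ a * (2 * b)).trans h

lemma mul_ofReal_le {κ c M : ℝ} {a : ℝ} {X : ℝ≥0∞} (hκ : 0 ≤ κ) (hc : 0 ≤ c)
    (h : ENNReal.ofReal a ≤ ENNReal.ofReal M * X) :
    ENNReal.ofReal κ * (ENNReal.ofReal c * ENNReal.ofReal a) ≤ ENNReal.ofReal (κ * c * M) * X := by
  rw [ENNReal.ofReal_mul (by positivity), ENNReal.ofReal_mul hκ]
  calc _ ≤ ENNReal.ofReal κ * (ENNReal.ofReal c * (ENNReal.ofReal M * X)) := by gcongr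
    _ = _ := by ring

lemma region_subset_Dint (R u₁ u₂ d : ℝ) (hu : 0 ≤ 2 * u₁ + R) :
    {p : V | (tC p, rad p) ∈ trap 1 R u₁ u₂ d} ⊆ Dint R (2 * u₁ + R) (2 * u₂ + R) := by
  rintro p ⟨h1, h2, h3, -⟩
  simp only at h1 h2 h3
  refine ⟨by linarith, ?_, ?_⟩ <;> unfold sigP uC <;> split_ifs <;> linarith

lemma box_subset_Dint {R u₁ u₂ : ℝ} (hu : 0 ≤ 2 * u₁ + R) :
    {p : V | (tC p, rad p) ∈ Icc (2 * u₁ + R) (2 * u₂ + R) ×ˢ Icc 0 R}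
      ⊆ Dint R (2 * u₁ + R) (2 * u₂ + R) := by
  rintro p ⟨⟨h1, h2⟩, -, h3⟩
  simp only at h1 h2 h3
  refine ⟨by linarith, ?_, ?_⟩ <;> rw [sigP, if_pos h3] <;> assumption

lemma Dint_subset (R u₁ u₂ d : ℝ) :
    Dint R (2 * u₁ + R) (2 * u₂ + R) ∩ {p | vC p ≤ d}
      ⊆ {p : V | (tC p, rad p) ∈ Icc (2 * u₁ + R) (2 * u₂ + R) ×ˢ Icc 0 R}
        ∪ {p : V | (tC p, rad p) ∈ trap 1 R u₁ u₂ d} := by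
  rintro p ⟨⟨-, h1, h2⟩, h3⟩
  have hr := rad_nonneg p
  simp only [sigP, uC] at h1 h2
  simp only [vC, mem_ofPred_eq] at h3
  split_ifs at h1 h2 with h
  · exact Or.inl ⟨⟨h1, h2⟩, hr, h⟩
  · refine Or.inr ⟨?_, ?_, ?_, h3⟩ <;> simp only <;> linarith

lemma lintegral_Dint_le {R τ₁ τ₂ : ℝ} {g : V → ℝ≥0∞} {B : ℝ≥0∞} (c : ℝ)
    (h : ∀ d, c ≤ d → ∫⁻ p in Dint R τ₁ τ₂ ∩ {p | vC p ≤ d}, g p ≤ B) :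
    ∫⁻ p in Dint R τ₁ τ₂, g p ≤ B := by
  have hU : Dint R τ₁ τ₂ = ⋃ n : ℕ, Dint R τ₁ τ₂ ∩ {p | vC p ≤ c + n} := by
    rw [← inter_iUnion, eq_comm, inter_eq_left]
    intro p _
    obtain ⟨n, hn⟩ := exists_nat_ge (vC p - c)
    exact mem_iUnion.2 ⟨n, show vC p ≤ c + n by linarith⟩
  have hmono : Monotone fun n : ℕ => Dint R τ₁ τ₂ ∩ {p | vC p ≤ c + n} := fun m n hmn p hp =>
    ⟨hp.1, show vC p ≤ c + n from
      (show vC p ≤ c + m from hp.2).trans (by gcongr)⟩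
  rw [hU, setLIntegral_iUnion_of_directed _ hmono.directed_le]
  exact iSup_le fun n : ℕ => h (c + n) (by simp)

lemma Dext_eq (u₁ u₂ R : ℝ) :
    Dext R (2 * u₂ + R) (2 * u₁ + R) = {p : V | (tC p, rad p) ∈ trap (-1) 0 u₁ u₂ (-u₁)} := by
  ext p
  simp only [Dext, trap, uC, vC, mem_ofPred_eq]
  have hr := rad_nonneg p
  constructor
  · rintro ⟨h1, h2, h3⟩
    refine ⟨?_, ?_, ?_, ?_⟩ <;> linarith
  · rintro ⟨h1, h2, h3, h4⟩
    refine ⟨?_, ?_, ?_⟩ <;> linarith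

/-- The integrated local energy estimate in the interior region. -/
lemma exists_interior_estimate (hε : 0 < ε) : ∃ C : ℝ, 0 < C ∧ ∀ (A : V → Fin 4 → ℝ) (φ : V → ℂ),
    ContDiff ℝ (⊤ : ℕ∞) A → ContDiff ℝ (⊤ : ℕ∞) φ → vanishNullInf φ →
    ∀ R u₁ u₂ v : ℝ, 0 < R → 0 ≤ 2 * u₁ + R → u₁ < u₂ → u₂ + R ≤ v →
      wI (-(1 + ε)) 0 (eDbar A φ) (Dint R (2 * u₁ + R) (2 * u₂ + R))
        + (lIntBall (2 * u₂ + R) R (eD A φ) + EphiH A φ u₂ (u₂ + R))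
        + EphiHb A φ v u₁ u₂
        + (∫⁻ p in Dint R (2 * u₁ + R) (2 * u₂ + R), oR (eDslash A φ p / (1 + rad p)))
      ≤ oR C * ((lIntBall (2 * u₁ + R) R (eD A φ) + EphiH A φ u₁ (u₁ + R))
        + wI (1 + ε) 0 (fun p => ‖boxA A φ p‖ ^ 2) (Dint R (2 * u₁ + R) (2 * u₂ + R))
        + ∫⁻ p in Dint R (2 * u₁ + R) (2 * u₂ + R), oR (kDen A φ p)) := by
  obtain ⟨C, hC, hmain⟩ := exists_interior_energy_bound hε
  obtain ⟨κ, hκ, hpol⟩ := exists_polar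
  have hpol : IsPolarConst κ := hpol
  have hκ' : (0 : ℝ) < κ := by exact_mod_cast hκ
  set M : ℝ := C * (5 / κ + 2) with hM
  have hM0 : 0 < M := by positivity
  refine ⟨4 * (κ + 1) * M, by positivity, ?_⟩
  intro A φ hA hφ hn R u₁ u₂ v hR hu₁ hu hv
  rw [wI_boxA_eq]
  set D := Dint R (2 * u₁ + R) (2 * u₂ + R) with hD
  set X : ℝ≥0∞ := lIntBall (2 * u₁ + R) R (eD A φ) + EphiH A φ u₁ (u₁ + R)
    + (∫⁻ p in D, oR (wDen ε A φ p)) + ∫⁻ p in D, oR (kDen A φ p) with hX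
  have hXB : lIntBall (2 * u₁ + R) R (eD A φ) ≤ X :=
    (le_add_right le_rfl).trans ((le_add_right le_rfl).trans (le_add_right le_rfl))
  have hXH : EphiH A φ u₁ (u₁ + R) ≤ X :=
    (le_add_left le_rfl).trans ((le_add_right le_rfl).trans (le_add_right le_rfl))
  have hXW : ∫⁻ p in D, oR (wDen ε A φ p) ≤ X := (le_add_left le_rfl).trans (le_add_right le_rfl)
  have hXK : ∫⁻ p in D, oR (kDen A φ p) ≤ X := le_add_left le_rfl
  set box : Set (ℝ × ℝ) := Icc (2 * u₁ + R) (2 * u₂ + R) ×ˢ Icc 0 R with hbox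
  have cbox : IsCompact box := isCompact_Icc.prod isCompact_Icc
  have rbox : ∀ z ∈ box, 0 ≤ z.2 := fun z hz => hz.2.1
  have rtrap : ∀ d, ∀ z ∈ trap 1 R u₁ u₂ d, 0 ≤ z.2 := fun d z hz => by linarith [hz.2.2.1]
  have cg := continuous_rad_sq_gDen hA hφ ε
  have cw : Continuous fun p => rad p ^ 2 * wDen ε A φ p :=
    (continuous_rad.pow 2).mul (continuous_wDen hA hφ ε)
  have ck := continuous_rad_sq_kDen hA hφ
  have gn : ∀ z, 0 ≤ gA ε A φ z := avg_nonneg fun p => mul_nonneg (sq_nonneg _) gDen_nonneg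
  have fn : ∀ σ : ℝ, σ = 0 ∨ σ = -1 ∨ σ = 1 → ∀ z : ℝ × ℝ, 0 ≤ z.2 →
      0 ≤ fluxS σ (energyCur A φ) z := fun σ hσ z hz => fluxS_energy_nonneg hA hφ hσ hz
  have key : ∀ d, v ≤ d →
      ENNReal.ofReal ((∫ z in box, gA ε A φ z) + ∫ z in trap 1 R u₁ u₂ d, gA ε A φ z)
          ≤ ENNReal.ofReal M * X
        ∧ ENNReal.ofReal (segI (2 * u₂ + R) 0 0 1 0 R (fluxS 0 (energyCur A φ)))
          ≤ ENNReal.ofReal M * X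
        ∧ ENNReal.ofReal (segI u₂ (-u₂) 1 1 (u₂ + R) d (fluxS (-1) (energyCur A φ)))
          ≤ ENNReal.ofReal M * X
        ∧ ENNReal.ofReal (segI d d 1 (-1) u₁ u₂ (fluxS 1 (energyCur A φ)))
          ≤ ENNReal.ofReal M * X := by
    intro d hd
    have h := hmain A φ hA hφ R u₁ u₂ d hR.le hu.le (hv.trans hd)
    rw [← hbox] at h
    have bS : ENNReal.ofReal (segI (2 * u₁ + R) 0 0 1 0 R (fluxS 0 (energyCur A φ)))
        ≤ ENNReal.ofReal (1 / κ) * X := by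
      refine ofReal_le_of_mul_le hκ (mul_two_le ?_)
      rw [← lIntBall_eq hA hφ hpol hR.le]; exact hXB
    have bC : ENNReal.ofReal (segI u₁ (-u₁) 1 1 (u₁ + R) d (fluxS (-1) (energyCur A φ))) ≤ X := by
      have e := EphiHseg_eq hA hφ (u := u₁) (v₀ := u₁ + R) (v₁ := d) (by linarith) (by linarith)
      refine (le_mul_of_one_le_left' one_le_two).trans (e.symm.trans_le ?_)
      exact (EphiHseg_le_EphiH _ _ _).trans hXH
    have bN : ENNReal.ofReal ((d - u₁) * nA φ (u₁ + d, d - u₁)) ≤ X :=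
      (ofReal_mul_nA_le_EphiH hA hφ hn (by linarith) (by linarith)).trans hXH
    have bulk : ∀ {g : V → ℝ}, Continuous (fun p => rad p ^ 2 * g p) → (∀ p, 0 ≤ g p) →
        ∫⁻ p in D, oR (g p) ≤ X →
        ENNReal.ofReal ((∫ z in box, avg (fun p => rad p ^ 2 * g p) z)
          + ∫ z in trap 1 R u₁ u₂ d, avg (fun p => rad p ^ 2 * g p) z)
          ≤ ENNReal.ofReal (2 / κ) * X := by
      intro g hg g0 hgX
      have b1 : ENNReal.ofReal (∫ z in box, avg (fun p => rad p ^ 2 * g p) z)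
          ≤ ENNReal.ofReal (1 / κ) * X := by
        refine ofReal_le_of_mul_le hκ ?_
        rw [← lintegral_compact_region hpol cbox rbox hg g0]
        exact (lintegral_mono_set (box_subset_Dint hu₁)).trans hgX
      have b2 : ENNReal.ofReal (∫ z in trap 1 R u₁ u₂ d, avg (fun p => rad p ^ 2 * g p) z)
          ≤ ENNReal.ofReal (1 / κ) * X := by
        refine ofReal_le_of_mul_le hκ ?_
        rw [← lintegral_compact_region hpol (isCompact_trap _ _ _ _ _) (rtrap d) hg g0]
        exact (lintegral_mono_set (region_subset_Dint R u₁ u₂ d hu₁)).trans hgX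
      refine ENNReal.ofReal_add_le.trans ((add_le_add b1 b2).trans_eq ?_)
      rw [← add_mul, ← ENNReal.ofReal_add (by positivity) (by positivity)]
      congr 2; ring
    have bW := bulk cw (fun _ => wDen_nonneg) hXW
    have bK := bulk ck (fun _ => kDen_nonneg) hXK
    have hX1 : X = ENNReal.ofReal 1 * X := by simp
    have hR' := ENNReal.ofReal_le_ofReal h
    rw [ENNReal.ofReal_mul hC.le] at hR'
    have hub : ∀ {a}, ENNReal.ofReal a ≤ _ → ENNReal.ofReal a ≤ ENNReal.ofReal M * X :=
      fun {a} ha => ha.trans <| hR'.trans <| by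
        rw [hM, ENNReal.ofReal_mul hC.le, mul_assoc (ENNReal.ofReal C)]
        refine mul_le_mul' le_rfl ?_
        refine ENNReal.ofReal_add_le.trans ((add_le_add (ENNReal.ofReal_add_le.trans
          (add_le_add (ENNReal.ofReal_add_le.trans (add_le_add (ENNReal.ofReal_add_le.trans
            (add_le_add bS (bC.trans_eq hX1))) (bN.trans_eq hX1))) bW)) bK).trans_eq ?_)
        rw [← add_mul, ← add_mul, ← add_mul, ← add_mul,
          ← ENNReal.ofReal_add (by positivity) (by positivity),
          ← ENNReal.ofReal_add (by positivity) (by positivity),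
          ← ENNReal.ofReal_add (by positivity) (by positivity),
          ← ENNReal.ofReal_add (by positivity) (by positivity)]
        congr 2; ring
    have n1 : 0 ≤ ∫ z in box, gA ε A φ z := integral_nonneg gn
    have n2 : 0 ≤ ∫ z in trap 1 R u₁ u₂ d, gA ε A φ z := integral_nonneg gn
    have n3 : 0 ≤ segI (2 * u₂ + R) 0 0 1 0 R (fluxS 0 (energyCur A φ)) :=
      segI_nonneg hR.le (fun s hs => by linarith [hs.1]) (fn 0 (by simp))
    have n4 : 0 ≤ segI u₂ (-u₂) 1 1 (u₂ + R) d (fluxS (-1) (energyCur A φ)) :=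
      segI_nonneg (by linarith) (fun s hs => by linarith [hs.1]) (fn _ (by simp))
    have n5 : 0 ≤ segI d d 1 (-1) u₁ u₂ (fluxS 1 (energyCur A φ)) :=
      segI_nonneg hu.le (fun s hs => by linarith [hs.2]) (fn _ (by simp))
    refine ⟨hub (ENNReal.ofReal_le_ofReal ?_), hub (ENNReal.ofReal_le_ofReal ?_),
      hub (ENNReal.ofReal_le_ofReal ?_), hub (ENNReal.ofReal_le_ofReal ?_)⟩ <;> linarith
  have bG : ∫⁻ p in D, oR (gDen ε A φ p) ≤ ENNReal.ofReal (κ * 1 * M) * X := by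
    refine lintegral_Dint_le v fun d hd => ?_
    refine (lintegral_mono_set (Dint_subset R u₁ u₂ d)).trans ((lintegral_union_le _ _ _).trans ?_)
    rw [lintegral_compact_region hpol cbox rbox cg fun _ => gDen_nonneg,
      lintegral_compact_region hpol (isCompact_trap _ _ _ _ _) (rtrap d) cg fun _ => gDen_nonneg,
      ← mul_add]
    change κ * (ENNReal.ofReal (∫ z in box, gA ε A φ z)
      + ENNReal.ofReal (∫ z in trap 1 R u₁ u₂ d, gA ε A φ z)) ≤ _
    rw [← ENNReal.ofReal_add (integral_nonneg gn) (integral_nonneg gn)]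
    simpa using mul_ofReal_le hκ'.le zero_le_one (key d hd).1
  have bS : lIntBall (2 * u₂ + R) R (eD A φ) ≤ ENNReal.ofReal (κ * 2 * M) * X := by
    rw [lIntBall_eq hA hφ hpol hR.le]
    simpa using mul_ofReal_le hκ'.le zero_le_two (key v le_rfl).2.1
  have bC : EphiH A φ u₂ (u₂ + R) ≤ ENNReal.ofReal (1 * 2 * M) * X := by
    refine EphiH_le_of_forall_EphiHseg_le v fun d hd => ?_
    rw [EphiHseg_eq hA hφ (by linarith) (by linarith)]
    simpa using mul_ofReal_le zero_le_one zero_le_two (key d hd).2.2.1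
  have bB : EphiHb A φ v u₁ u₂ ≤ ENNReal.ofReal (1 * 2 * M) * X := by
    rw [EphiHb_eq hA hφ hu.le (by linarith)]
    simpa using mul_ofReal_le zero_le_one zero_le_two (key v le_rfl).2.2.2
  refine (add_le_add (add_le_add (add_le_add ((wI_eDbar_le ε D).trans bG) (add_le_add bS bC)) bB)
    ((lintegral_eDslash_le ε D).trans bG)).trans_eq ?_
  rw [← add_mul, ← add_mul, ← add_mul, ← add_mul,
    ← ENNReal.ofReal_add (by positivity) (by positivity),
    ← ENNReal.ofReal_add (by positivity) (by positivity),
    ← ENNReal.ofReal_add (by positivity) (by positivity),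
    ← ENNReal.ofReal_add (by positivity) (by positivity), oR]
  congr 2; ring

/-- The integrated local energy estimate in the exterior region. -/
lemma exists_exterior_estimate (hε : 0 < ε) : ∃ C : ℝ, 0 < C ∧ ∀ (A : V → Fin 4 → ℝ) (φ : V → ℂ),
    ContDiff ℝ (⊤ : ℕ∞) A → ContDiff ℝ (⊤ : ℕ∞) φ → vanishSpatialInf φ →
    ∀ R u₁ u₂ : ℝ, u₁ ≤ u₂ → u₂ < 0 →
      wI (-(1 + ε)) 0 (eDbar A φ) (Dext R (2 * u₂ + R) (2 * u₁ + R))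
        + EphiHseg A φ u₂ (-u₂) (-u₁) + EphiHb A φ (-u₁) u₁ u₂
      ≤ oR C * (lIntExt 0 (-2 * u₂) (eD A φ)
        + wI (1 + ε) 0 (fun p => ‖boxA A φ p‖ ^ 2) (Dext R (2 * u₂ + R) (2 * u₁ + R))
        + ∫⁻ p in Dext R (2 * u₂ + R) (2 * u₁ + R), oR (kDen A φ p)) := by
  obtain ⟨C, hC, hmain⟩ := exists_exterior_energy_bound hε
  obtain ⟨κ, hκ, hpol⟩ := exists_polar
  have hpol : IsPolarConst κ := hpol
  have hκ' : (0 : ℝ) < κ := by exact_mod_cast hκ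
  set M : ℝ := C * (4 / κ) with hM
  have hM0 : 0 < M := by positivity
  refine ⟨(κ + 4) * M, by positivity, ?_⟩
  intro A φ hA hφ hs R u₁ u₂ hu hu₂
  rw [wI_boxA_eq, Dext_eq u₁ u₂ R]
  set K : Set (ℝ × ℝ) := trap (-1) 0 u₁ u₂ (-u₁) with hK
  set D := {p : V | (tC p, rad p) ∈ K} with hD
  set X : ℝ≥0∞ := lIntExt 0 (-2 * u₂) (eD A φ)
    + (∫⁻ p in D, oR (wDen ε A φ p)) + ∫⁻ p in D, oR (kDen A φ p) with hX
  have hXE : lIntExt 0 (-2 * u₂) (eD A φ) ≤ X := (le_add_right le_rfl).trans (le_add_right le_rfl)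
  have hXW : ∫⁻ p in D, oR (wDen ε A φ p) ≤ X := (le_add_left le_rfl).trans (le_add_right le_rfl)
  have hXK : ∫⁻ p in D, oR (kDen A φ p) ≤ X := le_add_left le_rfl
  have rK : ∀ z ∈ K, 0 ≤ z.2 := fun z hz => by linarith [hz.2.1, hz.2.2.1]
  have cK : IsCompact K := isCompact_trap _ _ _ _ _
  have cg := continuous_rad_sq_gDen hA hφ ε
  have cw : Continuous fun p => rad p ^ 2 * wDen ε A φ p :=
    (continuous_rad.pow 2).mul (continuous_wDen hA hφ ε)
  have ck := continuous_rad_sq_kDen hA hφ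
  have gn : ∀ z, 0 ≤ gA ε A φ z := avg_nonneg fun p => mul_nonneg (sq_nonneg _) gDen_nonneg
  have fn : ∀ σ : ℝ, σ = 0 ∨ σ = -1 ∨ σ = 1 → ∀ z : ℝ × ℝ, 0 ≤ z.2 →
      0 ≤ fluxS σ (energyCur A φ) z := fun σ hσ z hz => fluxS_energy_nonneg hA hφ hσ hz
  have h := hmain A φ hA hφ u₁ u₂ hu hu₂.le
  rw [← hK] at h
  have bS : ENNReal.ofReal (segI 0 0 0 1 (-2 * u₂) (-2 * u₁) (fluxS 0 (energyCur A φ)))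
      ≤ ENNReal.ofReal (1 / κ) * X :=
    ofReal_le_of_mul_le hκ (mul_two_le ((ofReal_segI_le_lIntExt hA hφ hpol (by linarith)
      (by linarith) 0).trans hXE))
  have bN : ENNReal.ofReal (-2 * u₁ * nA φ (0, -2 * u₁)) ≤ ENNReal.ofReal (1 / κ) * X :=
    ofReal_le_of_mul_le hκ ((ofReal_mul_nA_le_lIntExt hA hφ hpol hs (by linarith)
      (by linarith)).trans hXE)
  have bW : ENNReal.ofReal (∫ z in K, wA ε A φ z) ≤ ENNReal.ofReal (1 / κ) * X :=
    ofReal_le_of_mul_le hκ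
      ((lintegral_compact_region hpol cK rK cw fun _ => wDen_nonneg).symm.trans_le hXW)
  have bK : ENNReal.ofReal (∫ z in K, kA A φ z) ≤ ENNReal.ofReal (1 / κ) * X :=
    ofReal_le_of_mul_le hκ
      ((lintegral_compact_region hpol cK rK ck fun _ => kDen_nonneg).symm.trans_le hXK)
  have hR' := ENNReal.ofReal_le_ofReal h
  rw [ENNReal.ofReal_mul hC.le] at hR'
  have hub : ∀ {a}, ENNReal.ofReal a ≤ _ → ENNReal.ofReal a ≤ ENNReal.ofReal M * X :=
    fun {a} ha => ha.trans <| hR'.trans <| by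
      rw [hM, ENNReal.ofReal_mul hC.le, mul_assoc (ENNReal.ofReal C)]
      refine mul_le_mul' le_rfl ?_
      refine ENNReal.ofReal_add_le.trans ((add_le_add (ENNReal.ofReal_add_le.trans
        (add_le_add (ENNReal.ofReal_add_le.trans (add_le_add bS bN)) bW)) bK).trans_eq ?_)
      rw [← add_mul, ← add_mul, ← add_mul,
        ← ENNReal.ofReal_add (by positivity) (by positivity),
        ← ENNReal.ofReal_add (by positivity) (by positivity),
        ← ENNReal.ofReal_add (by positivity) (by positivity)]
      congr 2; ring
  have n1 : 0 ≤ ∫ z in K, gA ε A φ z := integral_nonneg gn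
  have n2 : 0 ≤ segI u₂ (-u₂) 1 1 (-u₂) (-u₁) (fluxS (-1) (energyCur A φ)) :=
    segI_nonneg (by linarith) (fun s hs => by linarith [hs.1]) (fn _ (by simp))
  have n3 : 0 ≤ segI (-u₁) (-u₁) 1 (-1) u₁ u₂ (fluxS 1 (energyCur A φ)) :=
    segI_nonneg hu (fun s hs => by linarith [hs.2]) (fn _ (by simp))
  have bG : ∫⁻ p in D, oR (gDen ε A φ p) ≤ ENNReal.ofReal (κ * 1 * M) * X := by
    rw [lintegral_compact_region hpol cK rK cg fun _ => gDen_nonneg]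
    simpa [gA] using mul_ofReal_le hκ'.le zero_le_one
      (hub (ENNReal.ofReal_le_ofReal (by linarith : ∫ z in K, gA ε A φ z ≤ _)))
  have bC : EphiHseg A φ u₂ (-u₂) (-u₁) ≤ ENNReal.ofReal (1 * 2 * M) * X := by
    rw [EphiHseg_eq hA hφ (by linarith) (by linarith)]
    simpa using mul_ofReal_le zero_le_one zero_le_two (hub (ENNReal.ofReal_le_ofReal
      (by linarith : segI u₂ (-u₂) 1 1 (-u₂) (-u₁) (fluxS (-1) (energyCur A φ)) ≤ _)))
  have bB : EphiHb A φ (-u₁) u₁ u₂ ≤ ENNReal.ofReal (1 * 2 * M) * X := by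
    rw [EphiHb_eq hA hφ hu (by linarith)]
    simpa using mul_ofReal_le zero_le_one zero_le_two (hub (ENNReal.ofReal_le_ofReal
      (by linarith : segI (-u₁) (-u₁) 1 (-1) u₁ u₂ (fluxS 1 (energyCur A φ)) ≤ _)))
  refine (add_le_add (add_le_add ((wI_eDbar_le ε D).trans bG) bC) bB).trans_eq ?_
  rw [← add_mul, ← add_mul, ← ENNReal.ofReal_add (by positivity) (by positivity),
    ← ENNReal.ofReal_add (by positivity) (by positivity), oR]
  congr 2; ring

end Final

end

end MKG

open MKG in
/-- **integrated local energy estimate for the scalar field.** -/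
theorem statement4 (R γ₀ ε : ℝ) (hR : 1 < R) (hγ₀ : 0 < γ₀) (hγ₀' : γ₀ < 1) (hε : 0 < ε) :
    ∃ C : ℝ, 0 < C ∧
      ∀ (A : V → Fin 4 → ℝ) (φ : V → ℂ), ContDiff ℝ (⊤ : ℕ∞) A → ContDiff ℝ (⊤ : ℕ∞) φ →
        vanishNullInf φ → vanishSpatialInf φ →
        ((∀ τ₁ τ₂ v : ℝ, 0 ≤ τ₁ → τ₁ < τ₂ → (τ₂ + R) / 2 ≤ v →
            wI (-(1 + ε)) 0 (eDbar A φ) (Dint R τ₁ τ₂)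
              + EphiSig R A φ τ₂
              + EphiHb A φ v ((τ₁ - R) / 2) ((τ₂ - R) / 2)
              + (∫⁻ p in Dint R τ₁ τ₂, oR (eDslash A φ p / (1 + rad p)))
            ≤ oR C *
              (EphiSig R A φ τ₁
                + wI (1 + ε) 0 (fun p => ‖boxA A φ p‖ ^ 2) (Dint R τ₁ τ₂)
                + ∫⁻ p in Dint R τ₁ τ₂,
                    oR (|FJcontr (curv A) A φ Lv p| + |FJcontr (curv A) A φ Lbv p|)))
          ∧ (∀ τ₁ τ₂ : ℝ, τ₂ ≤ τ₁ → τ₁ ≤ 0 →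
            wI (-(1 + ε)) 0 (eDbar A φ) (Dext R τ₁ τ₂)
              + EphiHseg A φ ((τ₁ - R) / 2) (-((τ₁ - R) / 2)) (-((τ₂ - R) / 2))
              + EphiHb A φ (-((τ₂ - R) / 2)) ((τ₂ - R) / 2) ((τ₁ - R) / 2)
            ≤ oR C *
              (lIntExt 0 (R - τ₁) (eD A φ)
                + wI (1 + ε) 0 (fun p => ‖boxA A φ p‖ ^ 2) (Dext R τ₁ τ₂)
                + ∫⁻ p in Dext R τ₁ τ₂,
                    oR (|FJcontr (curv A) A φ Lv p| + |FJcontr (curv A) A φ Lbv p|)))) := by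
  obtain ⟨C₁, hC₁, h₁⟩ := exists_interior_estimate hε
  obtain ⟨C₂, hC₂, h₂⟩ := exists_exterior_estimate hε
  refine ⟨C₁ + C₂, by positivity, fun A φ hA hφ hn hs => ⟨?_, ?_⟩⟩
  · intro τ₁ τ₂ v h0 hτ hv
    obtain ⟨u₁, rfl⟩ : ∃ u, τ₁ = 2 * u + R := ⟨(τ₁ - R) / 2, by ring⟩
    obtain ⟨u₂, rfl⟩ : ∃ u, τ₂ = 2 * u + R := ⟨(τ₂ - R) / 2, by ring⟩
    have e : ∀ u, (2 * u + R + R) / 2 = u + R := fun u => by ring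
    rw [EphiSig, EphiSig, if_pos h0, if_pos (h0.trans hτ.le)]
    simp only [add_sub_cancel_right, mul_div_cancel_left₀ _ (two_ne_zero (α := ℝ)), e] at hv ⊢
    refine (h₁ A φ hA hφ hn R u₁ u₂ v (by linarith) h0 (by linarith) hv).trans ?_
    exact mul_le_mul' (ENNReal.ofReal_le_ofReal (by linarith)) le_rfl
  · intro τ₁ τ₂ hτ h0
    obtain ⟨u₂, rfl⟩ : ∃ u, τ₁ = 2 * u + R := ⟨(τ₁ - R) / 2, by ring⟩
    obtain ⟨u₁, rfl⟩ : ∃ u, τ₂ = 2 * u + R := ⟨(τ₂ - R) / 2, by ring⟩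
    simp only [add_sub_cancel_right, mul_div_cancel_left₀ _ (two_ne_zero (α := ℝ)),
      show R - (2 * u₂ + R) = -2 * u₂ by ring]
    refine (h₂ A φ hA hφ hs R u₁ u₂ (by linarith) (by linarith)).trans ?_
    exact mul_le_mul' (ENNReal.ofReal_le_ofReal (by linarith)) le_rfl
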